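/- Let T and U be computable consistent extensions of PA and n ≥ 1. The following are equivalent: (1) Th_{Π_n}(T) ⊄ Th(U) or T + Th_{Π_n}(U) is consistent; (2) there is a Π_n sentence in Cons(Σ_n,T) ∩ Cons(Σ_n,U) \ Th(U); (3) there is a sentence φ ∈ Cons(Δ_n,T) such that T + φ is not Π_n-conservative over U (i.e., some Π_n sentence is provable in T + φ but not in U). -/

import Mathlib

open FirstOrder Language
open scoped FirstOrder

namespace Guaspari

/-- The first-order language of arithmetic: a constant `0`, a unary function `S`,
binary functions `+` (coded `false`) and `·` (coded `true`), and a binary relation `≤`. -/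
def LA : FirstOrder.Language :=
  ⟨fun n => match n with | 0 => Unit | 1 => Unit | 2 => Bool | _ => Empty,
   fun n => match n with | 2 => Unit | _ => Empty⟩

/-- Sentences of the language of arithmetic. -/
abbrev Snt : Type := LA.Sentence

/-- Theories (sets of sentences) in the language of arithmetic. -/
abbrev Thy : Type := LA.Theory

/-- The term `0`. -/
def zeroT {α : Type} {n : ℕ} : LA.Term (α ⊕ Fin n) :=
  Constants.term (show LA.Constants from Unit.unit)

/-- The term `S t`. -/
def succT {α : Type} {n : ℕ} (t : LA.Term (α ⊕ Fin n)) : LA.Term (α ⊕ Fin n) :=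
  Functions.apply₁ (show LA.Functions 1 from Unit.unit) t

/-- The term `t + u`. -/
def addT {α : Type} {n : ℕ} (t u : LA.Term (α ⊕ Fin n)) : LA.Term (α ⊕ Fin n) :=
  Functions.apply₂ (show LA.Functions 2 from false) t u

/-- The term `t * u`. -/
def mulT {α : Type} {n : ℕ} (t u : LA.Term (α ⊕ Fin n)) : LA.Term (α ⊕ Fin n) :=
  Functions.apply₂ (show LA.Functions 2 from true) t u

/-- The atomic formula `t ≤ u`. -/
def leF {α : Type} {n : ℕ} (t u : LA.Term (α ⊕ Fin n)) : LA.BoundedFormula α n :=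
  Relations.boundedFormula₂ (show LA.Relations 2 from Unit.unit) t u

/-- The `i`-th (de Bruijn-indexed) bound variable as a term. -/
def vT {m : ℕ} (i : Fin m) : LA.Term (Empty ⊕ Fin m) := Term.var (Sum.inr i)

/-- The induction axiom for the formula `φ(x₀,…,x_{k-1}, x_k)` with induction on `x_k`,
universally closed over the parameters `x₀,…,x_{k-1}`. -/
def indAxiom {k : ℕ} (φ : LA.BoundedFormula Empty (k + 1)) : Snt :=
  let base := ∀' ((vT (Fin.last k) =' zeroT) ⟹ φ)
  let step := ∀' (φ ⟹
    ∀' ((vT (Fin.last (k + 1)) =' succT (vT (Fin.castSucc (Fin.last k)))) ⟹ φ.liftAt 1 k))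
  ((base ⊓ step) ⟹ ∀' φ).alls

/-- The axioms of Peano arithmetic `PA`: the basic axioms for `0`, `S`, `+`, `·`, `≤`,
together with the full induction scheme. -/
def PAAx : Thy :=
  {∀' ∼(succT (vT 0) =' zeroT),
   ∀' ∀' ((succT (vT 0) =' succT (vT 1)) ⟹ (vT 0 =' vT 1)),
   ∀' (addT (vT 0) zeroT =' vT 0),
   ∀' ∀' (addT (vT 0) (succT (vT 1)) =' succT (addT (vT 0) (vT 1))),
   ∀' (mulT (vT 0) zeroT =' zeroT),
   ∀' ∀' (mulT (vT 0) (succT (vT 1)) =' addT (mulT (vT 0) (vT 1)) (vT 0)),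
   ∀' ∀' (leF (vT 0) (vT 1) ⇔ ∃' (addT (vT 2) (vT 0) =' vT 1))} ∪
  {φ | ∃ (k : ℕ) (ψ : LA.BoundedFormula Empty (k + 1)), φ = indAxiom ψ}

/-- `Prv T φ`: the sentence `φ` is provable from the theory `T` (equivalently, by the
Gödel completeness theorem, `φ` holds in every model of `T`). -/
def Prv (T : Thy) (φ : Snt) : Prop := T ⊨ᵇ φ

/-- `Th T`: the set of sentences provable from `T`. -/
def Th (T : Thy) : Set Snt := {φ | Prv T φ}

/-- `Con T`: the theory `T` is consistent. -/
def Con (T : Thy) : Prop := ¬ Prv T ⊥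

/-- The theory `T + φ`. -/
def add (T : Thy) (φ : Snt) : Thy := insert φ T

/-- `T` is an extension of `PA`. -/
def ExtPA (T : Thy) : Prop := ∀ φ ∈ PAAx, Prv T φ

/-- `V` is a subtheory of `T` (containing `PA`, as assumed throughout the paper). -/
def SubThy (V T : Thy) : Prop := ExtPA V ∧ ∀ φ, Prv V φ → Prv T φ

/-- Δ₀ (bounded) formulas. -/
inductive IsDelta0 : ∀ {m : ℕ}, LA.BoundedFormula Empty m → Prop
  | falsum {m : ℕ} : IsDelta0 (⊥ : LA.BoundedFormula Empty m)
  | equal {m : ℕ} (t u : LA.Term (Empty ⊕ Fin m)) : IsDelta0 (t =' u)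
  | le {m : ℕ} (t u : LA.Term (Empty ⊕ Fin m)) : IsDelta0 (leF t u)
  | imp {m : ℕ} {φ ψ : LA.BoundedFormula Empty m} :
      IsDelta0 φ → IsDelta0 ψ → IsDelta0 (φ ⟹ ψ)
  | ball {m : ℕ} (t : LA.Term (Empty ⊕ Fin m)) {φ : LA.BoundedFormula Empty (m + 1)} :
      IsDelta0 φ →
      IsDelta0 (∀' (leF (vT (Fin.last m)) (t.relabel (Sum.map id Fin.castSucc)) ⟹ φ))
  | bex {m : ℕ} (t : LA.Term (Empty ⊕ Fin m)) {φ : LA.BoundedFormula Empty (m + 1)} :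
      IsDelta0 φ →
      IsDelta0 (∃' (leF (vT (Fin.last m)) (t.relabel (Sum.map id Fin.castSucc)) ⊓ φ))

mutual
  /-- `Σ_k` formulas (cumulatively: every `Π_k` formula is `Σ_{k+1}`). -/
  inductive IsSigmaFml : ℕ → ∀ {m : ℕ}, LA.BoundedFormula Empty m → Prop
    | ofDelta0 {m : ℕ} {φ : LA.BoundedFormula Empty m} : IsDelta0 φ → IsSigmaFml 0 φ
    | ofPi {k : ℕ} {m : ℕ} {φ : LA.BoundedFormula Empty m} :
        IsPiFml k φ → IsSigmaFml (k + 1) φ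
    | ex {k : ℕ} {m : ℕ} {φ : LA.BoundedFormula Empty (m + 1)} :
        IsSigmaFml (k + 1) φ → IsSigmaFml (k + 1) (∃' φ)
  /-- `Π_k` formulas (cumulatively: every `Σ_k` formula is `Π_{k+1}`). -/
  inductive IsPiFml : ℕ → ∀ {m : ℕ}, LA.BoundedFormula Empty m → Prop
    | ofDelta0 {m : ℕ} {φ : LA.BoundedFormula Empty m} : IsDelta0 φ → IsPiFml 0 φ
    | ofSigma {k : ℕ} {m : ℕ} {φ : LA.BoundedFormula Empty m} :
        IsSigmaFml k φ → IsPiFml (k + 1) φ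
    | all {k : ℕ} {m : ℕ} {φ : LA.BoundedFormula Empty (m + 1)} :
        IsPiFml (k + 1) φ → IsPiFml (k + 1) (∀' φ)
end

/-- The set of `Σ_k` sentences. -/
def SigmaS (k : ℕ) : Set Snt := {φ | IsSigmaFml k φ}

/-- The set of `Π_k` sentences. -/
def PiS (k : ℕ) : Set Snt := {φ | IsPiFml k φ}

/-- The set of `Σ_k ∧ Π_k` sentences, i.e. sentences of the form `σ ∧ π` with
`σ` a `Σ_k` sentence and `π` a `Π_k` sentence. -/
def SigAndPiS (k : ℕ) : Set Snt :=
  {φ | ∃ σ ∈ SigmaS k, ∃ π ∈ PiS k, φ = σ ⊓ π}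

/-- `B(Σ_k)` sentences: Boolean combinations of `Σ_k` sentences. -/
inductive IsBoolSigma (k : ℕ) : Snt → Prop
  | base {φ : Snt} : φ ∈ SigmaS k → IsBoolSigma k φ
  | not {φ : Snt} : IsBoolSigma k φ → IsBoolSigma k (∼φ)
  | imp {φ ψ : Snt} : IsBoolSigma k φ → IsBoolSigma k ψ → IsBoolSigma k (φ ⟹ ψ)
  | inf {φ ψ : Snt} : IsBoolSigma k φ → IsBoolSigma k ψ → IsBoolSigma k (φ ⊓ ψ)
  | sup {φ ψ : Snt} : IsBoolSigma k φ → IsBoolSigma k ψ → IsBoolSigma k (φ ⊔ ψ)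

/-- The set of `B(Σ_k)` sentences. -/
def BSigmaS (k : ℕ) : Set Snt := {φ | IsBoolSigma k φ}

/-- The set of `Γ` sentences provable in `T`, `Th_Γ(T)`. -/
def ThIn (Γ : Set Snt) (T : Thy) : Set Snt := Γ ∩ Th T

instance (i : ℕ) : Encodable (LA.Functions i) :=
  match i with
  | 0 => inferInstanceAs (Encodable Unit)
  | 1 => inferInstanceAs (Encodable Unit)
  | 2 => inferInstanceAs (Encodable Bool)
  | (_ + 3) => inferInstanceAs (Encodable Empty)

instance (i : ℕ) : Encodable (LA.Relations i) :=
  match i with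
  | 0 => inferInstanceAs (Encodable Empty)
  | 1 => inferInstanceAs (Encodable Empty)
  | 2 => inferInstanceAs (Encodable Unit)
  | (_ + 3) => inferInstanceAs (Encodable Empty)

/-- A Gödel numbering of sentences, via Mathlib's encoding of bounded formulas. -/
def gnum (φ : Snt) : ℕ :=
  Encodable.encode
    (show List ((Σ k, LA.Term (Empty ⊕ Fin k)) ⊕ ((Σ n, LA.Relations n) ⊕ ℕ)) from
      BoundedFormula.encoding.encode (⟨0, φ⟩ : Σ n, LA.BoundedFormula Empty n))

/-- The (axiom set of the) theory `T` is computable. -/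
def CompThy (T : Thy) : Prop :=
  ComputablePred (fun m : ℕ => ∃ φ ∈ T, gnum φ = m)

/-- `T` is a computable consistent extension of `PA`. -/
def GoodThy (T : Thy) : Prop := CompThy T ∧ Con T ∧ ExtPA T

/-- `φ` is `Γ`-conservative over `T` for a class of sentences `Γ`:
every `Γ` sentence provable in `T + φ` is provable in `T`. -/
def ConsIn (Γ : Set Snt) (T : Thy) (φ : Snt) : Prop :=
  ∀ γ ∈ Γ, Prv (add T φ) γ → Prv T γ

/-- `φ` is hereditarily `Γ`-conservative over `T`: `Γ`-conservative over every
subtheory of `T` (containing `PA`). -/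
def HConsIn (Γ : Set Snt) (T : Thy) (φ : Snt) : Prop :=
  ∀ V : Thy, SubThy V T → ConsIn Γ V φ

/-- `φ` is `Σ_k↓Π_k`-conservative over `V`. -/
def SPCons (k : ℕ) (V : Thy) (φ : Snt) : Prop :=
  ∀ σ ∈ SigmaS k, ∀ π ∈ PiS k, Prv (add V φ) (σ ⊓ π) → Prv V (σ ⊔ π)

/-- `φ` is hereditarily `Σ_k↓Π_k`-conservative over `T`. -/
def HSPCons (k : ℕ) (T : Thy) (φ : Snt) : Prop :=
  ∀ V : Thy, SubThy V T → SPCons k V φ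

/-- The theory `S` is `Σ_k↓Π_k`-conservative over `PA`. -/
def ThySPConsPA (k : ℕ) (S : Thy) : Prop :=
  ∀ σ ∈ SigmaS k, ∀ π ∈ PiS k, Prv S (σ ⊓ π) → Prv PAAx (σ ⊔ π)

/-- `δ` is a `Δ_k(S)` sentence: `S`-provably equivalent to both a `Σ_k` sentence
and a `Π_k` sentence. -/
def IsDeltaIn (k : ℕ) (S : Thy) (δ : Snt) : Prop :=
  (∃ σ ∈ SigmaS k, Prv S (δ ⇔ σ)) ∧ ∃ π ∈ PiS k, Prv S (δ ⇔ π)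

/-- `φ` is `Δ_k(S)`-conservative over `V`. -/
def DeltaConsRel (k : ℕ) (S V : Thy) (φ : Snt) : Prop :=
  ∀ δ : Snt, IsDeltaIn k S δ → Prv (add V φ) δ → Prv V δ

/-- `φ` is `Δ_k`-conservative over `T`, i.e. `Δ_k(Th(T))`-conservative over `T`. -/
def DeltaCons (k : ℕ) (T : Thy) (φ : Snt) : Prop := DeltaConsRel k (Th T) T φ

/-- `φ` is hereditarily `Δ_k`-conservative over `T`. -/
def HDeltaCons (k : ℕ) (T : Thy) (φ : Snt) : Prop :=
  ∀ V : Thy, SubThy V T → DeltaConsRel k (Th V) V φ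

/-- `φ` is doubly `Π_k`-conservative over `T`: `φ` is `Π_k`-conservative and `¬φ` is
`Σ_k`-conservative over `T`. -/
def DCons (k : ℕ) (T : Thy) (φ : Snt) : Prop :=
  ConsIn (PiS k) T φ ∧ ConsIn (SigmaS k) T (∼φ)

/-- `φ` is hereditarily doubly `Π_k`-conservative over `T`. -/
def HDCons (k : ℕ) (T : Thy) (φ : Snt) : Prop :=
  ∀ V : Thy, SubThy V T → DCons k V φ

/-- `(T,U)` is a `B_n`-pair. -/
def Bpair (n : ℕ) (T U : Thy) : Prop :=
  (¬ ThIn (PiS n) T ⊆ Th U ∨ Con (T ∪ ThIn (PiS n) U)) ∧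
  (¬ ThIn (PiS n) U ⊆ Th T ∨ Con (U ∪ ThIn (PiS n) T))

/-- `(T,U)` is a `C_n`-pair. -/
def Cpair (n : ℕ) (T U : Thy) : Prop :=
  Con (T ∪ ThIn (PiS n) U) ∧ Con (U ∪ ThIn (PiS n) T)

/-- `(T,U)` is a `C⁻_n`-pair. -/
def Cmpair (n : ℕ) (T U : Thy) : Prop :=
  Con (T ∪ ThIn (PiS n) U) ∨ Con (U ∪ ThIn (PiS n) T)

/-- `(T,U)` is a `C^∧_n`-pair. -/
def Capair (n : ℕ) (T U : Thy) : Prop :=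
  Con (T ∪ ThIn (SigAndPiS n) U) ∧ Con (U ∪ ThIn (SigAndPiS n) T)

/-- `(T,U)` is a `C^B_n`-pair. -/
def CBpair (n : ℕ) (T U : Thy) : Prop :=
  Con (T ∪ ThIn (BSigmaS n) U)


-- SECTION helpers
section Structures

/-- The standard reading of `LA` in an arithmetical type. -/
@[reducible] def structOf (M : Type) [Zero M] [One M] [Add M] [Mul M] [LE M] : LA.Structure M where
  funMap := fun {n} f v =>
    match n, f, v with
    | 0, _, _ => 0
    | 1, _, v => v 0 + 1
    | 2, f, v => match (show Bool from f) with
      | false => v 0 + v 1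
      | true => v 0 * v 1
    | (_ + 3), f, _ => (show Empty from f).elim
  RelMap := fun {n} r v =>
    match n, r, v with
    | 0, r, _ => (show Empty from r).elim
    | 1, r, _ => (show Empty from r).elim
    | 2, _, v => v 0 ≤ v 1
    | (_ + 3), r, _ => (show Empty from r).elim

/-- Models of Peano arithmetic, in algebraic form. -/
class PAM (M : Type) extends CommSemiring M, LinearOrder M, IsStrictOrderedRing M,
    CanonicallyOrderedAdd M where
  ind : ∀ {k : ℕ} (φ : LA.BoundedFormula Empty (k + 1)) (xs : Fin k → M),
    @BoundedFormula.Realize LA M (structOf M) Empty (k+1) φ default (Fin.snoc xs 0) →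
    (∀ x : M, @BoundedFormula.Realize LA M (structOf M) Empty (k+1) φ default (Fin.snoc xs x) →
      @BoundedFormula.Realize LA M (structOf M) Empty (k+1) φ default (Fin.snoc xs (x + 1))) →
    ∀ x : M, @BoundedFormula.Realize LA M (structOf M) Empty (k+1) φ default (Fin.snoc xs x)

instance pamStr {M : Type} [PAM M] : LA.Structure M := structOf M

end Structures

section Raw
variable {M : Type} [S : LA.Structure M]

/-- raw zero -/
def rz : M := Structure.funMap (L := LA) (show LA.Functions 0 from Unit.unit) ![]
/-- raw successor -/
def rs (x : M) : M := Structure.funMap (L := LA) (show LA.Functions 1 from Unit.unit) ![x]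
/-- raw addition -/
def ra (x y : M) : M := Structure.funMap (L := LA) (show LA.Functions 2 from false) ![x, y]
/-- raw multiplication -/
def rm (x y : M) : M := Structure.funMap (L := LA) (show LA.Functions 2 from true) ![x, y]
/-- raw order -/
def rl (x y : M) : Prop := Structure.RelMap (L := LA) (show LA.Relations 2 from Unit.unit) ![x, y]

@[simp] theorem realize_zeroT {α : Type} {n : ℕ} (v : α ⊕ Fin n → M) :
    (zeroT : LA.Term (α ⊕ Fin n)).realize v = rz := by
  unfold zeroT rz
  rw [Term.realize_constants]
  unfold constantMap
  congr

@[simp] theorem realize_succT {α : Type} {n : ℕ} (t : LA.Term (α ⊕ Fin n)) (v : α ⊕ Fin n → M) :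
    (succT t).realize v = rs (t.realize v) := by
  exact Term.realize_functions_apply₁
@[simp] theorem realize_addT {α : Type} {n : ℕ} (t u : LA.Term (α ⊕ Fin n)) (v : α ⊕ Fin n → M) :
    (addT t u).realize v = ra (t.realize v) (u.realize v) := by
  exact Term.realize_functions_apply₂
@[simp] theorem realize_mulT {α : Type} {n : ℕ} (t u : LA.Term (α ⊕ Fin n)) (v : α ⊕ Fin n → M) :
    (mulT t u).realize v = rm (t.realize v) (u.realize v) := by
  exact Term.realize_functions_apply₂
@[simp] theorem realize_vT {n : ℕ} (i : Fin n) (v : Empty → M) (xs : Fin n → M) :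
    (vT i).realize (Sum.elim v xs) = xs i := by
  simp [vT]
@[simp] theorem realize_leF {α : Type} {n : ℕ} (t u : LA.Term (α ⊕ Fin n)) (v : α → M)
    (xs : Fin n → M) :
    (leF t u).Realize v xs ↔ rl (t.realize (Sum.elim v xs)) (u.realize (Sum.elim v xs)) := by
  exact BoundedFormula.realize_rel₂

theorem realize_indAxiom {k : ℕ} (φ : LA.BoundedFormula Empty (k + 1)) :
    M ⊨ indAxiom φ ↔ ∀ xs : Fin k → M, φ.Realize default (Fin.snoc xs rz) →
      (∀ x, φ.Realize default (Fin.snoc xs x) → φ.Realize default (Fin.snoc xs (rs x))) →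
      ∀ x, φ.Realize default (Fin.snoc xs x) := by
  unfold indAxiom Sentence.Realize
  have key : ∀ (xs : Fin k → M) (x y : M),
      ((Fin.snoc (Fin.snoc xs x : Fin (k+1) → M) y : Fin (k+2) → M) ∘
        fun i : Fin (k+1) => if (i:ℕ) < k then Fin.castSucc i else i.succ) = Fin.snoc xs y := by
    intro xs x y
    funext i
    refine Fin.lastCases ?_ (fun j => ?_) i
    · simp [Fin.snoc]
    · simp
  have hl : ∀ (xs : Fin k → M) (x y : M), (φ.liftAt 1 k).Realize (default : Empty → M)
      (Fin.snoc (Fin.snoc xs x : Fin (k+1) → M) y : Fin (k+2) → M) ↔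
      φ.Realize default (Fin.snoc xs y) := by
    intro xs x y
    rw [BoundedFormula.realize_liftAt_one (Nat.le_succ k), key]
  simp only [BoundedFormula.realize_alls, BoundedFormula.realize_imp, BoundedFormula.realize_inf,
    BoundedFormula.realize_all, BoundedFormula.realize_bdEqual, realize_vT, realize_zeroT,
    realize_succT, hl, Fin.snoc_last, Fin.snoc_castSucc, forall_eq, and_imp]

end Raw

theorem snoc0 {M : Type} (xs : Fin 0 → M) (x : M) : (Fin.snoc xs x : Fin 1 → M) = ![x] := by
  ext i; fin_cases i; rfl
theorem snoc1 {M : Type} (a x : M) : (Fin.snoc ![a] x : Fin 2 → M) = ![a, x] := by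
  ext i; fin_cases i <;> rfl
theorem snoc2 {M : Type} (a b x : M) : (Fin.snoc ![a, b] x : Fin 3 → M) = ![a, b, x] := by
  ext i; fin_cases i <;> rfl

section Build
variable {M : Type} [S : LA.Structure M]

theorem raw_ind (h : M ⊨ PAAx) {k : ℕ} (φ : LA.BoundedFormula Empty (k + 1)) (xs : Fin k → M)
    (h0 : φ.Realize default (Fin.snoc xs rz))
    (h1 : ∀ x, φ.Realize default (Fin.snoc xs x) → φ.Realize default (Fin.snoc xs (rs x))) (x : M) :
    φ.Realize default (Fin.snoc xs x) :=
  (realize_indAxiom φ).1 (h.realize_of_mem _ (Or.inr ⟨k, φ, rfl⟩)) xs h0 h1 x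

theorem raw_s_ne (h : M ⊨ PAAx) (x : M) : rs x ≠ rz := by
  have := h.realize_of_mem (∀' ∼(succT (vT 0) =' zeroT)) (Or.inl (by simp))
  simpa [Sentence.Realize, Formula.Realize, snoc0, Fin.snoc] using this x
theorem raw_s_inj (h : M ⊨ PAAx) {x y : M} (hh : rs x = rs y) : x = y := by
  have := h.realize_of_mem (∀' ∀' ((succT (vT 0) =' succT (vT 1)) ⟹ (vT 0 =' vT 1))) (Or.inl (by simp))
  have := this x y
  simp only [BoundedFormula.realize_imp, BoundedFormula.realize_bdEqual, realize_succT, realize_vT, snoc0, snoc1] at this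
  exact this hh
theorem raw_a0 (h : M ⊨ PAAx) (x : M) : ra x rz = x := by
  have := h.realize_of_mem (∀' (addT (vT 0) zeroT =' vT 0)) (Or.inl (by simp)) x
  simp only [BoundedFormula.realize_bdEqual, realize_addT, realize_zeroT, realize_vT, snoc0, snoc1] at this; exact this
theorem raw_aS (h : M ⊨ PAAx) (x y : M) : ra x (rs y) = rs (ra x y) := by
  have := h.realize_of_mem (∀' ∀' (addT (vT 0) (succT (vT 1)) =' succT (addT (vT 0) (vT 1)))) (Or.inl (by simp)) x y
  simp only [BoundedFormula.realize_bdEqual, realize_addT, realize_succT, realize_zeroT, realize_vT, snoc0, snoc1] at this; exact this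
theorem raw_m0 (h : M ⊨ PAAx) (x : M) : rm x rz = rz := by
  have := h.realize_of_mem (∀' (mulT (vT 0) zeroT =' zeroT)) (Or.inl (by simp)) x
  simp only [BoundedFormula.realize_bdEqual, realize_mulT, realize_zeroT, realize_vT, snoc0, snoc1] at this; exact this
theorem raw_mS (h : M ⊨ PAAx) (x y : M) : rm x (rs y) = ra (rm x y) x := by
  have := h.realize_of_mem (∀' ∀' (mulT (vT 0) (succT (vT 1)) =' addT (mulT (vT 0) (vT 1)) (vT 0))) (Or.inl (by simp)) x y
  simp only [BoundedFormula.realize_bdEqual, realize_addT, realize_mulT, realize_succT, realize_zeroT, realize_vT, snoc0, snoc1] at this; exact this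
theorem raw_le (h : M ⊨ PAAx) (x y : M) : rl x y ↔ ∃ z, ra z x = y := by
  have := h.realize_of_mem (∀' ∀' (leF (vT 0) (vT 1) ⇔ ∃' (addT (vT 2) (vT 0) =' vT 1))) (Or.inl (by simp)) x y
  simp only [BoundedFormula.realize_iff, BoundedFormula.realize_ex, realize_leF, BoundedFormula.realize_bdEqual, realize_addT, realize_mulT, realize_succT, realize_zeroT, realize_vT, snoc0, snoc1, snoc2] at this; exact this

theorem raw_0a (h : M ⊨ PAAx) (x : M) : ra rz x = x := by
  have := raw_ind h (k := 0) (addT zeroT (vT 0) =' vT 0) ![]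
  simp only [BoundedFormula.realize_bdEqual, realize_addT, realize_zeroT, realize_vT, snoc0, snoc1] at this
  exact this (raw_a0 h _) (fun x hx => by simp [raw_aS h] at hx ⊢; rw [hx]) x
theorem raw_Sa (h : M ⊨ PAAx) (x y : M) : ra (rs x) y = rs (ra x y) := by
  have := raw_ind h (k := 1) (addT (succT (vT 0)) (vT 1) =' succT (addT (vT 0) (vT 1))) ![x]
  simp only [BoundedFormula.realize_bdEqual, realize_addT, realize_succT, realize_vT, snoc0, snoc1] at this
  exact this (by simp [raw_a0 h]) (fun x hx => by simp [raw_aS h] at hx ⊢; rw [hx]) y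
theorem raw_ac (h : M ⊨ PAAx) (x y : M) : ra x y = ra y x := by
  have := raw_ind h (k := 1) (addT (vT 0) (vT 1) =' addT (vT 1) (vT 0)) ![x]
  simp only [BoundedFormula.realize_bdEqual, realize_addT, realize_succT, realize_vT, snoc0, snoc1] at this
  exact this (by simp [raw_a0 h, raw_0a h]) (fun x hx => by simp [raw_aS h, raw_Sa h] at hx ⊢; rw [hx]) y
theorem raw_aa (h : M ⊨ PAAx) (x y z : M) : ra (ra x y) z = ra x (ra y z) := by
  have := raw_ind h (k := 2) (addT (addT (vT 0) (vT 1)) (vT 2) =' addT (vT 0) (addT (vT 1) (vT 2))) ![x, y]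
  simp only [BoundedFormula.realize_bdEqual, realize_addT, realize_succT, realize_vT, snoc0, snoc2] at this
  exact this (by simp [raw_a0 h]) (fun x hx => by simp [raw_aS h] at hx ⊢; rw [hx]) z
theorem raw_0m (h : M ⊨ PAAx) (x : M) : rm rz x = rz := by
  have := raw_ind h (k := 0) (mulT zeroT (vT 0) =' zeroT) ![]
  simp only [BoundedFormula.realize_bdEqual, realize_mulT, realize_zeroT, realize_vT, snoc0, snoc1] at this
  exact this (raw_m0 h _) (fun x hx => by simp [raw_mS h] at hx ⊢; rw [hx, raw_a0 h]) x
theorem raw_Sm (h : M ⊨ PAAx) (x y : M) : rm (rs x) y = ra (rm x y) y := by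
  have := raw_ind h (k := 1) (mulT (succT (vT 0)) (vT 1) =' (addT (mulT (vT 0) (vT 1)) (vT 1))) ![x]
  simp only [BoundedFormula.realize_bdEqual, realize_addT, realize_mulT, realize_succT, realize_vT, snoc0, snoc1] at this
  refine this (by simp [raw_m0 h, raw_a0 h]) (fun z hx => ?_) y
  simp [raw_mS h, raw_aS h] at hx ⊢
  rw [hx, raw_aa h, raw_aa h, raw_ac h z x]
theorem raw_mc (h : M ⊨ PAAx) (x y : M) : rm x y = rm y x := by
  have := raw_ind h (k := 1) (mulT (vT 0) (vT 1) =' mulT (vT 1) (vT 0)) ![x]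
  simp only [BoundedFormula.realize_bdEqual, realize_mulT, realize_succT, realize_vT, snoc0, snoc1] at this
  exact this (by simp [raw_m0 h, raw_0m h]) (fun x hx => by simp [raw_mS h, raw_Sm h] at hx ⊢; rw [hx]) y
theorem raw_ld (h : M ⊨ PAAx) (x y z : M) : rm x (ra y z) = ra (rm x y) (rm x z) := by
  have := raw_ind h (k := 2) (mulT (vT 0) (addT (vT 1) (vT 2)) =' addT (mulT (vT 0) (vT 1)) (mulT (vT 0) (vT 2))) ![x, y]
  simp only [BoundedFormula.realize_bdEqual, realize_addT, realize_mulT, realize_succT, realize_vT, snoc0, snoc2] at this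
  exact this (by simp [raw_a0 h, raw_m0 h]) (fun x hx => by simp [raw_aS h, raw_mS h] at hx ⊢; rw [hx, raw_aa h]) z
theorem raw_ma (h : M ⊨ PAAx) (x y z : M) : rm (rm x y) z = rm x (rm y z) := by
  have := raw_ind h (k := 2) (mulT (mulT (vT 0) (vT 1)) (vT 2) =' mulT (vT 0) (mulT (vT 1) (vT 2))) ![x, y]
  simp only [BoundedFormula.realize_bdEqual, realize_mulT, realize_succT, realize_vT, snoc0, snoc2] at this
  exact this (by simp [raw_m0 h]) (fun x hx => by simp [raw_mS h, raw_ld h] at hx ⊢; rw [hx]) z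
theorem raw_cancel (h : M ⊨ PAAx) (x y z : M) : ra x z = ra y z → x = y := by
  have := raw_ind h (k := 2) ((addT (vT 0) (vT 2) =' addT (vT 1) (vT 2)) ⟹ (vT 0 =' vT 1)) ![x, y]
  simp only [BoundedFormula.realize_bdEqual, BoundedFormula.realize_imp, realize_addT, realize_mulT, realize_succT, realize_vT, snoc0, snoc2] at this
  exact this (by simp [raw_a0 h]) (fun x hx => by simp [raw_aS h] at hx ⊢; exact fun hh => hx (raw_s_inj h hh)) z
theorem raw_cases (h : M ⊨ PAAx) (x : M) : x = rz ∨ ∃ y, x = rs y := by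
  have := raw_ind h (k := 0) ((vT 0 =' zeroT) ⊔ (∃' (vT 0 =' succT (vT 1)))) ![]
  simp only [BoundedFormula.realize_bdEqual, BoundedFormula.realize_sup, BoundedFormula.realize_ex, realize_zeroT, realize_succT, realize_vT, snoc0, snoc1] at this
  exact this (by simp) (fun x _ => by simp) x
theorem raw_total (h : M ⊨ PAAx) (x y : M) : (∃ z, ra z x = y) ∨ ∃ z, ra z y = x := by
  have := raw_ind h (k := 1) ((∃' (addT (vT 2) (vT 0) =' vT 1)) ⊔ (∃' (addT (vT 2) (vT 1) =' vT 0))) ![x]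
  simp only [BoundedFormula.realize_bdEqual, BoundedFormula.realize_sup, BoundedFormula.realize_ex, realize_addT, realize_succT, realize_vT, snoc2, snoc1] at this
  refine this (Or.inr ⟨x, by simp [raw_a0 h]⟩) (fun y hy => ?_) y
  simp at hy ⊢
  rcases hy with ⟨z, hz⟩ | ⟨z, hz⟩
  · exact Or.inl ⟨rs z, by rw [raw_Sa h, hz]⟩
  · rcases raw_cases h z with rfl | ⟨w, rfl⟩
    · exact Or.inl ⟨rs rz, by rw [raw_Sa h, raw_0a h, ← hz, raw_0a h]⟩
    · exact Or.inr ⟨w, by rw [← hz, raw_aS h, raw_Sa h]⟩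
theorem raw_add_zero (h : M ⊨ PAAx) (x y : M) (hh : ra x y = rz) : y = rz := by
  rcases raw_cases h y with rfl | ⟨w, rfl⟩
  · rfl
  · rw [raw_aS h] at hh; exact absurd hh (raw_s_ne h _)

/-- The algebraic form of a model of PA. -/
@[reducible] noncomputable def mkCS (h : M ⊨ PAAx) : CommSemiring M where
  add := ra
  zero := rz
  mul := rm
  one := rs rz
  add_assoc := raw_aa h
  zero_add := raw_0a h
  add_zero := raw_a0 h
  add_comm := raw_ac h
  nsmul := @nsmulRec M ⟨rz⟩ ⟨ra⟩
  npow := @npowRec M ⟨rs rz⟩ ⟨rm⟩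
  left_distrib := raw_ld h
  right_distrib a b c := by change rm (ra a b) c = ra (rm a c) (rm b c); rw [raw_mc h, raw_ld h, raw_mc h c a, raw_mc h c b]
  zero_mul := raw_0m h
  mul_zero := raw_m0 h
  mul_assoc := raw_ma h
  one_mul a := by change rm (rs rz) a = a; rw [raw_Sm h, raw_0m h, raw_0a h]
  mul_one a := by change rm a (rs rz) = a; rw [raw_mS h, raw_m0 h, raw_0a h]
  mul_comm := raw_mc h

/-- The order of a model of PA. -/
@[reducible] noncomputable def mkLO (h : M ⊨ PAAx) : LinearOrder M where
  le := rl
  le_refl a := (raw_le h a a).2 ⟨rz, raw_0a h a⟩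
  le_trans a b c h1 h2 := by
    rw [raw_le h] at *
    obtain ⟨z, rfl⟩ := h1
    obtain ⟨w, rfl⟩ := h2
    exact ⟨ra w z, raw_aa h _ _ _⟩
  le_antisymm a b h1 h2 := by
    rw [raw_le h] at *
    obtain ⟨z, rfl⟩ := h1
    obtain ⟨w, hw⟩ := h2
    rw [← raw_aa h] at hw
    have h3 : ra w z = rz := raw_cancel h _ _ a (by rw [hw, raw_0a h])
    rw [raw_add_zero h _ _ h3, raw_0a h]
  le_total a b := by
    simp only [raw_le h]
    exact raw_total h a b
  toDecidableLE := Classical.decRel _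

/-- Every model of `PAAx` is a `PAM`. -/
@[reducible] noncomputable def mkPAM (h : M ⊨ PAAx) : PAM M :=
  letI := mkCS h
  letI := mkLO h
  have hle : ∀ a b : M, a ≤ b ↔ ∃ z, z + a = b := raw_le h
  have hone : ∀ x : M, x + 1 = rs x := fun x => by
    change ra x (rs rz) = rs x; rw [raw_aS h, raw_a0 h]
  have hcan : ∀ x y z : M, x + z = y + z → x = y := raw_cancel h
  have hcases : ∀ x : M, x = 0 ∨ ∃ y, x = y + 1 := fun x => by
    rcases raw_cases h x with h1 | ⟨y, h1⟩
    · exact Or.inl h1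
    · exact Or.inr ⟨y, by rw [hone]; exact h1⟩
  have hne : ∀ x : M, x + 1 ≠ 0 := fun x => by rw [hone]; exact raw_s_ne h x
  have canon : CanonicallyOrderedAdd M :=
    { exists_add_of_le := fun {a b} hab => by
        obtain ⟨z, hz⟩ := (hle a b).1 hab
        exact ⟨z, by rw [← hz, add_comm]⟩
      le_add_self := fun a b => (hle _ _).2 ⟨b, rfl⟩
      le_self_add := fun a b => (hle _ _).2 ⟨b, add_comm _ _⟩ }
  have zlo : ∀ a : M, 0 < a → ∃ b, a = b + 1 := fun a ha => by
    rcases hcases a with rfl | hb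
    · exact absurd ha (lt_irrefl _)
    · exact hb
  have hlt : ∀ a b : M, a < b → ∃ c, b = a + (c + 1) := fun a b hab => by
    obtain ⟨z, hz⟩ := (hle a b).1 hab.le
    rcases hcases z with rfl | ⟨w, rfl⟩
    · rw [zero_add] at hz; exact absurd hab (by rw [hz]; exact lt_irrefl _)
    · exact ⟨w, by rw [← hz, add_comm]⟩
  have hlt' : ∀ a c : M, a < a + (c + 1) := fun a c => by
    refine lt_of_le_of_ne (le_self_add) (fun hh => hne c (hcan _ 0 a ?_))
    rw [zero_add, add_comm]; exact hh.symm
  have strict : IsStrictOrderedRing M :=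
    { add_le_add_left := fun a b hab c => by
        obtain ⟨z, rfl⟩ := (hle a b).1 hab
        exact (hle _ _).2 ⟨z, by rw [add_assoc]⟩
      le_of_add_le_add_left := fun a b c hh => by
        obtain ⟨z, hz⟩ := (hle _ _).1 hh
        exact (hle _ _).2 ⟨z, hcan _ _ a (by rw [add_comm c a, ← hz]; ring)⟩
      zero_le_one := zero_le
      exists_pair_ne := ⟨0, 1, fun hh => hne 0 (by rw [zero_add]; exact hh.symm)⟩
      mul_lt_mul_of_pos_left := fun a ha b c hbc => by
        obtain ⟨d, rfl⟩ := hlt b c hbc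
        obtain ⟨e, rfl⟩ := zlo a ha
        have : (e + 1) * (b + (d + 1)) = (e + 1) * b + ((e * d + e + d) + 1) := by ring
        show (e + 1) * b < (e + 1) * (b + (d + 1))
        rw [this]; exact hlt' _ _
      mul_lt_mul_of_pos_right := fun a ha b c hbc => by
        obtain ⟨d, rfl⟩ := hlt b c hbc
        obtain ⟨e, rfl⟩ := zlo a ha
        have : (b + (d + 1)) * (e + 1) = b * (e + 1) + ((e * d + e + d) + 1) := by ring
        show b * (e + 1) < (b + (d + 1)) * (e + 1)
        rw [this]; exact hlt' _ _ }
  have hS : structOf M = S := by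
    refine Structure.ext ?_ ?_
    · funext n f v
      match n, f, v with
      | 0, f, v =>
        exact congrArg (@Structure.funMap LA M S 0 f) (Subsingleton.elim _ _)
      | 1, f, v =>
        change v 0 + 1 = _
        rw [hone]
        exact congrArg (@Structure.funMap LA M S 1 f) (by ext i; fin_cases i; rfl)
      | 2, false, v =>
        exact congrArg (@Structure.funMap LA M S 2 false) (by ext i; fin_cases i <;> rfl)
      | 2, true, v =>
        exact congrArg (@Structure.funMap LA M S 2 true) (by ext i; fin_cases i <;> rfl)
      | n + 3, f, v => exact (show Empty from f).elim
    · funext n f v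
      match n, f, v with
      | 0, f, v => exact (show Empty from f).elim
      | 1, f, v => exact (show Empty from f).elim
      | 2, f, v =>
        exact congrArg (@Structure.RelMap LA M S 2 f) (by ext i; fin_cases i <;> rfl)
      | n + 3, f, v => exact (show Empty from f).elim
  { mkCS h, mkLO h, strict, canon with
    ind := by
      intro k φ xs
      rw [hS]
      intro h0 h1
      exact raw_ind h φ xs h0 (fun x hx => by rw [← hone]; exact h1 x hx) }

theorem structOf_mkPAM (h : M ⊨ PAAx) : (letI := mkPAM h; structOf M) = S := by
  letI := mkPAM h
  have hone : ∀ x : M, x + 1 = rs x := fun x => by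
    change ra x (rs rz) = rs x; rw [raw_aS h, raw_a0 h]
  change structOf M = S
  refine Structure.ext ?_ ?_
  · funext n f v
    match n, f, v with
    | 0, f, v =>
      exact congrArg (@Structure.funMap LA M S 0 f) (Subsingleton.elim _ _)
    | 1, f, v =>
      change v 0 + 1 = _
      rw [hone]
      exact congrArg (@Structure.funMap LA M S 1 f) (by ext i; fin_cases i; rfl)
    | 2, false, v =>
      exact congrArg (@Structure.funMap LA M S 2 false) (by ext i; fin_cases i <;> rfl)
    | 2, true, v =>
      exact congrArg (@Structure.funMap LA M S 2 true) (by ext i; fin_cases i <;> rfl)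
    | n + 3, f, v => exact (show Empty from f).elim
  · funext n f v
    match n, f, v with
    | 0, f, v => exact (show Empty from f).elim
    | 1, f, v => exact (show Empty from f).elim
    | 2, f, v =>
      exact congrArg (@Structure.RelMap LA M S 2 f) (by ext i; fin_cases i <;> rfl)
    | n + 3, f, v => exact (show Empty from f).elim

end Build

section PAMBasics

variable {M : Type} [PAM M]

@[simp] theorem rz_eq : (rz : M) = 0 := rfl
@[simp] theorem rs_eq (x : M) : rs x = x + 1 := rfl
@[simp] theorem ra_eq (x y : M) : ra x y = x + y := rfl
@[simp] theorem rm_eq (x y : M) : rm x y = x * y := rfl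
@[simp] theorem rl_eq (x y : M) : rl x y ↔ x ≤ y := Iff.rfl

theorem pam_cases (x : M) : x = 0 ∨ ∃ y, x = y + 1 := by
  have := PAM.ind (M := M) (k := 0) ((vT 0 =' zeroT) ⊔ (∃' (vT 0 =' succT (vT 1)))) ![]
  simp only [BoundedFormula.realize_bdEqual, BoundedFormula.realize_sup,
    BoundedFormula.realize_ex, realize_zeroT, realize_succT, realize_vT, snoc0, snoc1] at this
  exact this (by left; rfl) (fun x _ => by right; exact ⟨x, rfl⟩) x

theorem pam_lt_add_one (x : M) : x < x + 1 := lt_add_of_pos_right x zero_lt_one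

theorem pam_lt_succ {x y : M} : x < y + 1 ↔ x ≤ y := by
  constructor
  · intro h
    by_contra hc
    push Not at hc
    obtain ⟨z, rfl⟩ := exists_add_of_le hc.le
    rcases pam_cases z with rfl | ⟨w, rfl⟩
    · simp at hc
    · have : y + 1 ≤ y + (w + 1) := by
        rw [add_comm w 1, ← add_assoc]; exact le_self_add
      exact absurd h (not_lt.2 this)
  · intro h
    exact lt_of_le_of_lt h (pam_lt_add_one y)

theorem pam_succ_le {x y : M} : x + 1 ≤ y ↔ x < y := by
  rw [← not_lt, pam_lt_succ, not_le]

theorem pam_le_cast {x : M} {k : ℕ} (h : x ≤ (k : M)) : ∃ j : ℕ, j ≤ k ∧ x = (j : M) := by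
  induction k generalizing x with
  | zero => exact ⟨0, le_rfl, by simpa using h⟩
  | succ k ih =>
    rcases h.eq_or_lt with h | h
    · exact ⟨k + 1, le_rfl, h⟩
    · rw [Nat.cast_succ, pam_lt_succ] at h
      obtain ⟨j, hj, rfl⟩ := ih h
      exact ⟨j, hj.trans (Nat.le_succ k), rfl⟩

theorem pam_cast_le {a b : ℕ} : (a : M) ≤ (b : M) ↔ a ≤ b := Nat.cast_le
theorem pam_cast_inj {a b : ℕ} : (a : M) = (b : M) ↔ a = b := by
  constructor
  · intro h
    exact le_antisymm (pam_cast_le.1 h.le) (pam_cast_le.1 h.ge)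
  · rintro rfl; rfl

end PAMBasics

noncomputable instance : PAM ℕ :=
  { (inferInstance : CommSemiring ℕ), (inferInstance : LinearOrder ℕ),
    (inferInstance : IsStrictOrderedRing ℕ), (inferInstance : CanonicallyOrderedAdd ℕ) with
    ind := fun φ xs h0 h1 x => by
      induction x with
      | zero => exact h0
      | succ n ih => exact h1 n ih }

section Semantics

theorem pam_models (M : Type) [PAM M] : M ⊨ PAAx := by
  refine ⟨fun φ hφ => ?_⟩
  rcases hφ with h | ⟨k, ψ, rfl⟩
  · simp only [Set.mem_insert_iff, Set.mem_singleton_iff] at h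
    rcases h with rfl | rfl | rfl | rfl | rfl | rfl | rfl
    · intro x
      simp only [BoundedFormula.realize_not, BoundedFormula.realize_bdEqual, realize_succT,
        realize_zeroT, realize_vT, snoc0]
      intro h
      exact (pos_of_gt (pam_lt_add_one x)).ne' (h.trans rfl)
    · intro x y
      simp only [BoundedFormula.realize_imp, BoundedFormula.realize_bdEqual, realize_succT,
        realize_vT, snoc0, snoc1]
      intro h
      exact add_right_cancel (b := (1 : M)) h
    · intro x
      simp only [BoundedFormula.realize_bdEqual, realize_addT, realize_zeroT, realize_vT, snoc0]
      exact add_zero x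
    · intro x y
      simp only [BoundedFormula.realize_bdEqual, realize_addT, realize_succT, realize_vT, snoc0,
        snoc1]
      exact (add_assoc x y 1).symm
    · intro x
      simp only [BoundedFormula.realize_bdEqual, realize_mulT, realize_zeroT, realize_vT, snoc0]
      exact mul_zero x
    · intro x y
      simp only [BoundedFormula.realize_bdEqual, realize_addT, realize_mulT, realize_succT,
        realize_vT, snoc0, snoc1]
      exact mul_add_one x y
    · intro x y
      simp only [BoundedFormula.realize_iff, BoundedFormula.realize_ex, realize_leF,
        BoundedFormula.realize_bdEqual, realize_addT, realize_vT, snoc0, snoc1, snoc2]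
      change x ≤ y ↔ ∃ z, z + x = y
      constructor
      · intro h
        obtain ⟨z, rfl⟩ := exists_add_of_le h
        exact ⟨z, add_comm _ _⟩
      · rintro ⟨z, rfl⟩
        exact le_add_self
  · exact (realize_indAxiom ψ).2 (fun xs h0 h1 x => PAM.ind ψ xs h0 h1 x)

theorem prv_iff {T : Thy} (hT : ExtPA T) (φ : Snt) :
    Prv T φ ↔ ∀ (M : Type) [PAM M], M ⊨ T → M ⊨ φ := by
  constructor
  · intro h M _ hM
    haveI := hM
    haveI : Nonempty M := ⟨(0 : M)⟩
    exact Theory.models_sentence_iff.1 h (Theory.ModelType.of T M)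
  · intro h
    refine Theory.models_sentence_iff.2 (fun N => ?_)
    have hPA : N ⊨ PAAx := ⟨fun ψ hψ => Theory.models_sentence_iff.1 (hT ψ hψ) N⟩
    have hN : N ⊨ T := N.is_model
    letI P : PAM N := mkPAM hPA
    have hS := structOf_mkPAM hPA
    have := @h N P
    rw [show @pamStr N P = N.struc from hS] at this
    exact this hN

theorem con_iff {T : Thy} (hT : ExtPA T) :
    Con T ↔ ∃ (M : Type) (_ : PAM M), M ⊨ T := by
  unfold Con
  rw [prv_iff hT]
  push Not
  constructor
  · rintro ⟨M, i, h, _⟩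
    exact ⟨M, i, h⟩
  · rintro ⟨M, i, h⟩
    exact ⟨M, i, h, fun hh => hh⟩

theorem models_add {M : Type} [PAM M] {T : Thy} {φ : Snt} :
    M ⊨ add T φ ↔ M ⊨ T ∧ M ⊨ φ := by
  unfold add
  simp only [Theory.model_iff, Set.mem_insert_iff, forall_eq_or_imp]
  exact and_comm

theorem extPA_mono {T T' : Thy} (h : T ⊆ T') (hT : ExtPA T) : ExtPA T' := by
  intro φ hφ
  refine Theory.models_sentence_iff.2 (fun N => ?_)
  have hN : N ⊨ T := N.is_model.mono h
  exact Theory.models_sentence_iff.1 (hT φ hφ) (Theory.ModelType.of T N)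

theorem extPA_add {T : Thy} (hT : ExtPA T) (φ : Snt) : ExtPA (add T φ) :=
  extPA_mono (Set.subset_insert _ _) hT

end Semantics

section Classes

/-- Uniformly defined relations on models of PA. -/
abbrev URel (m : ℕ) : Type 1 := ∀ (M : Type) [PAM M], (Fin m → M) → Prop
/-- Uniformly defined functions on models of PA. -/
abbrev UFun (m : ℕ) : Type 1 := ∀ (M : Type) [PAM M], (Fin m → M) → M

/-- Functions given by terms. -/
class Tm (m : ℕ) (t : UFun m) : Prop where
  out : ∃ τ : LA.Term (Empty ⊕ Fin m), ∀ (M : Type) [PAM M] (xs : Fin m → M),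
    t M xs = τ.realize (Sum.elim default xs)

/-- Relations given by bounded formulas. -/
class D0 (m : ℕ) (R : URel m) : Prop where
  out : ∃ φ : LA.BoundedFormula Empty m, IsDelta0 φ ∧ ∀ (M : Type) [PAM M] (xs : Fin m → M),
    R M xs ↔ φ.Realize default xs

/-- Functions of one model given by terms with parameters. -/
class FT (M : Type) [PAM M] (m : ℕ) (t : (Fin m → M) → M) : Prop where
  out : ∃ (τ : LA.Term (M ⊕ Fin m)), ∀ (xs : Fin m → M), t xs = τ.realize (Sum.elim id xs)

/-- Relations of one model definable with parameters. -/
class Fm (M : Type) [PAM M] (m : ℕ) (R : (Fin m → M) → Prop) : Prop where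
  out : ∃ (φ : LA.BoundedFormula M m), ∀ (xs : Fin m → M), R xs ↔ φ.Realize id xs

instance tm_var {m : ℕ} (i : Fin m) : Tm m (fun _ _ xs => xs i) :=
  ⟨vT i, fun _ _ _ => by simp⟩
instance tm_zero {m : ℕ} : Tm m (fun _ _ _ => 0) := ⟨zeroT, fun _ _ _ => by simp⟩
instance tm_add {m : ℕ} (t u : UFun m) [ht : Tm m t] [hu : Tm m u] :
    Tm m (fun M _ xs => t M xs + u M xs) := by
  obtain ⟨τ, hτ⟩ := ht
  obtain ⟨υ, hυ⟩ := hu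
  exact ⟨addT τ υ, fun M _ xs => by rw [hτ, hυ]; simp⟩
instance tm_mul {m : ℕ} (t u : UFun m) [ht : Tm m t] [hu : Tm m u] :
    Tm m (fun M _ xs => t M xs * u M xs) := by
  obtain ⟨τ, hτ⟩ := ht
  obtain ⟨υ, hυ⟩ := hu
  exact ⟨mulT τ υ, fun M _ xs => by rw [hτ, hυ]; simp⟩
instance tm_one {m : ℕ} : Tm m (fun _ _ _ => 1) := ⟨succT zeroT, fun _ _ _ => by simp⟩
theorem tm_cast {m : ℕ} (c : ℕ) : Tm m (fun _ _ _ => (c : _)) := by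
  induction c with
  | zero => simpa using tm_zero
  | succ n ih =>
    have := tm_add (m := m) (fun _ _ _ => (n : _)) (fun _ _ _ => 1)
    simpa using this
instance tm_castI {m : ℕ} (c : ℕ) : Tm m (fun _ _ _ => (c : _)) := tm_cast c
instance tm_two {m : ℕ} : Tm m (fun _ _ _ => 2) := by simpa using tm_cast (m := m) 2

theorem tm_subst {m l : ℕ} (t : UFun m) [ht : Tm m t] (ts : Fin m → UFun l)
    [hts : ∀ i, Tm l (ts i)] : Tm l (fun M _ xs => t M (fun i => ts i M xs)) := by
  obtain ⟨τ, hτ⟩ := ht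
  have h : ∀ i, ∃ υ : LA.Term (Empty ⊕ Fin l), ∀ (M : Type) [PAM M] (xs : Fin l → M),
    ts i M xs = υ.realize (Sum.elim default xs) := fun i => (hts i).out
  choose υ hυ using h
  refine ⟨τ.subst (Sum.elim (fun e => e.elim) υ), fun M _ xs => ?_⟩
  rw [hτ, Term.realize_subst]
  congr 1
  funext x
  rcases x with e | i
  · exact e.elim
  · simp [hυ]

instance ft_var {M : Type} [PAM M] {m : ℕ} (i : Fin m) : FT M m (fun xs => xs i) :=
  ⟨Term.var (Sum.inr i), fun _ => by simp⟩
instance ft_const {M : Type} [PAM M] {m : ℕ} (c : M) : FT M m (fun _ => c) :=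
  ⟨Term.var (Sum.inl c), fun _ => by simp⟩
instance ft_add {M : Type} [PAM M] {m : ℕ} (t u : (Fin m → M) → M) [ht : FT M m t]
    [hu : FT M m u] : FT M m (fun xs => t xs + u xs) := by
  obtain ⟨τ, hτ⟩ := ht
  obtain ⟨υ, hυ⟩ := hu
  exact ⟨addT τ υ, fun xs => by rw [hτ, hυ]; simp⟩
instance ft_mul {M : Type} [PAM M] {m : ℕ} (t u : (Fin m → M) → M) [ht : FT M m t]
    [hu : FT M m u] : FT M m (fun xs => t xs * u xs) := by
  obtain ⟨τ, hτ⟩ := ht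
  obtain ⟨υ, hυ⟩ := hu
  exact ⟨mulT τ υ, fun xs => by rw [hτ, hυ]; simp⟩

section D0closure
variable {m : ℕ}

theorem D0.congr {P Q : URel m} (h : D0 m P) (e : ∀ (M : Type) [PAM M] xs, Q M xs ↔ P M xs) :
    D0 m Q := by
  obtain ⟨φ, h1, h2⟩ := h
  exact ⟨φ, h1, fun M _ xs => (e M xs).trans (h2 M xs)⟩

theorem delta0_not {φ : LA.BoundedFormula Empty m} (h : IsDelta0 φ) : IsDelta0 (∼φ) :=
  IsDelta0.imp h IsDelta0.falsum
theorem delta0_inf {φ ψ : LA.BoundedFormula Empty m} (h : IsDelta0 φ) (h' : IsDelta0 ψ) :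
    IsDelta0 (φ ⊓ ψ) :=
  delta0_not (IsDelta0.imp h (delta0_not h'))
theorem delta0_sup {φ ψ : LA.BoundedFormula Empty m} (h : IsDelta0 φ) (h' : IsDelta0 ψ) :
    IsDelta0 (φ ⊔ ψ) :=
  IsDelta0.imp (delta0_not h) h'

instance d0_false : D0 m (fun _ _ _ => False) :=
  ⟨⊥, IsDelta0.falsum, fun _ _ _ => by simp⟩
instance d0_imp (P Q : URel m) [hP : D0 m P] [hQ : D0 m Q] :
    D0 m (fun M _ xs => P M xs → Q M xs) := by
  obtain ⟨φ, h1, h2⟩ := hP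
  obtain ⟨ψ, h3, h4⟩ := hQ
  exact ⟨φ ⟹ ψ, h1.imp h3, fun M _ xs => by rw [h2, h4]; simp⟩
instance d0_not (P : URel m) [hP : D0 m P] : D0 m (fun M _ xs => ¬ P M xs) :=
  d0_imp P (fun _ _ _ => False)
instance d0_true : D0 m (fun _ _ _ => True) := by
  simpa using d0_not (m := m) (fun _ _ _ => False)
instance d0_and (P Q : URel m) [hP : D0 m P] [hQ : D0 m Q] :
    D0 m (fun M _ xs => P M xs ∧ Q M xs) := by
  obtain ⟨φ, h1, h2⟩ := hP
  obtain ⟨ψ, h3, h4⟩ := hQ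
  exact ⟨φ ⊓ ψ, delta0_inf h1 h3, fun M _ xs => by rw [h2, h4]; simp⟩
instance d0_or (P Q : URel m) [hP : D0 m P] [hQ : D0 m Q] :
    D0 m (fun M _ xs => P M xs ∨ Q M xs) := by
  obtain ⟨φ, h1, h2⟩ := hP
  obtain ⟨ψ, h3, h4⟩ := hQ
  exact ⟨φ ⊔ ψ, delta0_sup h1 h3, fun M _ xs => by rw [h2, h4]; simp⟩
instance d0_iff (P Q : URel m) [hP : D0 m P] [hQ : D0 m Q] :
    D0 m (fun M _ xs => P M xs ↔ Q M xs) :=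
  D0.congr (d0_and (fun M _ xs => P M xs → Q M xs) (fun M _ xs => Q M xs → P M xs))
    (fun _ _ _ => iff_iff_implies_and_implies)
instance d0_eq (t u : UFun m) [ht : Tm m t] [hu : Tm m u] :
    D0 m (fun M _ xs => t M xs = u M xs) := by
  obtain ⟨τ, hτ⟩ := ht
  obtain ⟨υ, hυ⟩ := hu
  exact ⟨τ =' υ, IsDelta0.equal _ _, fun M _ xs => by rw [hτ, hυ]; simp⟩
instance d0_le (t u : UFun m) [ht : Tm m t] [hu : Tm m u] :
    D0 m (fun M _ xs => t M xs ≤ u M xs) := by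
  obtain ⟨τ, hτ⟩ := ht
  obtain ⟨υ, hυ⟩ := hu
  exact ⟨leF τ υ, IsDelta0.le _ _, fun M _ xs => by rw [hτ, hυ]; simp⟩
instance d0_lt (t u : UFun m) [ht : Tm m t] [hu : Tm m u] :
    D0 m (fun M _ xs => t M xs < u M xs) :=
  D0.congr (d0_not (fun M _ xs => u M xs ≤ t M xs)) (fun _ _ _ => not_le.symm)

theorem realize_wk {M : Type} [PAM M] (t : LA.Term (Empty ⊕ Fin m)) (xs : Fin m → M) (y : M) :
    (t.relabel (Sum.map id Fin.castSucc)).realize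
      (Sum.elim default (Fin.snoc xs y : Fin (m+1) → M)) = t.realize (Sum.elim default xs) := by
  rw [Term.realize_relabel]
  congr 1
  funext x
  rcases x with e | i
  · exact e.elim
  · simp

theorem snoc_cs {M : Type} (xs : Fin m → M) (y : M) :
    (fun i => (Fin.snoc xs y : Fin (m+1) → M) (Fin.castSucc i)) = xs := by
  funext i; simp

instance d0_ball (t : UFun m) (P : ∀ (M : Type) [PAM M], (Fin m → M) → M → Prop) [ht : Tm m t]
    [hP : D0 (m+1) (fun M _ xs => P M (fun i => xs (Fin.castSucc i)) (xs (Fin.last m)))] :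
    D0 m (fun M _ xs => ∀ y, y ≤ t M xs → P M xs y) := by
  obtain ⟨τ, hτ⟩ := ht
  obtain ⟨φ, h1, h2⟩ := hP
  refine ⟨_, IsDelta0.ball τ h1, fun M _ xs => ?_⟩
  simp only [BoundedFormula.realize_all, BoundedFormula.realize_imp, realize_leF, realize_wk,
    realize_vT, ← h2, snoc_cs, Fin.snoc_last, hτ, rl_eq]

instance d0_bex (t : UFun m) (P : ∀ (M : Type) [PAM M], (Fin m → M) → M → Prop) [ht : Tm m t]
    [hP : D0 (m+1) (fun M _ xs => P M (fun i => xs (Fin.castSucc i)) (xs (Fin.last m)))] :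
    D0 m (fun M _ xs => ∃ y, y ≤ t M xs ∧ P M xs y) := by
  obtain ⟨τ, hτ⟩ := ht
  obtain ⟨φ, h1, h2⟩ := hP
  refine ⟨_, IsDelta0.bex τ h1, fun M _ xs => ?_⟩
  simp only [BoundedFormula.realize_ex, BoundedFormula.realize_inf, realize_leF, realize_wk,
    realize_vT, ← h2, snoc_cs, Fin.snoc_last, hτ, rl_eq]


theorem delta0_subst {φ : LA.BoundedFormula Empty m} (hφ : IsDelta0 φ) :
    ∀ {l : ℕ} (ts : Fin m → UFun l) (_ : ∀ i, Tm l (ts i)),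
      D0 l (fun M _ xs => φ.Realize default (fun i => ts i M xs)) := by
  induction hφ with
  | falsum => intro l ts hts; exact D0.congr d0_false (fun _ _ _ => by simp)
  | @equal m t u =>
    intro l ts hts
    have h : ∀ t : LA.Term (Empty ⊕ Fin m), Tm l (fun M _ xs => t.realize
      (Sum.elim default (fun i => ts i M xs))) := fun t =>
      haveI : Tm m (fun M _ xs => t.realize (Sum.elim default xs)) := ⟨t, fun _ _ _ => rfl⟩
      tm_subst (fun M _ xs => t.realize (Sum.elim default xs)) ts
    haveI := h t
    haveI := h u
    exact D0.congr (d0_eq (fun M _ xs => t.realize (Sum.elim default (fun i => ts i M xs)))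
      (fun M _ xs => u.realize (Sum.elim default (fun i => ts i M xs)))) (fun _ _ _ => by simp)
  | @le m t u =>
    intro l ts hts
    have h : ∀ t : LA.Term (Empty ⊕ Fin m), Tm l (fun M _ xs => t.realize
      (Sum.elim default (fun i => ts i M xs))) := fun t =>
      haveI : Tm m (fun M _ xs => t.realize (Sum.elim default xs)) := ⟨t, fun _ _ _ => rfl⟩
      tm_subst (fun M _ xs => t.realize (Sum.elim default xs)) ts
    haveI := h t
    haveI := h u
    exact D0.congr (d0_le (fun M _ xs => t.realize (Sum.elim default (fun i => ts i M xs)))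
      (fun M _ xs => u.realize (Sum.elim default (fun i => ts i M xs)))) (fun _ _ _ => by simp)
  | imp _ _ ih1 ih2 =>
    intro l ts hts
    haveI := ih1 ts hts
    haveI := ih2 ts hts
    exact D0.congr (d0_imp _ _) (fun M _ xs => by rw [BoundedFormula.realize_imp])
  | @ball m t φ _ ih =>
    intro l ts hts
    haveI : Tm m (fun M _ xs => t.realize (Sum.elim default xs)) := ⟨t, fun _ _ _ => rfl⟩
    haveI := tm_subst (fun M _ xs => t.realize (Sum.elim default xs)) ts
    haveI := ih (l := l + 1) (Fin.snoc (α := fun _ => UFun (l+1))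
      (fun i M _ xs => ts i M (fun j => xs (Fin.castSucc j)))
      (fun M _ xs => xs (Fin.last l))) (fun i => by
        refine Fin.lastCases ?_ (fun j => ?_) i
        · rw [Fin.snoc_last]; infer_instance
        · rw [Fin.snoc_castSucc]
          haveI := hts j
          exact tm_subst (ts j) (fun j M _ xs => xs (Fin.castSucc j)))
    have e : ∀ (M : Type) [PAM M] (xs : Fin (l+1) → M),
      (fun i => (Fin.snoc (α := fun _ => UFun (l+1))
      (fun i M _ xs => ts i M (fun j => xs (Fin.castSucc j)))
      (fun M _ xs => xs (Fin.last l)) : Fin (m+1) → UFun (l+1)) i M xs) =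
      Fin.snoc (fun i => ts i M (fun j => xs (Fin.castSucc j))) (xs (Fin.last l)) := by
      intro M _ xs
      funext i
      refine Fin.lastCases ?_ (fun j => ?_) i
      · rw [Fin.snoc_last, Fin.snoc_last]
      · rw [Fin.snoc_castSucc, Fin.snoc_castSucc]
    haveI := this.congr (Q := fun M _ xs => φ.Realize default (Fin.snoc
      (fun i => ts i M (fun j => xs (Fin.castSucc j))) (xs (Fin.last l))))
      (fun M _ xs => by rw [e])
    refine D0.congr (d0_ball (fun M _ xs => t.realize (Sum.elim default (fun i => ts i M xs)))
      (fun M _ xs y => φ.Realize default (Fin.snoc (fun i => ts i M xs) y))) (fun M _ xs => ?_)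
    simp only [BoundedFormula.realize_all, BoundedFormula.realize_imp, realize_leF, realize_wk,
      realize_vT, Fin.snoc_last, rl_eq]
  | @bex m t φ _ ih =>
    intro l ts hts
    haveI : Tm m (fun M _ xs => t.realize (Sum.elim default xs)) := ⟨t, fun _ _ _ => rfl⟩
    haveI := tm_subst (fun M _ xs => t.realize (Sum.elim default xs)) ts
    haveI := ih (l := l + 1) (Fin.snoc (α := fun _ => UFun (l+1))
      (fun i M _ xs => ts i M (fun j => xs (Fin.castSucc j)))
      (fun M _ xs => xs (Fin.last l))) (fun i => by
        refine Fin.lastCases ?_ (fun j => ?_) i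
        · rw [Fin.snoc_last]; infer_instance
        · rw [Fin.snoc_castSucc]
          haveI := hts j
          exact tm_subst (ts j) (fun j M _ xs => xs (Fin.castSucc j)))
    have e : ∀ (M : Type) [PAM M] (xs : Fin (l+1) → M),
      (fun i => (Fin.snoc (α := fun _ => UFun (l+1))
      (fun i M _ xs => ts i M (fun j => xs (Fin.castSucc j)))
      (fun M _ xs => xs (Fin.last l)) : Fin (m+1) → UFun (l+1)) i M xs) =
      Fin.snoc (fun i => ts i M (fun j => xs (Fin.castSucc j))) (xs (Fin.last l)) := by
      intro M _ xs
      funext i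
      refine Fin.lastCases ?_ (fun j => ?_) i
      · rw [Fin.snoc_last, Fin.snoc_last]
      · rw [Fin.snoc_castSucc, Fin.snoc_castSucc]
    haveI := this.congr (Q := fun M _ xs => φ.Realize default (Fin.snoc
      (fun i => ts i M (fun j => xs (Fin.castSucc j))) (xs (Fin.last l))))
      (fun M _ xs => by rw [e])
    refine D0.congr (d0_bex (fun M _ xs => t.realize (Sum.elim default (fun i => ts i M xs)))
      (fun M _ xs y => φ.Realize default (Fin.snoc (fun i => ts i M xs) y))) (fun M _ xs => ?_)
    simp only [BoundedFormula.realize_ex, BoundedFormula.realize_inf, realize_leF, realize_wk,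
      realize_vT, Fin.snoc_last, rl_eq]

theorem d0_subst {l : ℕ} (R : URel m) [hR : D0 m R] (ts : Fin m → UFun l)
    [hts : ∀ i, Tm l (ts i)] : D0 l (fun M _ xs => R M (fun i => ts i M xs)) := by
  obtain ⟨φ, h1, h2⟩ := hR
  exact (delta0_subst h1 ts hts).congr (fun M _ xs => h2 M _)

end D0closure

end Classes

section Fmclosure
variable {M : Type} [PAM M] {m : ℕ}

theorem Fm.congr {P Q : (Fin m → M) → Prop} (h : Fm M m P) (e : ∀ xs, Q xs ↔ P xs) :
    Fm M m Q := by
  obtain ⟨φ, h2⟩ := h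
  exact ⟨φ, fun xs => (e xs).trans (h2 xs)⟩

instance fm_const (p : Prop) : Fm M m (fun _ => p) := by
  by_cases hp : p
  · exact ⟨⊤, fun _ => by simp [hp]⟩
  · exact ⟨⊥, fun _ => by simp [hp]⟩
instance fm_imp (P Q : (Fin m → M) → Prop) [hP : Fm M m P] [hQ : Fm M m Q] :
    Fm M m (fun xs => P xs → Q xs) := by
  obtain ⟨φ, h2⟩ := hP
  obtain ⟨ψ, h4⟩ := hQ
  exact ⟨φ ⟹ ψ, fun xs => by rw [h2, h4]; simp⟩
instance fm_not (P : (Fin m → M) → Prop) [hP : Fm M m P] : Fm M m (fun xs => ¬ P xs) :=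
  fm_imp P (fun _ => False)
instance fm_and (P Q : (Fin m → M) → Prop) [hP : Fm M m P] [hQ : Fm M m Q] :
    Fm M m (fun xs => P xs ∧ Q xs) := by
  obtain ⟨φ, h2⟩ := hP
  obtain ⟨ψ, h4⟩ := hQ
  exact ⟨φ ⊓ ψ, fun xs => by rw [h2, h4]; simp⟩
instance fm_or (P Q : (Fin m → M) → Prop) [hP : Fm M m P] [hQ : Fm M m Q] :
    Fm M m (fun xs => P xs ∨ Q xs) := by
  obtain ⟨φ, h2⟩ := hP
  obtain ⟨ψ, h4⟩ := hQ
  exact ⟨φ ⊔ ψ, fun xs => by rw [h2, h4]; simp⟩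
instance fm_iff (P Q : (Fin m → M) → Prop) [hP : Fm M m P] [hQ : Fm M m Q] :
    Fm M m (fun xs => P xs ↔ Q xs) :=
  Fm.congr (fm_and (fun xs => P xs → Q xs) (fun xs => Q xs → P xs))
    (fun _ => iff_iff_implies_and_implies)
instance fm_eq (t u : (Fin m → M) → M) [ht : FT M m t] [hu : FT M m u] :
    Fm M m (fun xs => t xs = u xs) := by
  obtain ⟨τ, hτ⟩ := ht
  obtain ⟨υ, hυ⟩ := hu
  exact ⟨τ =' υ, fun xs => by rw [hτ, hυ]; simp⟩
instance fm_le (t u : (Fin m → M) → M) [ht : FT M m t] [hu : FT M m u] :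
    Fm M m (fun xs => t xs ≤ u xs) := by
  obtain ⟨τ, hτ⟩ := ht
  obtain ⟨υ, hυ⟩ := hu
  exact ⟨leF τ υ, fun xs => by rw [hτ, hυ]; simp⟩
instance fm_lt (t u : (Fin m → M) → M) [ht : FT M m t] [hu : FT M m u] :
    Fm M m (fun xs => t xs < u xs) :=
  Fm.congr (fm_not (fun xs => u xs ≤ t xs)) (fun _ => not_le.symm)
instance fm_all (P : (Fin m → M) → M → Prop)
    [hP : Fm M (m+1) (fun xs => P (fun i => xs (Fin.castSucc i)) (xs (Fin.last m)))] :
    Fm M m (fun xs => ∀ y, P xs y) := by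
  obtain ⟨φ, h2⟩ := hP
  refine ⟨∀' φ, fun xs => ?_⟩
  simp only [BoundedFormula.realize_all, ← h2, snoc_cs, Fin.snoc_last]
instance fm_ex (P : (Fin m → M) → M → Prop)
    [hP : Fm M (m+1) (fun xs => P (fun i => xs (Fin.castSucc i)) (xs (Fin.last m)))] :
    Fm M m (fun xs => ∃ y, P xs y) := by
  obtain ⟨φ, h2⟩ := hP
  refine ⟨∃' φ, fun xs => ?_⟩
  simp only [BoundedFormula.realize_ex, ← h2, snoc_cs, Fin.snoc_last]
instance fm_dvd (t u : (Fin m → M) → M) [ht : FT M m t] [hu : FT M m u] :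
    Fm M m (fun xs => t xs ∣ u xs) := by
  obtain ⟨τ, hτ⟩ := ht
  obtain ⟨υ, hυ⟩ := hu
  refine ⟨∃' ((υ.relabel (Sum.map id Fin.castSucc)) =' mulT (τ.relabel (Sum.map id Fin.castSucc)) (Term.var (Sum.inr (Fin.last m)))), fun xs => ?_⟩
  simp only [BoundedFormula.realize_ex, BoundedFormula.realize_bdEqual, realize_mulT,
    Term.realize_relabel, Sum.elim_comp_map, rm_eq, hτ, hυ]
  simp [Function.comp_def, dvd_def]

theorem ft_subst {α : Type} (v : α → M) (τ : LA.Term (α ⊕ Fin m)) {l : ℕ} (ts : Fin m → (Fin l → M) → M)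
    [hts : ∀ i, FT M l (ts i)] :
    FT M l (fun xs => τ.realize (Sum.elim v (fun i => ts i xs))) := by
  have h := fun i => (hts i).out
  choose υ hυ using h
  refine ⟨τ.subst (Sum.elim (fun e => Term.var (Sum.inl (v e))) υ), fun xs => ?_⟩
  rw [Term.realize_subst]
  congr 1
  funext x
  rcases x with e | i
  · simp
  · simp [hυ]

theorem fm_subst_fml {α : Type} (v : α → M) (φ : LA.BoundedFormula α m) :
    ∀ {l : ℕ} (ts : Fin m → (Fin l → M) → M) (_ : ∀ i, FT M l (ts i)),
      Fm M l (fun xs => φ.Realize v (fun i => ts i xs)) := by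
  induction φ with
  | falsum => intro l ts hts; exact Fm.congr (fm_const False) (fun _ => Iff.rfl)
  | equal t u =>
    intro l ts hts
    haveI := ft_subst v t ts
    haveI := ft_subst v u ts
    exact Fm.congr (fm_eq _ _) (fun _ => Iff.rfl)
  | @rel n k r t =>
    intro l ts hts
    match k, r, t with
    | 0, r, _ => exact (show Empty from r).elim
    | 1, r, _ => exact (show Empty from r).elim
    | 2, r, t =>
      haveI := ft_subst v (t 0) ts
      haveI := ft_subst v (t 1) ts
      exact Fm.congr (fm_le (fun xs => (t 0).realize (Sum.elim v (fun i => ts i xs)))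
        (fun xs => (t 1).realize (Sum.elim v (fun i => ts i xs)))) (fun _ => Iff.rfl)
    | (_ + 3), r, _ => exact (show Empty from r).elim
  | imp _ _ ih1 ih2 =>
    intro l ts hts
    haveI := ih1 ts hts
    haveI := ih2 ts hts
    exact Fm.congr (fm_imp _ _) (fun xs => by rw [BoundedFormula.realize_imp])
  | @all m φ ih =>
    intro l ts hts
    haveI := ih (l := l + 1) (Fin.snoc (α := fun _ => (Fin (l+1) → M) → M)
      (fun i xs => ts i (fun j => xs (Fin.castSucc j)))
      (fun xs => xs (Fin.last l))) (fun i => by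
        refine Fin.lastCases ?_ (fun j => ?_) i
        · rw [Fin.snoc_last]; infer_instance
        · rw [Fin.snoc_castSucc]
          obtain ⟨τ, hτ⟩ := hts j
          refine ⟨τ.relabel (Sum.map id Fin.castSucc), fun xs => ?_⟩
          rw [hτ, Term.realize_relabel, Sum.elim_comp_map]; rfl)
    have e : ∀ (xs : Fin (l+1) → M),
      (fun i => (Fin.snoc (α := fun _ => (Fin (l+1) → M) → M)
      (fun i xs => ts i (fun j => xs (Fin.castSucc j)))
      (fun xs => xs (Fin.last l)) : Fin (m+1) → (Fin (l+1) → M) → M) i xs) =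
      Fin.snoc (fun i => ts i (fun j => xs (Fin.castSucc j))) (xs (Fin.last l)) := by
      intro xs
      funext i
      refine Fin.lastCases ?_ (fun j => ?_) i
      · rw [Fin.snoc_last, Fin.snoc_last]
      · rw [Fin.snoc_castSucc, Fin.snoc_castSucc]
    haveI := this.congr (Q := fun xs => φ.Realize v (Fin.snoc
      (fun i => ts i (fun j => xs (Fin.castSucc j))) (xs (Fin.last l))))
      (fun xs => by rw [e])
    refine Fm.congr (fm_all
      (fun xs y => φ.Realize v (Fin.snoc (fun i => ts i xs) y))) (fun xs => ?_)
    simp only [BoundedFormula.realize_all]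

theorem fm_of_d0 {l : ℕ} (R : URel m) (hR : D0 m R) (ts : Fin m → (Fin l → M) → M)
    (hts : ∀ i, FT M l (ts i)) : Fm M l (fun xs => R M (fun i => ts i xs)) := by
  obtain ⟨φ, h1, h2⟩ := hR
  exact (fm_subst_fml default φ ts hts).congr (fun xs => h2 M _)

theorem fm_subst {l : ℕ} (R : (Fin m → M) → Prop) (hR : Fm M m R) (ts : Fin m → (Fin l → M) → M)
    (hts : ∀ i, FT M l (ts i)) : Fm M l (fun xs => R (fun i => ts i xs)) := by
  obtain ⟨φ, h2⟩ := hR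
  exact (fm_subst_fml id φ ts hts).congr (fun xs => h2 _)

theorem fm_app1 {P : M → Prop} (h : Fm M 1 (fun xs => P (xs 0))) {l : ℕ}
    (t : (Fin l → M) → M) [ht : FT M l t] : Fm M l (fun xs => P (t xs)) :=
  fm_subst _ h ![t] (fun i => by fin_cases i; exact ht)

theorem fm_app2 {P : M → M → Prop} (h : Fm M 2 (fun xs => P (xs 0) (xs 1))) {l : ℕ}
    (t u : (Fin l → M) → M) [ht : FT M l t] [hu : FT M l u] : Fm M l (fun xs => P (t xs) (u xs)) :=
  fm_subst _ h ![t, u] (fun i => by fin_cases i; exact ht; exact hu)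

/-- A subset of `M` definable with parameters. -/
abbrev Dfn (M : Type) [PAM M] (P : M → Prop) : Prop := Fm M 1 (fun xs => P (xs 0))

theorem pam_ind (P : M → Prop) [hP : Dfn M P] (h0 : P 0) (h1 : ∀ x, P x → P (x+1)) (x : M) :
    P x := by
  classical
  obtain ⟨φ, hφ⟩ := hP
  let s := φ.freeVarFinset
  let e : s ≃ Fin s.card := s.equivFin
  let ψ : LA.BoundedFormula Empty (s.card + 1) :=
    (φ.restrictFreeVar (β := Fin s.card) (fun i => e i)).relabel
      (fun i : Fin s.card => (Sum.inr i : Empty ⊕ Fin s.card))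
  let ps : Fin s.card → M := fun i => (e.symm i : M)
  have key : ∀ x, ψ.Realize default (Fin.snoc ps x) ↔ P x := by
    intro x
    have h3 : P x ↔ φ.Realize id ![x] := hφ ![x]
    rw [h3]
    have h1 : ((Fin.snoc ps x : Fin (s.card + 1) → M) ∘ Fin.natAdd s.card) = ![x] := by
      funext i
      have : i = 0 := Subsingleton.elim _ _
      subst this
      exact Fin.snoc_last (α := fun _ => M) (x := x) (p := ps)
    rw [BoundedFormula.realize_relabel, h1]
    rw [BoundedFormula.realize_restrictFreeVar (v' := (id : M → M))]
    intro a
    change (Fin.snoc ps x : Fin (s.card + 1) → M) (Fin.castSucc (e a)) = _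
    rw [Fin.snoc_castSucc]
    simp [ps]
  rw [← key]
  refine PAM.ind ψ ps ((key 0).2 h0) (fun x hx => (key _).2 (h1 x ((key x).1 hx))) x

theorem pam_sind (P : M → Prop) [hP : Dfn M P] (h : ∀ x, (∀ y, y < x → P y) → P x) (x : M) :
    P x := by
  haveI : ∀ (l : ℕ) (t : (Fin l → M) → M) [FT M l t], Fm M l (fun xs => P (t xs)) :=
    fun l t _ => fm_app1 hP t
  refine pam_ind (fun x => ∀ y, y < x → P y) (fun y hy => absurd hy not_lt_zero)
    (fun x hx y hy => ?_) (x + 1) x (pam_lt_add_one x)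
  rw [pam_lt_succ] at hy
  rcases hy.eq_or_lt with rfl | hy
  · exact h _ hx
  · exact hx _ hy

theorem pam_least (P : M → Prop) [hP : Dfn M P] (h : ∃ x, P x) :
    ∃ x, P x ∧ ∀ y, y < x → ¬ P y := by
  by_contra hc
  push Not at hc
  obtain ⟨x, hx⟩ := h
  haveI : Dfn M (fun x => ¬ P x) := fm_not (m := 1) (fun xs => P (xs 0))
  refine pam_sind (fun x => ¬ P x) (fun x ih hx => ?_) x hx
  obtain ⟨y, hy, hy2⟩ := hc x hx
  exact ih y hy hy2

theorem pam_collect (P : M → M → Prop) [hP : Fm M 2 (fun xs => P (xs 0) (xs 1))] (t : M)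
    (h : ∀ x, x ≤ t → ∃ y, P x y) : ∃ w, ∀ x, x ≤ t → ∃ y, y ≤ w ∧ P x y := by
  haveI : ∀ (l : ℕ) (t u : (Fin l → M) → M) [FT M l t] [FT M l u],
    Fm M l (fun xs => P (t xs) (u xs)) := fun l t u _ _ => fm_app2 hP t u
  have := pam_ind (fun s => ∃ w, ∀ x, x ≤ s → x ≤ t → ∃ y, y ≤ w ∧ P x y) ?_ ?_ t
  · obtain ⟨w, hw⟩ := this
    exact ⟨w, fun x hx => hw x hx hx⟩
  · obtain ⟨y, hy⟩ := h 0 zero_le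
    refine ⟨y, fun x hx _ => ⟨y, le_rfl, ?_⟩⟩
    obtain rfl : x = 0 := le_antisymm hx zero_le
    exact hy
  · rintro s ⟨w, hw⟩
    by_cases hs : s + 1 ≤ t
    · obtain ⟨y, hy⟩ := h _ hs
      refine ⟨max w y, fun x hx hxt => ?_⟩
      rcases hx.eq_or_lt with rfl | hx
      · exact ⟨y, le_max_right _ _, hy⟩
      · rw [pam_lt_succ] at hx
        obtain ⟨z, hz, hz2⟩ := hw x hx hxt
        exact ⟨z, hz.trans (le_max_left _ _), hz2⟩
    · refine ⟨w, fun x hx hxt => hw x ?_ hxt⟩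
      rw [← pam_lt_succ]
      exact lt_of_le_of_lt hxt (not_le.1 hs)

end Fmclosure

section SigmaClasses

/-- Binary-split uniform relations. -/
abbrev URel1 (m : ℕ) : Type 1 := ∀ (M : Type) [PAM M], (Fin m → M) → M → Prop

/-- Uncurrying the last variable. -/
abbrev unc {m : ℕ} (Q : URel1 m) : URel (m+1) :=
  fun M _ xs => Q M (fun i => xs (Fin.castSucc i)) (xs (Fin.last m))

/-- Uncurrying the last two variables. -/
abbrev unc2 {m : ℕ} (Q : ∀ (M : Type) [PAM M], (Fin m → M) → M → M → Prop) : URel (m+2) :=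
  fun M _ xs => Q M (fun i => xs (Fin.castSucc (Fin.castSucc i)))
    (xs (Fin.castSucc (Fin.last m))) (xs (Fin.last (m+1)))

/-- `Σ_k` relations, uniformly over models of PA. -/
def Sg : ℕ → ∀ m, URel m → Prop
  | 0, m, R => D0 m R
  | k + 1, m, R => ∃ Q : URel1 m, Sg k (m+1) (unc Q) ∧
      ∀ (M : Type) [PAM M] (xs : Fin m → M), R M xs ↔ ∃ y, ¬ Q M xs y

/-- Class version of `Sg`. -/
class SC (k m : ℕ) (R : URel m) : Prop where
  out : Sg k m R

theorem SC.congr {k m : ℕ} {P Q : URel m} (h : SC k m P)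
    (e : ∀ (M : Type) [PAM M] xs, Q M xs ↔ P M xs) : SC k m Q := by
  have : Q = P := by
    funext M i xs
    exact propext (e M xs)
  rw [this]; exact h

theorem sc_zero {m : ℕ} {R : URel m} : SC 0 m R ↔ D0 m R := ⟨fun h => h.out, fun h => ⟨h⟩⟩
theorem sc_succ {k m : ℕ} {R : URel m} : SC (k+1) m R ↔ ∃ Q : URel1 m, SC k (m+1) (unc Q) ∧
      ∀ (M : Type) [PAM M] (xs : Fin m → M), R M xs ↔ ∃ y, ¬ Q M xs y := by
  constructor
  · rintro ⟨Q, h1, h2⟩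
    exact ⟨Q, ⟨h1⟩, h2⟩
  · rintro ⟨Q, ⟨h1⟩, h2⟩
    exact ⟨Q, h1, h2⟩

theorem sc_subst : ∀ {k m l : ℕ} (R : URel m) (_ : SC k m R) (ts : Fin m → UFun l)
    (_ : ∀ i, Tm l (ts i)), SC k l (fun M _ xs => R M (fun i => ts i M xs)) := by
  intro k
  induction k with
  | zero =>
    intro m l R h ts hts
    rw [sc_zero] at *
    exact d0_subst R ts
  | succ k ih =>
    intro m l R h ts hts
    rw [sc_succ] at *
    obtain ⟨Q, h1, h2⟩ := h
    refine ⟨fun M _ xs y => Q M (fun i => ts i M xs) y, ?_, fun M _ xs => h2 M _⟩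
    have := ih (l := l+1) (unc Q) h1 (Fin.snoc (α := fun _ => UFun (l+1))
      (fun i M _ xs => ts i M (fun j => xs (Fin.castSucc j)))
      (fun M _ xs => xs (Fin.last l))) (fun i => by
        refine Fin.lastCases ?_ (fun j => ?_) i
        · rw [Fin.snoc_last]; infer_instance
        · rw [Fin.snoc_castSucc]
          haveI := hts j
          exact tm_subst (ts j) (fun j M _ xs => xs (Fin.castSucc j)))
    refine this.congr (fun M _ xs => ?_)
    simp only [unc, Fin.snoc_castSucc, Fin.snoc_last]

theorem sc_subst1 {k m l : ℕ} (Q : URel1 m) (h : SC k (m+1) (unc Q)) (ts : Fin m → UFun l)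
    (u : UFun l) [hts : ∀ i, Tm l (ts i)] [hu : Tm l u] :
    SC k l (fun M _ xs => Q M (fun i => ts i M xs) (u M xs)) := by
  refine (sc_subst (unc Q) h (Fin.snoc (α := fun _ => UFun l) ts u) (fun i => ?_)).congr
    (fun M _ xs => ?_)
  · refine Fin.lastCases ?_ (fun j => ?_) i
    · rw [Fin.snoc_last]; exact hu
    · rw [Fin.snoc_castSucc]; exact hts j
  · simp only [unc, Fin.snoc_castSucc, Fin.snoc_last]

theorem sc_subst2 {k m l : ℕ} (Q : ∀ (M : Type) [PAM M], (Fin m → M) → M → M → Prop)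
    (h : SC k (m+2) (unc2 Q)) (ts : Fin m → UFun l)
    (u v : UFun l) [hts : ∀ i, Tm l (ts i)] [hu : Tm l u] [hv : Tm l v] :
    SC k l (fun M _ xs => Q M (fun i => ts i M xs) (u M xs) (v M xs)) := by
  refine (sc_subst (unc2 Q) h (Fin.snoc (α := fun _ => UFun l)
    (Fin.snoc (α := fun _ => UFun l) ts u) v) (fun i => ?_)).congr (fun M _ xs => ?_)
  · refine Fin.lastCases ?_ (fun j => ?_) i
    · rw [Fin.snoc_last]; exact hv
    · rw [Fin.snoc_castSucc]
      refine Fin.lastCases ?_ (fun j => ?_) j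
      · rw [Fin.snoc_last]; exact hu
      · rw [Fin.snoc_castSucc]; exact hts j
  · simp only [unc2, Fin.snoc_castSucc, Fin.snoc_last]

theorem sc_not {k m : ℕ} (R : URel m) (h : SC k m R) : SC (k+1) m (fun M _ xs => ¬ R M xs) := by
  rw [sc_succ]
  refine ⟨fun M _ xs _ => R M xs, ?_, fun M _ xs => by simp⟩
  exact sc_subst R h (fun i _ _ xs => xs (Fin.castSucc i)) (fun i => inferInstance)

theorem sc_fm : ∀ {k m : ℕ} (R : URel m) (_ : SC k m R), ∃ φ : LA.BoundedFormula Empty m,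
    ∀ (M : Type) [PAM M] (xs : Fin m → M), R M xs ↔ φ.Realize default xs := by
  intro k
  induction k with
  | zero =>
    intro m R h
    obtain ⟨φ, h1, h2⟩ := sc_zero.1 h
    exact ⟨φ, h2⟩
  | succ k ih =>
    intro m R h
    obtain ⟨Q, h1, h2⟩ := sc_succ.1 h
    obtain ⟨φ, hφ⟩ := ih _ h1
    refine ⟨∃' ∼φ, fun M _ xs => ?_⟩
    rw [h2]
    simp [← hφ, unc]

theorem fm_of_sc {M : Type} [PAM M] {k m l : ℕ} (R : URel m) (hR : SC k m R)
    (ts : Fin m → (Fin l → M) → M)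
    (hts : ∀ i, FT M l (ts i)) : Fm M l (fun xs => R M (fun i => ts i xs)) := by
  obtain ⟨φ, h2⟩ := sc_fm R hR
  exact (fm_subst_fml default φ ts hts).congr (fun xs => h2 M _)

/-- Closure properties of `Σ_k`, as an induction hypothesis. -/
structure Clo (k : ℕ) : Prop where
  and : ∀ {m : ℕ} (P Q : URel m) [SC k m P] [SC k m Q], SC k m (fun M _ xs => P M xs ∧ Q M xs)
  or : ∀ {m : ℕ} (P Q : URel m) [SC k m P] [SC k m Q], SC k m (fun M _ xs => P M xs ∨ Q M xs)
  bex : ∀ {m : ℕ} (t : UFun m) (P : URel1 m) [Tm m t] [SC k (m+1) (unc P)],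
    SC k m (fun M _ xs => ∃ y, y ≤ t M xs ∧ P M xs y)
  ball : ∀ {m : ℕ} (t : UFun m) (P : URel1 m) [Tm m t] [SC k (m+1) (unc P)],
    SC k m (fun M _ xs => ∀ y, y ≤ t M xs → P M xs y)

theorem clo (k : ℕ) : Clo k := by
  induction k with
  | zero =>
    refine ⟨fun P Q hP hQ => ?_, fun P Q hP hQ => ?_, fun t P ht hP => ?_, fun t P ht hP => ?_⟩ <;>
    · simp only [sc_zero] at *
      infer_instance
  | succ k ih =>
    have iand := @ih.and
    have ior := @ih.or
    have ibex := @ih.bex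
    have iball := @ih.ball
    refine ⟨fun {m} P Q hP hQ => ?_, fun {m} P Q hP hQ => ?_, fun {m} t P ht hP => ?_,
      fun {m} t P ht hP => ?_⟩
    · obtain ⟨P', p1, p2⟩ := sc_succ.1 hP
      obtain ⟨Q', q1, q2⟩ := sc_succ.1 hQ
      have p3 := fun {l} => @sc_subst1 k m l P' p1
      have q3 := fun {l} => @sc_subst1 k m l Q' q1
      rw [sc_succ]
      refine ⟨fun M _ xs w => ∀ y, y ≤ w → ∀ z, z ≤ w → P' M xs y ∨ Q' M xs z, ?_, ?_⟩
      · infer_instance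
      · intro M _ xs
        rw [p2, q2]
        constructor
        · rintro ⟨⟨y, hy⟩, z, hz⟩
          exact ⟨max y z, fun h => (h y (le_max_left _ _) z (le_max_right _ _)).elim hy hz⟩
        · rintro ⟨w, hw⟩
          push Not at hw
          obtain ⟨y, _, z, _, h1, h2⟩ := hw
          exact ⟨⟨y, h1⟩, z, h2⟩
    · obtain ⟨P', p1, p2⟩ := sc_succ.1 hP
      obtain ⟨Q', q1, q2⟩ := sc_succ.1 hQ
      rw [sc_succ]
      refine ⟨fun M _ xs y => P' M xs y ∧ Q' M xs y, iand (unc P') (unc Q'), ?_⟩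
      intro M _ xs
      rw [p2, q2, ← exists_or]
      simp only [not_and_or]
    · obtain ⟨P', p1, p2⟩ := sc_succ.1 hP
      let P'' : ∀ (M : Type) [PAM M], (Fin m → M) → M → M → Prop :=
        fun M _ xs x y => P' M (Fin.snoc xs x) y
      have e : unc2 P'' = unc P' := by
        funext M _ xs
        simp only [unc, unc2, P'']
        congr 2
        exact Fin.snoc_init_self (α := fun _ => M) (fun i : Fin (m+1) => xs i.castSucc)
      have p3 := fun {l} => @sc_subst2 k m l P'' (e ▸ p1)
      rw [sc_succ]
      refine ⟨fun M _ xs y => ∀ x, x ≤ t M xs → P'' M xs x y, ?_, ?_⟩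
      · haveI := tm_subst (l := m+1) t (fun i _ _ xs => xs (Fin.castSucc i))
        exact iball (fun M _ xs => t M (fun i => xs (Fin.castSucc i)))
          (fun M _ xs x => P'' M (fun i => xs (Fin.castSucc i)) x (xs (Fin.last m)))
      · intro M _ xs
        have : ∀ y, P M xs y ↔ ∃ z, ¬ P'' M xs y z := by
          intro y
          have := p2 M (Fin.snoc xs y)
          simpa only [unc, Fin.snoc_castSucc, Fin.snoc_last] using this
        simp only [this]
        constructor
        · rintro ⟨y, hy, z, hz⟩
          exact ⟨z, fun h => hz (h y hy)⟩
        · rintro ⟨z, hz⟩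
          push Not at hz
          obtain ⟨y, hy, h⟩ := hz
          exact ⟨y, hy, z, h⟩
    · obtain ⟨P', p1, p2⟩ := sc_succ.1 hP
      let P'' : ∀ (M : Type) [PAM M], (Fin m → M) → M → M → Prop :=
        fun M _ xs x y => P' M (Fin.snoc xs x) y
      have e : unc2 P'' = unc P' := by
        funext M _ xs
        simp only [unc, unc2, P'']
        congr 2
        exact Fin.snoc_init_self (α := fun _ => M) (fun i : Fin (m+1) => xs i.castSucc)
      have p3 := fun {l} => @sc_subst2 k m l P'' (e ▸ p1)
      rw [sc_succ]
      refine ⟨fun M _ xs w => ∃ x, x ≤ t M xs ∧ ∀ y, y ≤ w → P'' M xs x y, ?_, ?_⟩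
      · haveI := tm_subst (l := m+1) t (fun i _ _ xs => xs (Fin.castSucc i))
        haveI : SC k (m + 2) (unc (fun M _ (xs : Fin (m+1) → M) x => ∀ y, y ≤ xs (Fin.last m) →
           P'' M (fun i => xs (Fin.castSucc i)) x y)) :=
          iball (m := m + 2) (fun M _ xs => xs (Fin.castSucc (Fin.last m)))
            (fun M _ xs y => P'' M (fun i => xs (Fin.castSucc (Fin.castSucc i)))
              (xs (Fin.last (m+1))) y)
        exact ibex (fun M _ xs => t M (fun i => xs (Fin.castSucc i)))
          (fun M _ xs x => ∀ y, y ≤ xs (Fin.last m) → P'' M (fun i => xs (Fin.castSucc i)) x y)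
      · intro M _ xs
        have : ∀ y, P M xs y ↔ ∃ z, ¬ P'' M xs y z := by
          intro y
          have := p2 M (Fin.snoc xs y)
          simpa only [unc, Fin.snoc_castSucc, Fin.snoc_last] using this
        simp only [this]
        constructor
        · intro h
          haveI : Fm M 2 (fun ys => ¬ P'' M xs (ys 0) (ys 1)) := by
            haveI := fm_of_sc (M := M) (l := 2) (unc P') p1 (Fin.snoc (α := fun _ => (Fin 2 → M) → M)
              (Fin.snoc (α := fun _ => (Fin 2 → M) → M) (fun i _ => xs i) (fun ys => ys 0))
              (fun ys => ys 1)) (fun i => by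
                refine Fin.lastCases ?_ (fun j => ?_) i
                · rw [Fin.snoc_last]; infer_instance
                · rw [Fin.snoc_castSucc]
                  refine Fin.lastCases ?_ (fun j => ?_) j
                  · rw [Fin.snoc_last]; infer_instance
                  · rw [Fin.snoc_castSucc]; infer_instance)
            rw [← e] at this
            haveI := this.congr (Q := fun ys => P'' M xs (ys 0) (ys 1)) (fun ys => by
              simp only [unc2, Fin.snoc_castSucc, Fin.snoc_last])
            infer_instance
          obtain ⟨w, hw⟩ := pam_collect (fun x y => ¬ P'' M xs x y) (t M xs) h
          refine ⟨w, ?_⟩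
          push Not
          exact hw
        · rintro ⟨w, hw⟩ x hx
          push Not at hw
          obtain ⟨y, _, hy⟩ := hw x hx
          exact ⟨y, hy⟩

instance sc_and {k m : ℕ} (P Q : URel m) [SC k m P] [SC k m Q] :
    SC k m (fun M _ xs => P M xs ∧ Q M xs) := (clo k).and P Q
instance sc_or {k m : ℕ} (P Q : URel m) [SC k m P] [SC k m Q] :
    SC k m (fun M _ xs => P M xs ∨ Q M xs) := (clo k).or P Q
instance sc_bex {k m : ℕ} (t : UFun m) (P : URel1 m) [Tm m t]
    [SC k (m+1) (fun M _ xs => P M (fun i => xs (Fin.castSucc i)) (xs (Fin.last m)))] :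
    SC k m (fun M _ xs => ∃ y, y ≤ t M xs ∧ P M xs y) := (clo k).bex t P
instance sc_ball {k m : ℕ} (t : UFun m) (P : URel1 m) [Tm m t]
    [SC k (m+1) (fun M _ xs => P M (fun i => xs (Fin.castSucc i)) (xs (Fin.last m)))] :
    SC k m (fun M _ xs => ∀ y, y ≤ t M xs → P M xs y) := (clo k).ball t P

theorem sc_mono1 : ∀ {k m : ℕ} (R : URel m) (_ : SC k m R), SC (k+1) m R := by
  intro k
  induction k with
  | zero =>
    intro m R h
    have := sc_not _ (sc_zero.2 (@d0_not m R (sc_zero.1 h)))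
    simpa using this
  | succ k ih =>
    intro m R h
    obtain ⟨Q, h1, h2⟩ := sc_succ.1 h
    exact sc_succ.2 ⟨Q, ih _ h1, h2⟩

instance sc_d0 {k m : ℕ} (R : URel m) [h : D0 m R] : SC k m R := by
  induction k with
  | zero => exact sc_zero.2 h
  | succ k ih => exact sc_mono1 R ih

theorem sc_ex {k m : ℕ} (P : URel1 m) (h : SC (k+1) (m+1) (unc P)) :
    SC (k+1) m (fun M _ xs => ∃ y, P M xs y) := by
  obtain ⟨P', p1, p2⟩ := sc_succ.1 h
  let P'' : ∀ (M : Type) [PAM M], (Fin m → M) → M → M → Prop :=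
    fun M _ xs x y => P' M (Fin.snoc xs x) y
  have e : unc2 P'' = unc P' := by
    funext M _ xs
    simp only [unc, unc2, P'']
    congr 2
    exact Fin.snoc_init_self (α := fun _ => M) (fun i : Fin (m+1) => xs i.castSucc)
  have p3 := fun {l} => @sc_subst2 k m l P'' (e ▸ p1)
  rw [sc_succ]
  refine ⟨fun M _ xs w => ∀ x, x ≤ w → ∀ y, y ≤ w → P'' M xs x y, ?_, ?_⟩
  · infer_instance
  · intro M _ xs
    have : ∀ y, P M xs y ↔ ∃ z, ¬ P'' M xs y z := by
      intro y
      have := p2 M (Fin.snoc xs y)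
      simpa only [unc, Fin.snoc_castSucc, Fin.snoc_last] using this
    simp only [this]
    constructor
    · rintro ⟨y, z, hz⟩
      exact ⟨max y z, fun h => hz (h y (le_max_left _ _) z (le_max_right _ _))⟩
    · rintro ⟨w, hw⟩
      push Not at hw
      obtain ⟨y, _, z, _, h⟩ := hw
      exact ⟨y, z, h⟩

instance sc_exI {k m : ℕ} (P : URel1 m)
    [h : SC (k+1) (m+1) (fun M _ xs => P M (fun i => xs (Fin.castSucc i)) (xs (Fin.last m)))] :
    SC (k+1) m (fun M _ xs => ∃ y, P M xs y) := sc_ex P h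


mutual
theorem sc_of_sigma : ∀ {k m : ℕ} {φ : LA.BoundedFormula Empty m}, IsSigmaFml k φ →
    SC k m (fun _ _ xs => φ.Realize default xs)
  | _, _, _, .ofDelta0 h => sc_zero.2 ⟨_, h, fun _ _ _ => Iff.rfl⟩
  | _, _, _, .ofPi h => (sc_not _ (sc_of_pi h)).congr (fun _ _ _ => not_not.symm)
  | _, m, _, .ex (φ := φ) h => by
      refine (sc_ex (fun M _ xs y => φ.Realize default (Fin.snoc xs y : Fin (m+1) → M)) ?_).congr
        (fun M _ xs => BoundedFormula.realize_ex)
      refine (sc_of_sigma h).congr (fun M _ xs => ?_)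
      simp only [unc]
      rw [show Fin.snoc (fun i => xs (Fin.castSucc i)) (xs (Fin.last m)) = xs from
        Fin.snoc_init_self (α := fun _ => M) xs]
theorem sc_of_pi : ∀ {k m : ℕ} {φ : LA.BoundedFormula Empty m}, IsPiFml k φ →
    SC k m (fun _ _ xs => ¬ φ.Realize default xs)
  | _, _, _, .ofDelta0 h => sc_zero.2 ⟨_, delta0_not h, fun _ _ _ => BoundedFormula.realize_not.symm⟩
  | _, _, _, .ofSigma h => sc_not _ (sc_of_sigma h)
  | _, m, _, .all (φ := φ) h => by
      refine (sc_ex (fun M _ xs y => ¬ φ.Realize default (Fin.snoc xs y : Fin (m+1) → M)) ?_).congr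
        (fun M _ xs => by rw [BoundedFormula.realize_all, not_forall])
      refine (sc_of_pi h).congr (fun M _ xs => ?_)
      simp only [unc]
      rw [show Fin.snoc (fun i => xs (Fin.castSucc i)) (xs (Fin.last m)) = xs from
        Fin.snoc_init_self (α := fun _ => M) xs]
end

theorem fml_of_sc : ∀ {k m : ℕ} {R : URel m} (_ : SC k m R),
    (∃ φ : LA.BoundedFormula Empty m, IsSigmaFml k φ ∧
      ∀ (M : Type) [PAM M] (xs : Fin m → M), φ.Realize default xs ↔ R M xs) ∧
    (∃ φ : LA.BoundedFormula Empty m, IsPiFml k φ ∧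
      ∀ (M : Type) [PAM M] (xs : Fin m → M), φ.Realize default xs ↔ ¬ R M xs) := by
  intro k
  induction k with
  | zero =>
    intro m R h
    obtain ⟨φ, h1, h2⟩ := sc_zero.1 h
    exact ⟨⟨φ, .ofDelta0 h1, fun M _ xs => (h2 M xs).symm⟩,
      ⟨∼φ, .ofDelta0 (delta0_not h1), fun M _ xs => by rw [h2, BoundedFormula.realize_not]⟩⟩
  | succ k ih =>
    intro m R h
    obtain ⟨Q, h1, h2⟩ := sc_succ.1 h
    obtain ⟨⟨φ, a1, a2⟩, ψ, b1, b2⟩ := ih h1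
    refine ⟨⟨∃' ψ, .ex (.ofPi b1), fun M _ xs => ?_⟩, ⟨∀' φ, .all (.ofSigma a1), fun M _ xs => ?_⟩⟩
    · rw [h2, BoundedFormula.realize_ex]
      simp only [b2, unc, Fin.snoc_castSucc, Fin.snoc_last]
    · rw [h2, BoundedFormula.realize_all]
      simp only [a2, unc, Fin.snoc_castSucc, Fin.snoc_last, not_exists, not_not]

end SigmaClasses

section Coding

/-- Pairing, as a term. -/
def pr {M : Type} [CommSemiring M] (x y : M) : M := (x + y) * (x + y) + x

instance tm_pr {m : ℕ} (t u : UFun m) [Tm m t] [Tm m u] :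
    Tm m (fun M _ xs => pr (t M xs) (u M xs)) := by
  unfold pr; infer_instance
instance ft_pr {M : Type} [PAM M] {m : ℕ} (t u : (Fin m → M) → M) [FT M m t] [FT M m u] :
    FT M m (fun xs => pr (t xs) (u xs)) := by
  unfold pr; infer_instance

variable {M : Type} [PAM M]

theorem pam_le_mul_self (x : M) : x ≤ x * x := by
  rcases pam_cases x with rfl | ⟨y, rfl⟩
  · simp
  · have : (y + 1) * (y + 1) = (y + 1) + y * (y + 1) := by ring
    rw [this]; exact le_self_add

theorem le_pr_left (x y : M) : x ≤ pr x y := le_add_self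
theorem le_pr_right (x y : M) : y ≤ pr x y := by
  unfold pr
  calc y ≤ x + y := le_add_self
    _ ≤ (x + y) * (x + y) := pam_le_mul_self _
    _ ≤ _ := le_self_add

theorem pr_lt_of {x y x' y' : M} (h : x + y < x' + y') : pr x y < pr x' y' := by
  unfold pr
  have h1 : x + y + 1 ≤ x' + y' := pam_succ_le.2 h
  calc (x + y) * (x + y) + x ≤ (x + y) * (x + y) + (x + y) := by gcongr; exact le_self_add
    _ < (x + y) * (x + y) + (x + y) + 1 := pam_lt_add_one _
    _ ≤ (x + y + 1) * (x + y + 1) := by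
      have : (x + y + 1) * (x + y + 1) = (x + y) * (x + y) + (x + y) + 1 + (x + y) := by ring
      rw [this]; exact le_self_add
    _ ≤ (x' + y') * (x' + y') := by gcongr
    _ ≤ _ := le_self_add

theorem pr_inj {x y x' y' : M} : pr x y = pr x' y' ↔ x = x' ∧ y = y' := by
  constructor
  · intro h
    have hs : x + y = x' + y' := by
      rcases lt_trichotomy (x + y) (x' + y') with h1 | h1 | h1
      · exact absurd h (pr_lt_of h1).ne
      · exact h1
      · exact absurd h (pr_lt_of h1).ne'
    unfold pr at h
    rw [hs] at h
    have hx : x = x' := add_left_cancel h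
    subst hx
    exact ⟨rfl, add_left_cancel hs⟩
  · rintro ⟨rfl, rfl⟩; rfl

theorem cast_pr (a b : ℕ) : ((pr a b : ℕ) : M) = pr (a : M) (b : M) := by
  unfold pr; push_cast; ring

theorem pam_dvd_of_add {a x y : M} (h : a ∣ x + y) (h' : a ∣ y) : a ∣ x := by
  obtain ⟨k, hk⟩ := h
  obtain ⟨l, rfl⟩ := h'
  rcases le_total l k with h | h
  · obtain ⟨d, rfl⟩ := exists_add_of_le h
    refine ⟨d, ?_⟩
    rw [mul_add, add_comm x] at hk
    exact add_left_cancel hk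
  · have h1 : a * k ≤ a * l := by gcongr
    rw [← hk] at h1
    have : x = 0 := by
      by_contra hx
      have h2 : 0 < x := pos_iff_ne_zero.2 hx
      exact absurd h1 (not_le.2 (lt_add_of_pos_left _ h2))
    rw [this]; exact dvd_zero a

theorem pam_one_lt {b z : M} (hb : 0 < b) : ¬ (1 + (z+1) * b) ∣ 1 := by
  intro h
  obtain ⟨k, hk⟩ := h
  rcases pam_cases k with rfl | ⟨k, rfl⟩
  · simp at hk
  · have h0 : (1 : M) < 1 + (z+1) * b := lt_add_of_pos_right _ (mul_pos (lt_of_le_of_lt zero_le (pam_lt_add_one z)) hb)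
    have h1 : (1 + (z+1) * b) * (k + 1) = (1 + (z+1)*b) + (1 + (z+1)*b) * k := by ring
    rw [h1] at hk
    have h2 : (1 + (z+1) * b) ≤ 1 :=
      le_of_le_of_eq (le_self_add (a := 1 + (z+1) * b) (b := (1 + (z+1) * b) * k)) hk.symm
    exact absurd h0 (not_lt.2 h2)

theorem pam_cop {b w z z' c : M} (hb : ∀ i, i ≤ w → (i + 1) ∣ b) (hz : z ≤ w) (hz' : z' ≤ w)
    (hne : z ≠ z') (h : (1 + (z+1) * b) ∣ (1 + (z'+1) * b) * c) : (1 + (z+1) * b) ∣ c := by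
  have hbc : ∀ c, (1 + (z+1) * b) ∣ b * c → (1 + (z+1) * b) ∣ c := by
    intro c hc
    refine pam_dvd_of_add (y := (z+1) * (b * c)) ?_ (hc.mul_left _)
    exact ⟨c, by ring⟩
  have hd : ∀ d, d + 1 ≤ w → (1 + (z+1) * b) ∣ (d + 1) * (b * c) → (1 + (z+1) * b) ∣ c := by
    intro d hd h
    obtain ⟨e, he⟩ := hb d ((pam_lt_add_one d).le.trans hd)
    apply hbc
    apply hbc
    have := h.mul_left e
    have e1 : e * ((d + 1) * (b * c)) = ((d+1) * e) * (b * c) := by ring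
    rw [e1, ← he] at this
    exact this
  rcases lt_or_gt_of_ne hne with h1 | h1
  · obtain ⟨d, rfl⟩ := exists_add_of_le (pam_succ_le.2 h1)
    refine hd d ?_ ?_
    · refine le_trans ?_ hz'
      rw [add_assoc, add_comm 1 d]; exact le_add_self
    · have e1 : (1 + (z + 1 + d + 1) * b) * c = (d+1) * (b * c) + (1 + (z+1) * b) * c := by ring
      rw [e1] at h
      exact pam_dvd_of_add h (dvd_mul_right _ _)
  · obtain ⟨d, rfl⟩ := exists_add_of_le (pam_succ_le.2 h1)
    refine hd d ?_ ?_
    · refine le_trans ?_ hz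
      rw [add_assoc, add_comm 1 d]; exact le_add_self
    · refine pam_dvd_of_add ?_ h
      exact ⟨c, by ring⟩

theorem pam_factorial (w : M) : ∃ b : M, 0 < b ∧ ∀ i, i ≤ w → (i + 1) ∣ b := by
  refine pam_ind (fun w : M => ∃ b : M, 0 < b ∧ ∀ i, i ≤ w → (i + 1) ∣ b) ?_ ?_ w
  · exact ⟨1, zero_lt_one, fun i hi => by rw [le_antisymm hi zero_le]; simp⟩
  · rintro w ⟨b, hb, h⟩
    refine ⟨b * (w + 1 + 1), mul_pos hb (lt_of_le_of_lt zero_le (pam_lt_add_one _)), fun i hi => ?_⟩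
    rcases hi.eq_or_lt with rfl | hi
    · exact dvd_mul_left _ _
    · exact (h i (pam_lt_succ.1 hi)).mul_right _

theorem pam_comp (P : M → Prop) [hP : Dfn M P] (w : M) :
    ∃ a b : M, ∀ z, z ≤ w → ((1 + (z+1) * b) ∣ a ↔ P z) := by
  obtain ⟨b, hb, hd⟩ := pam_factorial w
  haveI : ∀ (l : ℕ) (t : (Fin l → M) → M) [FT M l t], Fm M l (fun xs => P (t xs)) :=
    fun l t _ => fm_app1 hP t
  obtain ⟨a, ha⟩ := pam_ind (fun u => ∃ a : M, ∀ z, z ≤ w → ((1 + (z+1) * b) ∣ a ↔ (z < u ∧ P z)))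
    ⟨1, fun z hz => iff_of_false (pam_one_lt hb) (fun h => absurd h.1 not_lt_zero)⟩ (by
    rintro u ⟨a, ha⟩
    by_cases hu : P u ∧ u ≤ w
    · refine ⟨(1 + (u+1)*b) * a, fun z hz => ?_⟩
      by_cases hzu : z = u
      · subst hzu
        exact iff_of_true (dvd_mul_right _ _) ⟨pam_lt_add_one _, hu.1⟩
      · have : (1 + (z+1) * b) ∣ (1 + (u+1)*b) * a ↔ (1 + (z+1) * b) ∣ a :=
          ⟨pam_cop hd hz hu.2 hzu, fun h => h.mul_left _⟩
        rw [this, ha z hz, pam_lt_succ, le_iff_lt_or_eq]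
        tauto
    · refine ⟨a, fun z hz => ?_⟩
      rw [ha z hz, pam_lt_succ, le_iff_lt_or_eq]
      constructor
      · tauto
      · rintro ⟨h | rfl, h2⟩
        · exact ⟨h, h2⟩
        · exact absurd ⟨h2, hz⟩ hu) (w + 1)
  refine ⟨a, b, fun z hz => ?_⟩
  rw [ha z hz, pam_lt_succ]
  tauto

end Coding

section SatDef

theorem pam_dvd_iff {M : Type} [PAM M] (p a : M) : p ∣ a ↔ ∃ y, y ≤ a ∧ a = p * y := by
  constructor
  · rintro ⟨y, rfl⟩
    rcases pam_cases p with rfl | ⟨q, rfl⟩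
    · exact ⟨0, zero_le, by simp⟩
    · refine ⟨y, ?_, rfl⟩
      have : (q + 1) * y = y + q * y := by ring
      rw [this]; exact le_self_add
  · rintro ⟨y, -, h⟩; exact ⟨y, h⟩

instance d0_dvd {m : ℕ} (t u : UFun m) [ht : Tm m t] [hu : Tm m u] :
    D0 m (fun M _ xs => t M xs ∣ u M xs) := by
  haveI : Tm (m+1) (fun M _ xs => t M (fun i => xs (Fin.castSucc i))) :=
    tm_subst t (fun i _ _ xs => xs (Fin.castSucc i))
  haveI : Tm (m+1) (fun M _ xs => u M (fun i => xs (Fin.castSucc i))) :=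
    tm_subst u (fun i _ _ xs => xs (Fin.castSucc i))
  refine D0.congr (P := fun M _ xs => ∃ y, y ≤ u M xs ∧ u M xs = t M xs * y) inferInstance
    (fun M _ xs => pam_dvd_iff _ _)

variable {M : Type} [PAM M]

/-- Membership in the coded set. -/
def Mem (a b w z : M) : Prop := z ≤ w ∧ (1 + (z + 1) * b) ∣ a

/-- Atomic facts. -/
def Atom (d x : M) : Prop := ∃ e, e ≤ x ∧ ∃ z, z ≤ x ∧ (x = pr e z ∧ ((d = 0 ∧ z = 0) ∨
  ∃ f, f ≤ x ∧ ∃ y, y ≤ x ∧ (e = pr f y ∧ ((d = ((1 : ℕ) : M) ∧ y = z + 1) ∨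
   (d = ((2 : ℕ) : M) ∧ y = z) ∨ (d = ((3 : ℕ) : M) ∧ y < z) ∨ (d = ((4 : ℕ) : M) ∧ z < y) ∨
    ∃ g, g ≤ x ∧ ∃ u, u ≤ x ∧ (f = pr g u ∧ ((d = ((5 : ℕ) : M) ∧ u = y + z) ∨
      (d = ((6 : ℕ) : M) ∧ u = y * z)))))))

/-- Local justification of the item `(c,x)`. -/
def Just (w : M) (mem : M → M → Prop) (c x : M) : Prop :=
  ∃ d, d ≤ c ∧ ((c = pr ((0 : ℕ) : M) d ∧ Atom d x) ∨
   (c = pr ((1 : ℕ) : M) d ∧ ∃ c1, c1 ≤ d ∧ ∃ c2, c2 ≤ d ∧ (d = pr c1 c2 ∧ mem c1 x ∧ mem c2 x)) ∨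
   (c = pr ((2 : ℕ) : M) d ∧ ∃ c1, c1 ≤ d ∧ ∃ c2, c2 ≤ d ∧ (d = pr c1 c2 ∧ (mem c1 x ∨ mem c2 x))) ∨
   (c = pr ((3 : ℕ) : M) d ∧ ∃ y, y ≤ w ∧ mem d (pr x y)) ∨
   (c = pr ((4 : ℕ) : M) d ∧ ∃ e, e ≤ x ∧ ∃ t, t ≤ x ∧ (x = pr e t ∧ ∀ y, y ≤ t → mem d (pr e y))) ∨
   (c = pr ((5 : ℕ) : M) d ∧ ∃ e, e ≤ x ∧ ∃ y, y ≤ x ∧ ∃ v, v ≤ x ∧ (x = pr (pr e y) v ∧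
      ((d = 0 ∧ y = v) ∨ ∃ j, j ≤ d ∧ (d = j + 1 ∧ mem (pr ((5 : ℕ) : M) j) (pr e v))))))

theorem Just.mono {w w' : M} {mem mem' : M → M → Prop} {c x : M} (hw : w ≤ w')
    (hm : ∀ c x, mem c x → mem' c x) (h : Just w mem c x) : Just w' mem' c x := by
  obtain ⟨d, hd, h⟩ := h
  refine ⟨d, hd, ?_⟩
  rcases h with h | ⟨h, c1, h1, c2, h2, h3, h4, h5⟩ | ⟨h, c1, h1, c2, h2, h3, h4⟩ | ⟨h, y, hy, h1⟩ |
    ⟨h, e, h1, t, h2, h3, h4⟩ | ⟨h, e, h1, y, h2, v, h3, h4, h5⟩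
  · exact Or.inl h
  · exact Or.inr (Or.inl ⟨h, c1, h1, c2, h2, h3, hm _ _ h4, hm _ _ h5⟩)
  · exact Or.inr (Or.inr (Or.inl ⟨h, c1, h1, c2, h2, h3, h4.imp (hm _ _) (hm _ _)⟩))
  · exact Or.inr (Or.inr (Or.inr (Or.inl ⟨h, y, hy.trans hw, hm _ _ h1⟩)))
  · exact Or.inr (Or.inr (Or.inr (Or.inr (Or.inl ⟨h, e, h1, t, h2, h3, fun y hy => hm _ _ (h4 y hy)⟩))))
  · refine Or.inr (Or.inr (Or.inr (Or.inr (Or.inr ⟨h, e, h1, y, h2, v, h3, h4, h5.imp_right ?_⟩))))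
    rintro ⟨j, hj, h6, h7⟩
    exact ⟨j, hj, h6, hm _ _ h7⟩

/-- Correct coded sets. -/
def Corr (a b w : M) : Prop := ∀ c, c ≤ w → ∀ x, x ≤ w → (Mem a b w (pr c x) →
  Just w (fun c x => Mem a b w (pr c x)) c x)

/-- The item `(c,x)` is in a correct set with code at most `B`. -/
def Stage (B c x : M) : Prop := ∃ a, a ≤ B ∧ ∃ b, b ≤ B ∧ ∃ w, w ≤ B ∧ (Corr a b w ∧ Mem a b w (pr c x))

/-- Satisfaction for `Σ_1`. -/
def Sat (c x : M) : Prop := ∃ B, Stage B c x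

instance tm_cons {m l : ℕ} (t : UFun l) (ts : Fin m → UFun l) [ht : Tm l t] [hts : ∀ i, Tm l (ts i)]
    (i : Fin (m+1)) : Tm l (Matrix.vecCons t ts i) := by
  refine Fin.cases ?_ (fun i => ?_) i
  · exact ht
  · exact hts i
instance tm_empty {l : ℕ} (i : Fin 0) : Tm l (Matrix.vecEmpty i) := i.elim0
instance ft_cons {m l : ℕ} (t : (Fin l → M) → M) (ts : Fin m → (Fin l → M) → M) [ht : FT M l t]
    [hts : ∀ i, FT M l (ts i)] (i : Fin (m+1)) : FT M l (Matrix.vecCons t ts i) := by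
  refine Fin.cases ?_ (fun i => ?_) i
  · exact ht
  · exact hts i
instance ft_empty {l : ℕ} (i : Fin 0) : FT M l (Matrix.vecEmpty i) := i.elim0

instance d0_atom {m : ℕ} (c x : UFun m) [Tm m c] [Tm m x] :
    D0 m (fun M _ xs => Atom (c M xs) (x M xs)) := by
  haveI : D0 2 (fun M _ xs => Atom (xs 0) (xs 1)) := by
    unfold Atom; infer_instance
  exact d0_subst (fun M _ xs => Atom (xs 0) (xs 1)) ![c, x]
instance d0_mem {m : ℕ} (a b c x : UFun m) [Tm m a] [Tm m b] [Tm m c] [Tm m x] :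
    D0 m (fun M _ xs => Mem (a M xs) (b M xs) (c M xs) (x M xs)) := by
  unfold Mem; infer_instance
set_option synthInstance.maxHeartbeats 400000 in
set_option synthInstance.maxSize 2000 in
theorem d0_corr0 : D0 3 (fun M _ xs => Corr (xs 0) (xs 1) (xs 2)) := by
  unfold Corr Just
  beta_reduce
  infer_instance
instance d0_corr {m : ℕ} (a b w : UFun m) [Tm m a] [Tm m b] [Tm m w] :
    D0 m (fun M _ xs => Corr (a M xs) (b M xs) (w M xs)) :=
  haveI := d0_corr0
  d0_subst (fun M _ xs => Corr (xs 0) (xs 1) (xs 2)) ![a, b, w]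
theorem d0_stage0 : D0 3 (fun M _ xs => Stage (xs 0) (xs 1) (xs 2)) := by
  unfold Stage
  infer_instance
instance d0_stage {m : ℕ} (a b w : UFun m) [Tm m a] [Tm m b] [Tm m w] :
    D0 m (fun M _ xs => Stage (a M xs) (b M xs) (w M xs)) :=
  haveI := d0_stage0
  d0_subst (fun M _ xs => Stage (xs 0) (xs 1) (xs 2)) ![a, b, w]
instance fm_stage {m : ℕ} (a b w : (Fin m → M) → M) [FT M m a] [FT M m b] [FT M m w] :
    Fm M m (fun xs => Stage (a xs) (b xs) (w xs)) :=
  fm_of_d0 _ d0_stage0 ![a, b, w] inferInstance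
instance sc_sat {m k : ℕ} (c x : UFun m) [Tm m c] [Tm m x] :
    SC (k+1) m (fun M _ xs => Sat (c M xs) (x M xs)) := by
  haveI : SC (k+1) 2 (fun M _ xs => Sat (xs 0) (xs 1)) := by unfold Sat; infer_instance
  exact sc_subst (fun M _ xs => Sat (xs 0) (xs 1)) this ![c, x] inferInstance
instance fm_sat {m : ℕ} (b w : (Fin m → M) → M) [FT M m b] [FT M m w] :
    Fm M m (fun xs => Sat (b xs) (w xs)) := by
  haveI : SC 1 2 (fun M _ xs => Sat (xs 0) (xs 1)) := inferInstance
  exact fm_of_sc _ this ![b, w] inferInstance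

theorem Stage.mono {B B' c x : M} (h : B ≤ B') (hs : Stage B c x) : Stage B' c x := by
  obtain ⟨a, ha, b, hb, w, hw, h1⟩ := hs
  exact ⟨a, ha.trans h, b, hb.trans h, w, hw.trans h, h1⟩

theorem sat_of (P : M → M → Prop) (hP : Fm M 2 (fun xs => P (xs 0) (xs 1))) (w : M)
    (hw : ∀ c x, P c x → pr c x ≤ w) (hj : ∀ c x, P c x → Just w P c x) {c x : M} (h : P c x) :
    Sat c x := by
  haveI : ∀ (l : ℕ) (t u : (Fin l → M) → M) [FT M l t] [FT M l u],
    Fm M l (fun xs => P (t xs) (u xs)) := fun l t u _ _ => fm_app2 hP t u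
  obtain ⟨a, b, hab⟩ := pam_comp (fun z => ∃ c x, z = pr c x ∧ P c x) w
  have hm : ∀ c x, Mem a b w (pr c x) ↔ P c x := by
    intro c x
    unfold Mem
    constructor
    · rintro ⟨h1, h2⟩
      obtain ⟨c', x', h3, h4⟩ := (hab _ h1).1 h2
      obtain ⟨rfl, rfl⟩ := pr_inj.1 h3
      exact h4
    · intro h
      exact ⟨hw _ _ h, (hab _ (hw _ _ h)).2 ⟨c, x, rfl, h⟩⟩
  refine ⟨a + b + w, a, le_self_add.trans le_self_add, b, le_add_self.trans le_self_add, w, le_add_self, ?_, (hm _ _).2 h⟩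
  intro c _ x _ h
  refine (hj c x ((hm _ _).1 h)).mono le_rfl (fun c x h => (hm _ _).2 h)

theorem just_stage {B c x : M} (h : Stage B c x) : Just B (Stage B) c x := by
  obtain ⟨a, ha, b, hb, w, hw, h1, h2⟩ := h
  refine (h1 c ((le_pr_left c x).trans h2.1) x ((le_pr_right c x).trans h2.1) h2).mono hw ?_
  intro c x h
  exact ⟨a, ha, b, hb, w, hw, h1, h⟩

theorem stage_le {B c x : M} (h : Stage B c x) : pr c x ≤ B := by
  obtain ⟨a, ha, b, hb, w, hw, h1, h2⟩ := h
  exact h2.1.trans hw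

theorem just_bound {w c x : M} (h : Just w Sat c x) : ∃ B, Just w (Stage B) c x := by
  obtain ⟨d, hd, h⟩ := h
  rcases h with h | ⟨h, c1, h1, c2, h2, h3, ⟨B, h4⟩, ⟨B', h5⟩⟩ | ⟨h, c1, h1, c2, h2, h3, h4⟩ | ⟨h, y, hy, ⟨B, h1⟩⟩ |
    ⟨h, e, h1, t, h2, h3, h4⟩ | ⟨h, e, h1, y, h2, v, h3, h4, h5⟩
  · exact ⟨0, d, hd, Or.inl h⟩
  · exact ⟨B + B', d, hd, Or.inr (Or.inl ⟨h, c1, h1, c2, h2, h3, h4.mono le_self_add, h5.mono le_add_self⟩)⟩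
  · rcases h4 with ⟨B, h4⟩ | ⟨B, h4⟩
    · exact ⟨B, d, hd, Or.inr (Or.inr (Or.inl ⟨h, c1, h1, c2, h2, h3, Or.inl h4⟩))⟩
    · exact ⟨B, d, hd, Or.inr (Or.inr (Or.inl ⟨h, c1, h1, c2, h2, h3, Or.inr h4⟩))⟩
  · exact ⟨B, d, hd, Or.inr (Or.inr (Or.inr (Or.inl ⟨h, y, hy, h1⟩)))⟩
  · obtain ⟨B, hB⟩ := pam_collect (fun y B => Stage B d (pr e y)) t h4
    refine ⟨B, d, hd, Or.inr (Or.inr (Or.inr (Or.inr (Or.inl ⟨h, e, h1, t, h2, h3, fun y hy => ?_⟩))))⟩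
    obtain ⟨B', h5, h6⟩ := hB y hy
    exact h6.mono h5
  · rcases h5 with h5 | ⟨j, hj, h6, ⟨B, h7⟩⟩
    · exact ⟨0, d, hd, Or.inr (Or.inr (Or.inr (Or.inr (Or.inr ⟨h, e, h1, y, h2, v, h3, h4, Or.inl h5⟩))))⟩
    · exact ⟨B, d, hd, Or.inr (Or.inr (Or.inr (Or.inr (Or.inr ⟨h, e, h1, y, h2, v, h3, h4,
        Or.inr ⟨j, hj, h6, h7⟩⟩))))⟩

theorem sat_iff {c x : M} : Sat c x ↔ ∃ w, Just w Sat c x := by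
  constructor
  · rintro ⟨B, h⟩
    exact ⟨B, (just_stage h).mono le_rfl (fun c x h => ⟨B, h⟩)⟩
  · rintro ⟨w, h⟩
    obtain ⟨B, h⟩ := just_bound h
    refine sat_of (fun c' x' => Stage B c' x' ∨ (c' = c ∧ x' = x)) inferInstance (B + w + pr c x) ?_ ?_
      (c := c) (x := x) (Or.inr ⟨rfl, rfl⟩)
    · rintro c' x' (h | ⟨rfl, rfl⟩)
      · exact (stage_le h).trans (le_self_add.trans le_self_add)
      · exact le_add_self
    · rintro c' x' (h | ⟨rfl, rfl⟩)
      · exact (just_stage h).mono (le_self_add.trans le_self_add) (fun c x h => Or.inl h)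
      · exact h.mono (le_add_self.trans le_self_add) (fun c x h => Or.inl h)

theorem cast_pr_ne {i j : ℕ} (h : i ≠ j) (d d' : M) : pr (i : M) d ≠ pr (j : M) d' := by
  intro e
  exact h (Nat.cast_injective (pr_inj.1 e).1)

theorem prc_inj {i j : ℕ} {d d' : M} : pr (i : M) d = pr (j : M) d' ↔ i = j ∧ d = d' := by
  rw [pr_inj, Nat.cast_inj]

theorem sat_atom {d x : M} : Sat (pr ((0:ℕ) : M) d) x ↔ Atom d x := by
  rw [sat_iff]; unfold Just
  simp only [prc_inj]
  constructor
  · rintro ⟨w, d', -, h⟩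
    simp at h
    obtain ⟨rfl, h⟩ := h
    exact h
  · intro h
    exact ⟨0, d, le_pr_right _ _, by simpa using h⟩

theorem sat_and {c1 c2 x : M} : Sat (pr ((1:ℕ) : M) (pr c1 c2)) x ↔ Sat c1 x ∧ Sat c2 x := by
  rw [sat_iff]; unfold Just
  simp only [prc_inj]
  constructor
  · rintro ⟨w, d', -, h⟩
    simp at h
    obtain ⟨rfl, c1', -, c2', -, h, h1⟩ := h
    obtain ⟨rfl, rfl⟩ := pr_inj.1 h
    exact h1
  · intro h
    refine ⟨0, _, le_pr_right _ _, Or.inr (Or.inl ⟨⟨trivial, rfl⟩, c1, le_pr_left _ _, c2, le_pr_right _ _, rfl, h⟩)⟩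

theorem sat_or {c1 c2 x : M} : Sat (pr ((2:ℕ) : M) (pr c1 c2)) x ↔ Sat c1 x ∨ Sat c2 x := by
  rw [sat_iff]; unfold Just
  simp only [prc_inj]
  constructor
  · rintro ⟨w, d', -, h⟩
    simp at h
    obtain ⟨rfl, c1', -, c2', -, h, h1⟩ := h
    obtain ⟨rfl, rfl⟩ := pr_inj.1 h
    exact h1
  · intro h
    refine ⟨0, _, le_pr_right _ _, Or.inr (Or.inr (Or.inl ⟨⟨trivial, rfl⟩, c1, le_pr_left _ _, c2, le_pr_right _ _, rfl, h⟩))⟩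

theorem sat_ex {d x : M} : Sat (pr ((3:ℕ) : M) d) x ↔ ∃ y, Sat d (pr x y) := by
  rw [sat_iff]; unfold Just
  simp only [prc_inj]
  constructor
  · rintro ⟨w, d', -, h⟩
    simp at h
    obtain ⟨rfl, y, -, h⟩ := h
    exact ⟨y, h⟩
  · rintro ⟨y, h⟩
    refine ⟨y, _, le_pr_right _ _, Or.inr (Or.inr (Or.inr (Or.inl ⟨⟨trivial, rfl⟩, y, le_rfl, h⟩)))⟩

theorem sat_ball {d e t : M} : Sat (pr ((4:ℕ) : M) d) (pr e t) ↔ ∀ y, y ≤ t → Sat d (pr e y) := by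
  rw [sat_iff]; unfold Just
  simp only [prc_inj]
  constructor
  · rintro ⟨w, d', -, h⟩
    simp at h
    obtain ⟨rfl, e', -, t', -, h, h1⟩ := h
    obtain ⟨rfl, rfl⟩ := pr_inj.1 h
    exact h1
  · intro h
    refine ⟨0, _, le_pr_right _ _, Or.inr (Or.inr (Or.inr (Or.inr (Or.inl ⟨⟨trivial, rfl⟩, e, le_pr_left _ _, t,
      le_pr_right _ _, rfl, h⟩))))⟩

theorem sat_look0 {e y v : M} : Sat (pr ((5:ℕ) : M) 0) (pr (pr e y) v) ↔ y = v := by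
  rw [sat_iff]; unfold Just
  simp only [prc_inj]
  constructor
  · rintro ⟨w, d', -, h⟩
    simp at h
    obtain ⟨rfl, e', -, y', -, v', -, h, h1⟩ := h
    obtain ⟨h2, rfl⟩ := pr_inj.1 h
    obtain ⟨rfl, rfl⟩ := pr_inj.1 h2
    simpa using h1
  · intro h
    refine ⟨0, _, le_pr_right _ _, Or.inr (Or.inr (Or.inr (Or.inr (Or.inr ⟨⟨trivial, rfl⟩, e, 
      (le_pr_left _ _).trans (le_pr_left _ _), y,
      (le_pr_right _ _).trans (le_pr_left _ _), v, le_pr_right _ _, rfl, Or.inl ⟨rfl, h⟩⟩))))⟩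

theorem sat_look1 {j e y v : M} : Sat (pr ((5:ℕ) : M) (j+1)) (pr (pr e y) v) ↔
    Sat (pr ((5:ℕ) : M) j) (pr e v) := by
  rw [sat_iff]; unfold Just
  simp only [prc_inj]
  constructor
  · rintro ⟨w, d', -, h⟩
    simp at h
    obtain ⟨rfl, e', -, y', -, v', -, h, h1⟩ := h
    obtain ⟨h2, rfl⟩ := pr_inj.1 h
    obtain ⟨rfl, rfl⟩ := pr_inj.1 h2
    simpa using h1
  · intro h
    refine ⟨0, _, le_pr_right _ _, Or.inr (Or.inr (Or.inr (Or.inr (Or.inr ⟨⟨trivial, rfl⟩, e, 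
      (le_pr_left _ _).trans (le_pr_left _ _), y,
      (le_pr_right _ _).trans (le_pr_left _ _), v, le_pr_right _ _, rfl, Or.inr ⟨j, le_self_add, rfl, h⟩⟩))))⟩

end SatDef

section Univ

/-- Packing a tuple. -/
def pack {M : Type} [PAM M] : ∀ {m : ℕ}, (Fin m → M) → M
  | 0, _ => 0
  | _ + 1, xs => pr (pack (fun i => xs (Fin.castSucc i))) (xs (Fin.last _))

/-- Relations represented by a code of the universal `Σ_1` relation. -/
def KR (m : ℕ) (R : URel m) : Prop := ∃ c : ℕ, ∀ (M : Type) [PAM M] (xs : Fin m → M),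
  R M xs ↔ Sat (c : M) (pack xs)

theorem KR.congr {m : ℕ} {P Q : URel m} (h : KR m P) (e : ∀ (M : Type) [PAM M] xs, Q M xs ↔ P M xs) :
    KR m Q := by
  obtain ⟨c, hc⟩ := h
  exact ⟨c, fun M _ xs => (e M xs).trans (hc M xs)⟩

theorem kr_and {m : ℕ} {P Q : URel m} (hP : KR m P) (hQ : KR m Q) :
    KR m (fun M _ xs => P M xs ∧ Q M xs) := by
  obtain ⟨c, hc⟩ := hP
  obtain ⟨d, hd⟩ := hQ
  exact ⟨pr 1 (pr c d), fun M _ xs => by beta_reduce; rw [hc, hd, cast_pr, cast_pr, sat_and]⟩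
theorem kr_or {m : ℕ} {P Q : URel m} (hP : KR m P) (hQ : KR m Q) :
    KR m (fun M _ xs => P M xs ∨ Q M xs) := by
  obtain ⟨c, hc⟩ := hP
  obtain ⟨d, hd⟩ := hQ
  exact ⟨pr 2 (pr c d), fun M _ xs => by beta_reduce; rw [hc, hd, cast_pr, cast_pr, sat_or]⟩
theorem pack_snoc {M : Type} [PAM M] {m : ℕ} (xs : Fin m → M) (y : M) :
    pack (Fin.snoc (α := fun _ => M) xs y) = pr (pack xs) y := by
  simp [pack]
theorem kr_ex {m : ℕ} {P : URel1 m} (hP : KR (m+1) (unc P)) :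
    KR m (fun M _ xs => ∃ y, P M xs y) := by
  obtain ⟨c, hc⟩ := hP
  refine ⟨pr 3 c, fun M _ xs => ?_⟩
  rw [cast_pr, sat_ex]
  refine exists_congr (fun y => ?_)
  have := hc M (Fin.snoc (α := fun _ => M) xs y)
  simpa [unc, pack_snoc] using this
theorem kr_ball {m : ℕ} {P : URel1 m} (hP : KR (m+1) (unc P)) :
    KR (m+1) (fun M _ xs => ∀ y, y ≤ xs (Fin.last m) → P M (fun i => xs (Fin.castSucc i)) y) := by
  obtain ⟨c, hc⟩ := hP
  refine ⟨pr 4 c, fun M _ xs => ?_⟩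
  rw [cast_pr, pack, sat_ball]
  refine forall_congr' (fun y => imp_congr_right fun _ => ?_)
  have := hc M (Fin.snoc (α := fun _ => M) (fun i => xs (Fin.castSucc i)) y)
  simpa [unc, pack_snoc] using this

theorem kr_look : ∀ {m : ℕ} (i : Fin m), KR (m+1) (fun M _ xs => xs (Fin.last m) = xs (Fin.castSucc i)) := by
  have : ∀ (m : ℕ) (i : Fin m), ∃ j : ℕ, ∀ (M : Type) [PAM M] (xs : Fin m → M) (y : M),
      y = xs i ↔ Sat (pr ((5:ℕ) : M) j) (pr (pack xs) y) := by
    intro m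
    induction m with
    | zero => intro i; exact i.elim0
    | succ m ih =>
      intro i
      refine Fin.lastCases ?_ (fun i => ?_) i
      · refine ⟨0, fun M _ xs y => ?_⟩
        rw [pack, Nat.cast_zero, sat_look0]; exact eq_comm
      · obtain ⟨j, hj⟩ := ih i
        refine ⟨j+1, fun M _ xs y => ?_⟩
        rw [pack, Nat.cast_add, Nat.cast_one, sat_look1, ← hj]
  intro m i
  obtain ⟨j, hj⟩ := this m i
  refine ⟨pr 5 j, fun M _ xs => ?_⟩
  rw [cast_pr, pack]
  exact hj M (fun i => xs (Fin.castSucc i)) (xs (Fin.last m))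

theorem kr_zero {m : ℕ} : KR (m+1) (fun M _ xs => xs (Fin.last m) = 0) := by
  refine ⟨pr 0 0, fun M _ xs => ?_⟩
  rw [cast_pr, pack, sat_atom]
  constructor
  · intro h
    exact ⟨_, le_pr_left _ _, _, le_pr_right _ _, rfl, Or.inl ⟨by simp, h⟩⟩
  · rintro ⟨e, -, z, -, h, h1⟩
    obtain ⟨rfl, rfl⟩ := pr_inj.1 h
    simpa using h1

theorem kr_two {m : ℕ} (d : ℕ) (hd0 : d ≠ 0) (Q : ∀ (M : Type) [PAM M], M → M → Prop)
    (h : ∀ (M : Type) [PAM M] (y z : M), Q M y z ↔ ((d = 1 ∧ y = z + 1) ∨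
      (d = 2 ∧ y = z) ∨ (d = 3 ∧ y < z) ∨ (d = 4 ∧ z < y))) (h5 : d ≠ 5) (h6 : d ≠ 6) :
    KR (m+2) (fun M _ xs => Q M (xs (Fin.castSucc (Fin.last m))) (xs (Fin.last (m+1)))) := by
  refine ⟨pr 0 d, fun M _ xs => ?_⟩
  beta_reduce
  rw [cast_pr, pack, pack, sat_atom, h]
  unfold Atom
  simp only [Nat.cast_inj, h5, h6, false_and, or_false, and_false, exists_false, hd0, false_or,
    Nat.cast_eq_zero]
  constructor
  · intro h
    exact ⟨_, le_pr_left _ _, _, le_pr_right _ _, rfl, _, (le_pr_left _ _).trans (le_pr_left _ _), _,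
      (le_pr_right _ _).trans (le_pr_left _ _), rfl, h⟩
  · rintro ⟨e, -, z, -, h, f, -, y, -, h1, h2⟩
    obtain ⟨rfl, rfl⟩ := pr_inj.1 h
    obtain ⟨rfl, rfl⟩ := pr_inj.1 h1
    exact h2

theorem kr_three {m : ℕ} (d : ℕ) (Q : ∀ (M : Type) [PAM M], M → M → M → Prop) (hd : 4 < d)
    (h : ∀ (M : Type) [PAM M] (x y z : M), Q M x y z ↔ ((d = 5 ∧ x = y + z) ∨
      (d = 6 ∧ x = y * z))) :
    KR (m+3) (fun M _ xs => Q M (xs (Fin.castSucc (Fin.castSucc (Fin.last m))))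
      (xs (Fin.castSucc (Fin.last (m+1)))) (xs (Fin.last (m+2)))) := by
  refine ⟨pr 0 d, fun M _ xs => ?_⟩
  beta_reduce
  rw [cast_pr, pack, pack, pack, sat_atom, h]
  unfold Atom
  have h0 : d ≠ 0 := by omega
  have h1 : d ≠ 1 := by omega
  have h2 : d ≠ 2 := by omega
  have h3 : d ≠ 3 := by omega
  have h4 : d ≠ 4 := by omega
  simp only [Nat.cast_inj, h0, h1, h2, h3, h4, false_and, or_false, and_false, exists_false, false_or,
    Nat.cast_eq_zero]
  constructor
  · intro h
    exact ⟨_, le_pr_left _ _, _, le_pr_right _ _, rfl, _, (le_pr_left _ _).trans (le_pr_left _ _), _,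
      (le_pr_right _ _).trans (le_pr_left _ _), rfl, _,
      ((le_pr_left _ _).trans (le_pr_left _ _)).trans (le_pr_left _ _), _,
      ((le_pr_right _ _).trans (le_pr_left _ _)).trans (le_pr_left _ _), rfl, h⟩
  · rintro ⟨e, -, z, -, h, f, -, y, -, h1, g, -, x, -, h2, h3⟩
    obtain ⟨rfl, rfl⟩ := pr_inj.1 h
    obtain ⟨rfl, rfl⟩ := pr_inj.1 h1
    obtain ⟨rfl, rfl⟩ := pr_inj.1 h2
    exact h3

theorem kr_succ {m : ℕ} : KR (m+2) (fun M _ xs => xs (Fin.castSucc (Fin.last m)) = xs (Fin.last (m+1)) + 1) :=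
  kr_two 1 (by omega) (fun M _ y z => y = z + 1) (fun M _ y z => by simp) (by omega) (by omega)
theorem kr_eq {m : ℕ} : KR (m+2) (fun M _ xs => xs (Fin.castSucc (Fin.last m)) = xs (Fin.last (m+1))) :=
  kr_two 2 (by omega) (fun M _ y z => y = z) (fun M _ y z => by simp) (by omega) (by omega)
theorem kr_lt {m : ℕ} : KR (m+2) (fun M _ xs => xs (Fin.castSucc (Fin.last m)) < xs (Fin.last (m+1))) :=
  kr_two 3 (by omega) (fun M _ y z => y < z) (fun M _ y z => by simp) (by omega) (by omega)
theorem kr_gt {m : ℕ} : KR (m+2) (fun M _ xs => xs (Fin.last (m+1)) < xs (Fin.castSucc (Fin.last m))) :=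
  kr_two 4 (by omega) (fun M _ y z => z < y) (fun M _ y z => by simp) (by omega) (by omega)
theorem kr_le {m : ℕ} : KR (m+2) (fun M _ xs => xs (Fin.castSucc (Fin.last m)) ≤ xs (Fin.last (m+1))) :=
  (kr_or kr_lt kr_eq).congr (fun M _ xs => le_iff_lt_or_eq)
theorem kr_add {m : ℕ} : KR (m+3) (fun M _ xs => xs (Fin.castSucc (Fin.castSucc (Fin.last m))) =
      xs (Fin.castSucc (Fin.last (m+1))) + xs (Fin.last (m+2))) :=
  kr_three 5 (fun M _ x y z => x = y + z) (by omega) (fun M _ y z => by simp)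
theorem kr_mul {m : ℕ} : KR (m+3) (fun M _ xs => xs (Fin.castSucc (Fin.castSucc (Fin.last m))) =
      xs (Fin.castSucc (Fin.last (m+1))) * xs (Fin.last (m+2))) :=
  kr_three 6 (fun M _ x y z => x = y * z) (by omega) (fun M _ y z => by simp)

theorem kr_term {l : ℕ} (τ : LA.Term (Empty ⊕ Fin l)) : ∀ {m : ℕ} (f : Fin l → Fin m),
    KR (m+1) (fun M _ xs => xs (Fin.last m) =
      τ.realize (Sum.elim default (fun i => xs (Fin.castSucc (f i))))) := by
  induction τ with
  | var i =>
    intro m f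
    rcases i with i | i
    · exact i.elim
    · exact kr_look (f i)
  | @func n g ts ih =>
    intro m f
    match n, g with
    | 0, _ => exact kr_zero
    | 1, _ =>
      refine (kr_ex (P := fun M _ xs a => a = (ts 0).realize (Sum.elim default (fun i => xs (Fin.castSucc (f i)))) ∧
        xs (Fin.last m) = a + 1) (kr_and (ih 0 (fun i => Fin.castSucc (f i))) kr_succ)).congr ?_
      intro M _ xs
      simp only [exists_eq_left]
      exact Iff.rfl
    | 2, false =>
      refine (kr_ex (P := fun M _ xs a => a = (ts 0).realize (Sum.elim default (fun i => xs (Fin.castSucc (f i)))) ∧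
        ∃ b, b = (ts 1).realize (Sum.elim default (fun i => xs (Fin.castSucc (f i)))) ∧ 
        xs (Fin.last m) = a + b) (kr_and (ih 0 (fun i => Fin.castSucc (f i))) (kr_ex (m := m+2) (P := fun M _ xs b =>
          b = (ts 1).realize (Sum.elim default (fun i => xs (Fin.castSucc (Fin.castSucc (f i))))) ∧
            xs (Fin.castSucc (Fin.last m)) = xs (Fin.last (m+1)) + b) 
            (kr_and (ih 1 (fun i => Fin.castSucc (Fin.castSucc (f i)))) kr_add)))).congr ?_
      intro M _ xs
      simp only [exists_eq_left]
      exact Iff.rfl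
    | 2, true =>
      refine (kr_ex (P := fun M _ xs a => a = (ts 0).realize (Sum.elim default (fun i => xs (Fin.castSucc (f i)))) ∧
        ∃ b, b = (ts 1).realize (Sum.elim default (fun i => xs (Fin.castSucc (f i)))) ∧ 
        xs (Fin.last m) = a * b) (kr_and (ih 0 (fun i => Fin.castSucc (f i))) (kr_ex (m := m+2) (P := fun M _ xs b =>
          b = (ts 1).realize (Sum.elim default (fun i => xs (Fin.castSucc (Fin.castSucc (f i))))) ∧
            xs (Fin.castSucc (Fin.last m)) = xs (Fin.last (m+1)) * b) 
            (kr_and (ih 1 (fun i => Fin.castSucc (Fin.castSucc (f i)))) kr_mul)))).congr ?_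
      intro M _ xs
      simp only [exists_eq_left]
      exact Iff.rfl

/-- Comparing two terms. -/
theorem kr_cmp {m : ℕ} (τ υ : LA.Term (Empty ⊕ Fin m)) (Q : ∀ (M : Type) [PAM M], M → M → Prop)
    (hQ : ∀ m, KR (m+2) (fun M _ xs => Q M (xs (Fin.castSucc (Fin.last m))) (xs (Fin.last (m+1))))) :
    KR m (fun M _ xs => Q M (τ.realize (Sum.elim default xs)) (υ.realize (Sum.elim default xs))) := by
  refine (kr_ex (P := fun M _ xs a => a = τ.realize (Sum.elim default xs) ∧
    ∃ b, b = υ.realize (Sum.elim default xs) ∧ Q M a b) (kr_and (kr_term τ id) (kr_ex (m := m+1) (P := fun M _ xs b =>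
      b = υ.realize (Sum.elim default (fun i => xs (Fin.castSucc i))) ∧ Q M (xs (Fin.last m)) b)
      (kr_and (kr_term υ Fin.castSucc) (hQ m))))).congr ?_
  intro M _ xs
  simp only [exists_eq_left]

theorem kr_false {m : ℕ} : KR m (fun _ _ _ => False) := by
  refine (kr_cmp (m := m) zeroT zeroT (fun M _ x y => x < y) (fun _ => kr_lt)).congr ?_
  intro M _ xs; simp
theorem kr_true {m : ℕ} : KR m (fun _ _ _ => True) := by
  refine (kr_cmp (m := m) zeroT zeroT (fun M _ x y => x = y) (fun _ => kr_eq)).congr ?_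
  intro M _ xs; simp

theorem kr_ballT {m : ℕ} (τ : LA.Term (Empty ⊕ Fin m)) (P : URel1 m) (hP : KR (m+1) (unc P)) :
    KR m (fun M _ xs => ∀ y, y ≤ τ.realize (Sum.elim default xs) → P M xs y) := by
  refine (kr_ex (P := fun M _ xs a => a = τ.realize (Sum.elim default xs) ∧ ∀ y, y ≤ a → P M xs y)
    (kr_and (kr_term τ id) (kr_ball hP))).congr ?_
  intro M _ xs
  simp only [exists_eq_left]
theorem kr_bexT {m : ℕ} (τ : LA.Term (Empty ⊕ Fin m)) (P : URel1 m) (hP : KR (m+1) (unc P)) :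
    KR m (fun M _ xs => ∃ y, y ≤ τ.realize (Sum.elim default xs) ∧ P M xs y) := by
  refine kr_ex (P := fun M _ xs y => y ≤ τ.realize (Sum.elim default xs) ∧ P M xs y) (kr_and ?_ hP)
  refine (kr_ex (m := m+1) (P := fun M _ xs a => a = τ.realize (Sum.elim default (fun i => xs (Fin.castSucc i))) ∧
    xs (Fin.last m) ≤ a) (kr_and (kr_term τ Fin.castSucc) kr_le)).congr ?_
  intro M _ xs
  simp only [exists_eq_left]

theorem snoc_init' {M : Type} {m : ℕ} (xs : Fin (m+1) → M) :
    (Fin.snoc (fun i => xs (Fin.castSucc i)) (xs (Fin.last m)) : Fin (m+1) → M) = xs :=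
  Fin.snoc_init_self xs

theorem kr_delta0 {m : ℕ} {φ : LA.BoundedFormula Empty m} (h : IsDelta0 φ) :
    KR m (fun M _ xs => φ.Realize default xs) ∧ KR m (fun M _ xs => ¬ φ.Realize default xs) := by
  induction h with
  | falsum => exact ⟨kr_false, kr_true.congr (fun M _ xs => by simp)⟩
  | equal t u =>
    refine ⟨(kr_cmp t u (fun M _ x y => x = y) (fun _ => kr_eq)).congr (fun M _ xs => by simp),
      (kr_cmp t u (fun M _ x y => x < y ∨ y < x) (fun _ => kr_or kr_lt kr_gt)).congr (fun M _ xs => by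
        simp)⟩
  | le t u =>
    refine ⟨(kr_cmp t u (fun M _ x y => x ≤ y) (fun _ => kr_le)).congr (fun M _ xs => by simp),
      (kr_cmp t u (fun M _ x y => y < x) (fun _ => kr_gt)).congr (fun M _ xs => by
        simp)⟩
  | imp _ _ ih1 ih2 =>
    refine ⟨(kr_or ih1.2 ih2.1).congr (fun M _ xs => ?_), (kr_and ih1.1 ih2.2).congr (fun M _ xs => ?_)⟩
    · rw [BoundedFormula.realize_imp]; exact imp_iff_not_or
    · rw [BoundedFormula.realize_imp]; exact Classical.not_imp
  | @ball m t φ _ ih =>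
    have e : ∀ (M : Type) [PAM M] (xs : Fin m → M),
      ((∀' (leF (vT (Fin.last m)) (t.relabel (Sum.map id Fin.castSucc)) ⟹ φ)).Realize default xs ↔
      ∀ y, y ≤ t.realize (Sum.elim default xs) → φ.Realize default (Fin.snoc xs y)) := by
      intro M _ xs
      simp only [BoundedFormula.realize_all, BoundedFormula.realize_ex, BoundedFormula.realize_inf, BoundedFormula.realize_imp, realize_leF, realize_vT, realize_wk, rl_eq, Fin.snoc_last]
    refine ⟨(kr_ballT t (fun M _ xs y => φ.Realize default (Fin.snoc xs y)) ?_).congr (fun M _ xs => e M xs),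
      (kr_bexT t (fun M _ xs y => ¬ φ.Realize default (Fin.snoc xs y)) ?_).congr (fun M _ xs => ?_)⟩
    · refine ih.1.congr (fun M _ xs => ?_)
      rw [unc, snoc_init']
    · refine ih.2.congr (fun M _ xs => ?_)
      rw [unc, snoc_init']
    · rw [e]; push Not; rfl
  | @bex m t φ _ ih =>
    have e : ∀ (M : Type) [PAM M] (xs : Fin m → M),
      ((∃' (leF (vT (Fin.last m)) (t.relabel (Sum.map id Fin.castSucc)) ⊓ φ)).Realize default xs ↔
      ∃ y, y ≤ t.realize (Sum.elim default xs) ∧ φ.Realize default (Fin.snoc xs y)) := by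
      intro M _ xs
      simp only [BoundedFormula.realize_all, BoundedFormula.realize_ex, BoundedFormula.realize_inf, BoundedFormula.realize_imp, realize_leF, realize_vT, realize_wk, rl_eq, Fin.snoc_last]
    refine ⟨(kr_bexT t (fun M _ xs y => φ.Realize default (Fin.snoc xs y)) ?_).congr (fun M _ xs => e M xs),
      (kr_ballT t (fun M _ xs y => ¬ φ.Realize default (Fin.snoc xs y)) ?_).congr (fun M _ xs => ?_)⟩
    · refine ih.1.congr (fun M _ xs => ?_)
      rw [unc, snoc_init']
    · refine ih.2.congr (fun M _ xs => ?_)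
      rw [unc, snoc_init']
    · rw [e]; push Not; rfl

theorem kr_d0 {m : ℕ} {R : URel m} (h : D0 m R) : KR m R ∧ KR m (fun M _ xs => ¬ R M xs) := by
  obtain ⟨φ, h1, h2⟩ := h
  exact ⟨(kr_delta0 h1).1.congr h2, (kr_delta0 h1).2.congr (fun M _ xs => not_congr (h2 M xs))⟩

theorem kr_sc1 {m : ℕ} {R : URel m} (h : SC 1 m R) : KR m R := by
  obtain ⟨Q, h1, h2⟩ := sc_succ.1 h
  exact (kr_ex (P := fun M _ xs y => ¬ Q M xs y) (kr_d0 (sc_zero.1 h1)).2).congr h2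

/-- The universal relations. -/
def Uni (M : Type) [PAM M] : ℕ → M → M → Prop
  | 0, c, x => Sat c x
  | k + 1, c, x => ∃ z, ¬ Uni M k c (pr x z)

theorem sc_uni0 (k : ℕ) : SC (k+1) 2 (fun M _ xs => Uni M k (xs 0) (xs 1)) := by
  induction k with
  | zero => exact sc_sat _ _
  | succ k ih =>
    rw [sc_succ]
    refine ⟨fun M _ xs z => Uni M k (xs 0) (pr (xs 1) z), ?_, fun M _ xs => Iff.rfl⟩
    exact sc_subst _ ih ![fun _ _ xs => xs 0, fun _ _ xs => pr (xs 1) (xs 2)] inferInstance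
instance sc_uni {k m : ℕ} (c x : UFun m) [Tm m c] [Tm m x] :
    SC (k+1) m (fun M _ xs => Uni M k (c M xs) (x M xs)) :=
  sc_subst _ (sc_uni0 k) ![c, x] inferInstance

theorem uni_of_sc : ∀ {k m : ℕ} {R : URel m} (_ : SC (k+1) m R), ∃ c : ℕ, ∀ (M : Type) [PAM M] (xs : Fin m → M),
    R M xs ↔ Uni M k (c : M) (pack xs) := by
  intro k
  induction k with
  | zero => intro m R h; exact kr_sc1 h
  | succ k ih =>
    intro m R h
    obtain ⟨Q, h1, h2⟩ := sc_succ.1 h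
    obtain ⟨c, hc⟩ := ih h1
    refine ⟨c, fun M _ xs => (h2 M xs).trans (exists_congr fun y => not_congr ?_)⟩
    have := hc M (Fin.snoc (α := fun _ => M) xs y)
    simpa [unc, pack_snoc] using this

end Univ

section Abs
variable {M : Type} [PAM M]

/-- The default assignment of the empty variable set. -/
abbrev dflt (N : Type) : Empty → N := default

theorem cast_realize {m : ℕ} (τ : LA.Term (Empty ⊕ Fin m)) (xs : Fin m → ℕ) :
    ((τ.realize (Sum.elim (dflt ℕ) xs) : ℕ) : M) = τ.realize (Sum.elim default (fun i => (xs i : M))) := by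
  induction τ with
  | var i =>
    rcases i with i | i
    · exact i.elim
    · rfl
  | @func n g ts ih =>
    match n, g with
    | 0, _ => exact Nat.cast_zero
    | 1, _ =>
      refine (Nat.cast_add _ _).trans ?_
      rw [Nat.cast_one, ih 0]; rfl
    | 2, false =>
      refine (Nat.cast_add _ _).trans ?_
      rw [ih 0, ih 1]; rfl
    | 2, true =>
      refine (Nat.cast_mul _ _).trans ?_
      rw [ih 0, ih 1]; rfl

theorem cast_snoc {m : ℕ} (xs : Fin m → ℕ) (y : ℕ) :
    (fun i => (((Fin.snoc xs y : Fin (m+1) → ℕ) i : ℕ) : M)) = Fin.snoc (fun i => (xs i : M)) (y : M) := by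
  funext i
  refine Fin.lastCases ?_ (fun i => ?_) i <;> simp

theorem abs_delta0 {m : ℕ} {φ : LA.BoundedFormula Empty m} (h : IsDelta0 φ) : ∀ xs : Fin m → ℕ,
    φ.Realize (dflt ℕ) xs ↔ φ.Realize default (fun i => (xs i : M)) := by
  induction h with
  | falsum => intro xs; exact Iff.rfl
  | equal t u =>
    intro xs
    simp only [BoundedFormula.realize_bdEqual, ← cast_realize, Nat.cast_inj]
  | le t u =>
    intro xs
    simp only [realize_leF, rl_eq, ← cast_realize, Nat.cast_le]
  | imp _ _ ih1 ih2 =>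
    intro xs
    rw [BoundedFormula.realize_imp, BoundedFormula.realize_imp, ih1, ih2]
  | @ball m t φ _ ih =>
    intro xs
    simp only [BoundedFormula.realize_all, BoundedFormula.realize_imp, realize_leF, realize_vT, realize_wk, rl_eq, Fin.snoc_last, ← cast_realize]
    constructor
    · intro h y hy
      obtain ⟨j, hj, rfl⟩ := pam_le_cast hy
      rw [← cast_snoc, ← ih]
      exact h j hj
    · intro h y hy
      rw [ih, cast_snoc]
      exact h y (Nat.cast_le.2 hy)
  | @bex m t φ _ ih =>
    intro xs
    simp only [BoundedFormula.realize_ex, BoundedFormula.realize_inf, realize_leF, realize_vT, realize_wk, rl_eq, Fin.snoc_last, ← cast_realize]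
    constructor
    · rintro ⟨y, hy, h⟩
      rw [ih, cast_snoc] at h
      exact ⟨y, Nat.cast_le.2 hy, h⟩
    · rintro ⟨y, hy, h⟩
      obtain ⟨j, hj, rfl⟩ := pam_le_cast hy
      rw [← cast_snoc, ← ih] at h
      exact ⟨j, hj, h⟩

theorem abs_d0 {m : ℕ} {R : URel m} (h : D0 m R) (xs : Fin m → ℕ) :
    R ℕ xs ↔ R M (fun i => (xs i : M)) := by
  obtain ⟨φ, h1, h2⟩ := h
  exact (h2 ℕ xs).trans ((abs_delta0 h1 xs).trans (h2 M _).symm)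

theorem abs_stage (y c x : ℕ) : Stage y c x ↔ Stage (y : M) (c : M) (x : M) := by
  have := abs_d0 (M := M) d0_stage0 ![y, c, x]
  exact this

end Abs

/-- `Σ_1` relations on the natural numbers. -/
class N1 (m : ℕ) (P : (Fin m → ℕ) → Prop) : Prop where
  out : ∃ R : URel m, SC 1 m R ∧ ∀ xs, P xs ↔ R ℕ xs

/-- Functions on the natural numbers given by terms. -/
class NT (m : ℕ) (t : (Fin m → ℕ) → ℕ) : Prop where
  out : ∃ R : UFun m, Tm m R ∧ ∀ xs, t xs = R ℕ xs

section N1closure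
variable {m : ℕ}

theorem N1.congr {P Q : (Fin m → ℕ) → Prop} (h : N1 m P) (e : ∀ xs, Q xs ↔ P xs) : N1 m Q := by
  obtain ⟨R, h1, h2⟩ := h
  exact ⟨R, h1, fun xs => (e xs).trans (h2 xs)⟩

instance nt_var (i : Fin m) : NT m (fun xs => xs i) := ⟨fun _ _ xs => xs i, inferInstance, fun _ => rfl⟩
instance nt_const (c : ℕ) : NT m (fun _ => c) := ⟨fun _ _ _ => (c : _), inferInstance, fun _ => by simp⟩
instance nt_add (t u : (Fin m → ℕ) → ℕ) [ht : NT m t] [hu : NT m u] : NT m (fun xs => t xs + u xs) := by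
  obtain ⟨T, h1, h2⟩ := ht
  obtain ⟨U, h3, h4⟩ := hu
  exact ⟨fun M _ xs => T M xs + U M xs, inferInstance, fun xs => by rw [h2, h4]⟩
instance nt_mul (t u : (Fin m → ℕ) → ℕ) [ht : NT m t] [hu : NT m u] : NT m (fun xs => t xs * u xs) := by
  obtain ⟨T, h1, h2⟩ := ht
  obtain ⟨U, h3, h4⟩ := hu
  exact ⟨fun M _ xs => T M xs * U M xs, inferInstance, fun xs => by rw [h2, h4]⟩
instance nt_pr (t u : (Fin m → ℕ) → ℕ) [ht : NT m t] [hu : NT m u] : NT m (fun xs => pr (t xs) (u xs)) := by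
  unfold pr; infer_instance
instance n1_const (p : Prop) : N1 m (fun _ => p) := by
  by_cases hp : p
  · exact ⟨fun _ _ _ => True, inferInstance, fun _ => by simp [hp]⟩
  · exact ⟨fun _ _ _ => False, inferInstance, fun _ => by simp [hp]⟩
instance n1_and (P Q : (Fin m → ℕ) → Prop) [hP : N1 m P] [hQ : N1 m Q] : N1 m (fun xs => P xs ∧ Q xs) := by
  obtain ⟨T, h1, h2⟩ := hP
  obtain ⟨U, h3, h4⟩ := hQ
  exact ⟨fun M _ xs => T M xs ∧ U M xs, inferInstance, fun xs => by rw [h2, h4]⟩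
instance n1_or (P Q : (Fin m → ℕ) → Prop) [hP : N1 m P] [hQ : N1 m Q] : N1 m (fun xs => P xs ∨ Q xs) := by
  obtain ⟨T, h1, h2⟩ := hP
  obtain ⟨U, h3, h4⟩ := hQ
  exact ⟨fun M _ xs => T M xs ∨ U M xs, inferInstance, fun xs => by rw [h2, h4]⟩
instance n1_eq (t u : (Fin m → ℕ) → ℕ) [ht : NT m t] [hu : NT m u] : N1 m (fun xs => t xs = u xs) := by
  obtain ⟨T, h1, h2⟩ := ht
  obtain ⟨U, h3, h4⟩ := hu
  exact ⟨fun M _ xs => T M xs = U M xs, inferInstance, fun xs => by rw [h2, h4]⟩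
instance n1_le (t u : (Fin m → ℕ) → ℕ) [ht : NT m t] [hu : NT m u] : N1 m (fun xs => t xs ≤ u xs) := by
  obtain ⟨T, h1, h2⟩ := ht
  obtain ⟨U, h3, h4⟩ := hu
  exact ⟨fun M _ xs => T M xs ≤ U M xs, inferInstance, fun xs => by rw [h2, h4]⟩
instance n1_lt (t u : (Fin m → ℕ) → ℕ) [ht : NT m t] [hu : NT m u] : N1 m (fun xs => t xs < u xs) := by
  obtain ⟨T, h1, h2⟩ := ht
  obtain ⟨U, h3, h4⟩ := hu
  exact ⟨fun M _ xs => T M xs < U M xs, inferInstance, fun xs => by rw [h2, h4]⟩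
instance n1_ex (P : (Fin m → ℕ) → ℕ → Prop)
    [hP : N1 (m+1) (fun xs => P (fun i => xs (Fin.castSucc i)) (xs (Fin.last m)))] :
    N1 m (fun xs => ∃ y, P xs y) := by
  obtain ⟨R, h1, h2⟩ := hP
  refine ⟨fun M _ xs => ∃ y, R M (Fin.snoc xs y), ?_, fun xs => exists_congr fun y => ?_⟩
  · refine sc_ex (fun M _ xs y => R M (Fin.snoc xs y)) (h1.congr (fun M _ xs => ?_))
    rw [unc, snoc_init']
  · rw [← h2]; simp
instance n1_ball (t : (Fin m → ℕ) → ℕ) (P : (Fin m → ℕ) → ℕ → Prop) [ht : NT m t]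
    [hP : N1 (m+1) (fun xs => P (fun i => xs (Fin.castSucc i)) (xs (Fin.last m)))] :
    N1 m (fun xs => ∀ y, y ≤ t xs → P xs y) := by
  obtain ⟨T, h3, h4⟩ := ht
  obtain ⟨R, h1, h2⟩ := hP
  refine ⟨fun M _ xs => ∀ y, y ≤ T M xs → R M (Fin.snoc xs y), ?_, fun xs => forall_congr' fun y => ?_⟩
  · haveI : SC 1 (m+1) (fun M _ xs => R M (Fin.snoc (fun i => xs (Fin.castSucc i)) (xs (Fin.last m)))) :=
      h1.congr (fun M _ xs => by rw [snoc_init'])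
    exact sc_ball T (fun M _ xs y => R M (Fin.snoc xs y))
  · rw [← h2, h4]; simp
theorem n1_subst {l : ℕ} {P : (Fin m → ℕ) → Prop} (h : N1 m P) (ts : Fin m → (Fin l → ℕ) → ℕ)
    [hts : ∀ i, NT l (ts i)] : N1 l (fun xs => P (fun i => ts i xs)) := by
  obtain ⟨R, h1, h2⟩ := h
  choose T hT hT' using fun i => (hts i).out
  exact ⟨fun M _ xs => R M (fun i => T i M xs), sc_subst R h1 T hT, fun xs => by
    rw [h2]; simp only [hT']⟩
instance nt_cons {l : ℕ} (t : (Fin l → ℕ) → ℕ) (ts : Fin m → (Fin l → ℕ) → ℕ) [ht : NT l t]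
    [hts : ∀ i, NT l (ts i)] (i : Fin (m+1)) : NT l (Matrix.vecCons t ts i) := by
  refine Fin.cases ?_ (fun i => ?_) i
  · exact ht
  · exact hts i
instance nt_empty {l : ℕ} (i : Fin 0) : NT l (Matrix.vecEmpty i) := i.elim0

theorem n1_app1 {P : ℕ → Prop} (h : N1 1 (fun xs => P (xs 0))) (t : (Fin m → ℕ) → ℕ) [NT m t] :
    N1 m (fun xs => P (t xs)) := n1_subst h ![t]
theorem n1_app2 {P : ℕ → ℕ → Prop} (h : N1 2 (fun xs => P (xs 0) (xs 1))) (t u : (Fin m → ℕ) → ℕ) [NT m t]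
    [NT m u] : N1 m (fun xs => P (t xs) (u xs)) := n1_subst h ![t, u]
theorem n1_app3 {P : ℕ → ℕ → ℕ → Prop} (h : N1 3 (fun xs => P (xs 0) (xs 1) (xs 2)))
    (t u v : (Fin m → ℕ) → ℕ) [NT m t]
    [NT m u] [NT m v] : N1 m (fun xs => P (t xs) (u xs) (v xs)) := n1_subst h ![t, u, v]

end N1closure

/-- Semantic form of recursive enumerability of provability. -/
def RE (T : Thy) : Prop := ∀ (k : ℕ) (Φ : URel 2), SC k 2 Φ →
  N1 2 (fun xs => ∀ (M : Type) [PAM M], M ⊨ T → Φ M (fun i => (xs i : M)))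

section MainLemma

/-- The triple code. -/
def pk {M : Type} [PAM M] (a b c : M) : M := pr (pr (pr 0 a) b) c

instance tm_pk {m : ℕ} (t u v : UFun m) [Tm m t] [Tm m u] [Tm m v] :
    Tm m (fun M _ xs => pk (t M xs) (u M xs) (v M xs)) := by
  unfold pk; infer_instance

theorem cast_pk {M : Type} [PAM M] (a b c : ℕ) : ((pk a b c : ℕ) : M) = pk (a : M) (b : M) (c : M) := by
  unfold pk; simp [cast_pr]

/-- The auxiliary relation `R` of the construction. -/
def RR (k : ℕ) (tag : ℕ) (M : Type) [PAM M] (i x : M) : Prop :=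
  ∀ u, u ≤ x → (¬ Stage x i (pk (tag : M) i u) ∨ Uni M k u 0)

/-- The negation of the sentence of the construction. -/
def NTh (k : ℕ) (M : Type) [PAM M] (i : M) : Prop :=
  ∃ x, Stage x i (pk ((0:ℕ) : M) i 0) ∧ RR k 1 M i x ∧ RR k 2 M i x

instance sc_rr {k m tag : ℕ} (i x : UFun m) [Tm m i] [Tm m x] :
    SC (k+1) m (fun M _ xs => RR k tag M (i M xs) (x M xs)) := by
  have : SC (k+1) 2 (fun M _ xs => RR k tag M (xs 0) (xs 1)) := by
    unfold RR; infer_instance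
  exact sc_subst _ this ![i, x] inferInstance
instance sc_nth {k m : ℕ} (i : UFun m) [Tm m i] :
    SC (k+1) m (fun M _ xs => NTh k M (i M xs)) := by
  have : SC (k+1) 1 (fun M _ xs => NTh k M (xs 0)) := by
    unfold NTh; infer_instance
  exact sc_subst _ this ![i] inferInstance

theorem pi_of_sc {k : ℕ} (R : URel 0) (h : SC k 0 R) : ∃ φ ∈ PiS k, ∀ (M : Type) [PAM M],
    M ⊨ φ ↔ ¬ R M default := by
  obtain ⟨φ, h1, h2⟩ := (fml_of_sc h).2
  exact ⟨φ, h1, fun M _ => h2 M default⟩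

theorem main_lemma (T U : Thy) (hT : ExtPA T) (hU : ExtPA U) (rT : RE T) (rU : RE U) (k : ℕ)
    (hc : Con (T ∪ ThIn (PiS (k+1)) U)) :
    ∃ θ ∈ PiS (k+1), ConsIn (SigmaS (k+1)) T θ ∧ ConsIn (SigmaS (k+1)) U θ ∧ ¬ Prv U θ := by
  -- the enumerated set
  have a0 := rU (k+2) (fun M _ xs => ¬ NTh k M (xs 0)) (sc_not _ inferInstance)
  have a1 := rT (k+1) (fun M _ xs => NTh k M (xs 0) ∨ Uni M k (xs 1) 0) inferInstance
  have a2 := rU (k+1) (fun M _ xs => NTh k M (xs 0) ∨ Uni M k (xs 1) 0) inferInstance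
  let E : (Fin 3 → ℕ) → Prop := fun xs =>
    (xs 0 = 0 ∧ ∀ (M : Type) [PAM M], M ⊨ U → ¬ NTh k M (xs 1 : M)) ∨
    (xs 0 = 1 ∧ ∀ (M : Type) [PAM M], M ⊨ T → NTh k M (xs 1 : M) ∨ Uni M k (xs 2 : M) 0) ∨
    (xs 0 = 2 ∧ ∀ (M : Type) [PAM M], M ⊨ U → NTh k M (xs 1 : M) ∨ Uni M k (xs 2 : M) 0)
  have hE : N1 3 E := by
    haveI b0 := n1_subst (l := 3) a0 ![fun xs => xs 1, fun xs => xs 2]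
    haveI b1 := n1_subst (l := 3) a1 ![fun xs => xs 1, fun xs => xs 2]
    haveI b2 := n1_subst (l := 3) a2 ![fun xs => xs 1, fun xs => xs 2]
    exact @n1_or _ _ _ (@n1_and _ _ _ inferInstance b0) (@n1_or _ _ _ (@n1_and _ _ _ inferInstance b1)
      (@n1_and _ _ _ inferInstance b2))
  obtain ⟨R, hR1, hR2⟩ := hE
  obtain ⟨i, hi⟩ := kr_sc1 hR1
  have key : ∀ a j u : ℕ, E ![a, j, u] ↔ ∃ q : ℕ, Stage q i (pk a j u) := by
    intro a j u
    rw [hR2, hi]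
    exact Iff.rfl
  have e0 : (∀ (M : Type) [PAM M], M ⊨ U → ¬ NTh k M (i : M)) ↔ ∃ q : ℕ, Stage q i (pk 0 i 0) := by
    rw [← key]; simp [E]
  have e1 : ∀ u : ℕ, (∀ (M : Type) [PAM M], M ⊨ T → NTh k M (i : M) ∨ Uni M k (u : M) 0) ↔
      ∃ q : ℕ, Stage q i (pk 1 i u) := by
    intro u; rw [← key]; simp [E]
  have e2 : ∀ u : ℕ, (∀ (M : Type) [PAM M], M ⊨ U → NTh k M (i : M) ∨ Uni M k (u : M) 0) ↔
      ∃ q : ℕ, Stage q i (pk 2 i u) := by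
    intro u; rw [← key]; simp [E]
  have ab : ∀ (M : Type) [PAM M] (q a u : ℕ), Stage (q : M) (i : M) (pk (a : M) (i : M) (u : M)) ↔ Stage q i (pk a i u) := by
    intro M _ q a u
    rw [← cast_pk, ← abs_stage]
  have s1 : ∀ (M : Type) [PAM M] (q : ℕ), M ⊨ T → ¬ NTh k M (i : M) → RR k 1 M i q := by
    intro M _ q hM h u hu
    obtain ⟨u, -, rfl⟩ := pam_le_cast hu
    rw [ab, or_iff_not_imp_left, not_not]
    intro hs
    exact ((e1 u).2 ⟨q, hs⟩ M hM).resolve_left h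
  have s2 : ∀ (M : Type) [PAM M] (q : ℕ), M ⊨ U → ¬ NTh k M (i : M) → RR k 2 M i q := by
    intro M _ q hM h u hu
    obtain ⟨u, -, rfl⟩ := pam_le_cast hu
    rw [ab, or_iff_not_imp_left, not_not]
    intro hs
    exact ((e2 u).2 ⟨q, hs⟩ M hM).resolve_left h
  obtain ⟨θ, hθ, hθ'⟩ := pi_of_sc (k := k+1) (fun M _ _ => NTh k M (i : M)) inferInstance
  have hnU : ¬ ∃ q : ℕ, Stage q i (pk 0 i 0) := by
    rintro ⟨p, hp⟩
    have hth := e0.2 ⟨p, hp⟩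
    obtain ⟨ρ, hρ, hρ'⟩ := pi_of_sc (k := k+1) (fun M _ _ => RR k 1 M (i : M) (p : M)) inferInstance
    obtain ⟨M, _, hM⟩ := (con_iff (extPA_mono Set.subset_union_left hT)).1 hc
    have hMT : M ⊨ T := hM.mono Set.subset_union_left
    have p1 : M ⊨ θ := by
      refine hM.realize_of_mem θ (Or.inr ⟨hθ, ?_⟩)
      exact (prv_iff hU θ).2 (fun M _ hM => (hθ' M).2 (hth M hM))
    have p2 : M ⊨ ρ := by
      refine hM.realize_of_mem ρ (Or.inr ⟨hρ, ?_⟩)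
      refine (prv_iff hU ρ).2 (fun M _ hM => (hρ' M).2 (fun h => hth M hM ?_))
      refine ⟨p, ?_, h, s2 M p hM (hth M hM)⟩
      have := (ab M p 0 0).2 hp
      simpa using this
    exact (hρ' M).1 p2 (s1 M p hMT ((hθ' M).1 p1))
  have std : ∀ (M : Type) [PAM M] (x : M), Stage x (i : M) (pk ((0:ℕ) : M) (i : M) 0) → ∀ q : ℕ, (q : M) ≤ x := by
    intro M _ x hx q
    by_contra hlt
    obtain ⟨p, -, rfl⟩ := pam_le_cast (not_le.1 hlt).le
    refine hnU ⟨p, (ab M p 0 0).1 ?_⟩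
    simpa using hx
  have code : ∀ σ ∈ SigmaS (k+1), ∃ u : ℕ, ∀ (M : Type) [PAM M], M ⊨ σ ↔ Uni M k (u : M) 0 := by
    intro σ hσ
    obtain ⟨c, hc⟩ := uni_of_sc (sc_of_sigma hσ)
    exact ⟨c, fun M _ => hc M default⟩
  refine ⟨θ, hθ, ?_, ?_, ?_⟩
  · intro σ hσ hp
    obtain ⟨u, hu⟩ := code σ hσ
    rw [prv_iff (extPA_add hT _)] at hp
    have h1 : ∀ (M : Type) [PAM M], M ⊨ T → NTh k M (i : M) ∨ Uni M k (u : M) 0 := by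
      intro M _ hM
      rw [or_iff_not_imp_left]
      intro h
      exact (hu M).1 (hp M (models_add.2 ⟨hM, (hθ' M).2 h⟩))
    obtain ⟨q, hq⟩ := (e1 u).1 h1
    rw [prv_iff hT]
    intro M _ hM
    rcases h1 M hM with ⟨x, hA, hR, -⟩ | h
    · refine (hu M).2 ((hR u (std M x hA u)).resolve_left (not_not.2 ?_))
      exact ((ab M q 1 u).2 hq).mono (std M x hA q)
    · exact (hu M).2 h
  · intro σ hσ hp
    obtain ⟨u, hu⟩ := code σ hσ
    rw [prv_iff (extPA_add hU _)] at hp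
    have h1 : ∀ (M : Type) [PAM M], M ⊨ U → NTh k M (i : M) ∨ Uni M k (u : M) 0 := by
      intro M _ hM
      rw [or_iff_not_imp_left]
      intro h
      exact (hu M).1 (hp M (models_add.2 ⟨hM, (hθ' M).2 h⟩))
    obtain ⟨q, hq⟩ := (e2 u).1 h1
    rw [prv_iff hU]
    intro M _ hM
    rcases h1 M hM with ⟨x, hA, -, hR⟩ | h
    · refine (hu M).2 ((hR u (std M x hA u)).resolve_left (not_not.2 ?_))
      exact ((ab M q 2 u).2 hq).mono (std M x hA q)
    · exact (hu M).2 h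
  · intro hp
    rw [prv_iff hU] at hp
    exact hnU (e0.1 (fun M _ hM => (hθ' M).1 (hp M hM)))

end MainLemma

section Recursive

instance n1_ballt {m : ℕ} (t : (Fin m → ℕ) → ℕ) (P : (Fin m → ℕ) → ℕ → Prop) [ht : NT m t]
    [hP : N1 (m+1) (fun xs => P (fun i => xs (Fin.castSucc i)) (xs (Fin.last m)))] :
    N1 m (fun xs => ∀ y, y < t xs → P xs y) := by
  haveI : NT (m+1) (fun xs => t (fun i => xs (Fin.castSucc i))) := by
    obtain ⟨T, h1, h2⟩ := ht
    refine ⟨fun M _ xs => T M (fun i => xs (Fin.castSucc i)), ?_, fun xs => h2 _⟩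
    exact tm_subst T (fun i M _ xs => xs (Fin.castSucc i))
  refine N1.congr (n1_ball t (fun xs y => t xs ≤ y ∨ P xs y)) (fun xs => ?_)
  constructor
  · intro h y _
    rcases lt_or_ge y (t xs) with h' | h'
    · exact Or.inr (h y h')
    · exact Or.inl h'
  · intro h y hy
    exact (h y hy.le).resolve_left (not_le.2 hy)

/-- The graph of Mathlib's pairing function. -/
theorem pair_graph (a b c : ℕ) : Nat.pair a b = c ↔ (a < b ∧ c = b*b+a) ∨ (b ≤ a ∧ c = a*a+a+b) := by
  unfold Nat.pair
  split_ifs with h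
  · constructor
    · intro e; exact Or.inl ⟨h, e.symm⟩
    · rintro (⟨_, e⟩ | ⟨h', _⟩)
      · exact e.symm
      · omega
  · constructor
    · intro e; exact Or.inr ⟨by omega, e.symm⟩
    · rintro (⟨h', _⟩ | ⟨_, e⟩)
      · omega
      · exact e.symm

instance n1_pair {m : ℕ} (t u v : (Fin m → ℕ) → ℕ) [NT m t] [NT m u] [NT m v] :
    N1 m (fun xs => Nat.pair (t xs) (u xs) = v xs) := by
  refine N1.congr ?_ (fun xs => pair_graph _ _ _)
  infer_instance

theorem n1_beta0 : N1 3 (fun xs => Nat.beta (xs 0) (xs 1) = xs 2) := by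
  have : N1 3 (fun xs => ∃ p q, Nat.pair p q = xs 0 ∧ ∃ d, p = d * ((xs 1 + 1) * q + 1) + xs 2 ∧
      xs 2 < (xs 1 + 1) * q + 1) := inferInstance
  refine this.congr (fun xs => ?_)
  unfold Nat.beta
  constructor
  · intro h
    refine ⟨_, _, Nat.pair_unpair _, (xs 0).unpair.1 / ((xs 1 + 1) * (xs 0).unpair.2 + 1), ?_, ?_⟩
    · rw [← h, Nat.div_add_mod']
    · rw [← h]; exact Nat.mod_lt _ (Nat.succ_pos _)
  · rintro ⟨p, q, e, d, hp, hl⟩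
    rw [← e, Nat.unpair_pair]
    simp only
    rw [hp]
    rw [Nat.mul_add_mod_self_right, Nat.mod_eq_of_lt hl]

instance n1_beta {m : ℕ} (t u v : (Fin m → ℕ) → ℕ) [NT m t] [NT m u] [NT m v] :
    N1 m (fun xs => Nat.beta (t xs) (u xs) = v xs) := n1_app3 (P := fun a b c => Nat.beta a b = c) n1_beta0 t u v

theorem beta_exists (f : ℕ → ℕ) (n : ℕ) : ∃ c, ∀ i ≤ n, Nat.beta c i = f i := by
  refine ⟨Nat.unbeta (List.ofFn (fun i : Fin (n+1) => f i)), fun i hi => ?_⟩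
  have := Nat.beta_unbeta_coe (List.ofFn (fun i : Fin (n+1) => f i)) ⟨i, by simpa using Nat.lt_succ_of_le hi⟩
  refine this.trans ?_
  simp only [Fin.getElem_fin, List.getElem_ofFn]

theorem partrec_n1 {f : ℕ →. ℕ} (h : Nat.Partrec f) : N1 2 (fun xs => xs 1 ∈ f (xs 0)) := by
  induction h with
  | zero =>
    have h0 : N1 2 (fun xs => xs 1 = 0) := inferInstance
    refine h0.congr (fun xs => ?_)
    exact Part.mem_some_iff
  | succ =>
    have h0 : N1 2 (fun xs => xs 1 = xs 0 + 1) := inferInstance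
    refine h0.congr (fun xs => ?_)
    exact Part.mem_some_iff
  | left =>
    have h0 : N1 2 (fun xs => ∃ b, Nat.pair (xs 1) b = xs 0) := inferInstance
    refine h0.congr (fun xs => ?_)
    refine Part.mem_some_iff.trans ⟨fun e => ⟨(xs 0).unpair.2, by rw [e, Nat.pair_unpair]⟩, ?_⟩
    rintro ⟨b, e⟩
    rw [← e]; simp
  | right =>
    have h0 : N1 2 (fun xs => ∃ b, Nat.pair b (xs 1) = xs 0) := inferInstance
    refine h0.congr (fun xs => ?_)
    refine Part.mem_some_iff.trans ⟨fun e => ⟨(xs 0).unpair.1, by rw [e, Nat.pair_unpair]⟩, ?_⟩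
    rintro ⟨b, e⟩
    rw [← e]; simp
  | @pair f g _ _ hf hg =>
    haveI if' : ∀ {m} (t u : (Fin m → ℕ) → ℕ) [NT m t] [NT m u], N1 m (fun xs => u xs ∈ f (t xs)) :=
      fun t u _ _ => n1_app2 (P := fun a b => b ∈ f a) hf t u
    haveI ig' : ∀ {m} (t u : (Fin m → ℕ) → ℕ) [NT m t] [NT m u], N1 m (fun xs => u xs ∈ g (t xs)) :=
      fun t u _ _ => n1_app2 (P := fun a b => b ∈ g a) hg t u
    have h0 : N1 2 (fun xs => ∃ a b, a ∈ f (xs 0) ∧ b ∈ g (xs 0) ∧ Nat.pair a b = xs 1) := inferInstance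
    refine h0.congr (fun xs => ?_)
    simp [Seq.seq, Part.mem_bind_iff, eq_comm]
  | @comp f g _ _ hf hg =>
    haveI if' : ∀ {m} (t u : (Fin m → ℕ) → ℕ) [NT m t] [NT m u], N1 m (fun xs => u xs ∈ f (t xs)) :=
      fun t u _ _ => n1_app2 (P := fun a b => b ∈ f a) hf t u
    haveI ig' : ∀ {m} (t u : (Fin m → ℕ) → ℕ) [NT m t] [NT m u], N1 m (fun xs => u xs ∈ g (t xs)) :=
      fun t u _ _ => n1_app2 (P := fun a b => b ∈ g a) hg t u
    have h0 : N1 2 (fun xs => ∃ a, a ∈ g (xs 0) ∧ xs 1 ∈ f a) := inferInstance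
    refine h0.congr (fun xs => ?_)
    exact Part.mem_bind_iff
  | @prec f g _ _ hf hg =>
    haveI if' : ∀ {m} (t u : (Fin m → ℕ) → ℕ) [NT m t] [NT m u], N1 m (fun xs => u xs ∈ f (t xs)) :=
      fun t u _ _ => n1_app2 (P := fun a b => b ∈ f a) hf t u
    haveI ig' : ∀ {m} (t u : (Fin m → ℕ) → ℕ) [NT m t] [NT m u], N1 m (fun xs => u xs ∈ g (t xs)) :=
      fun t u _ _ => n1_app2 (P := fun a b => b ∈ g a) hg t u
    have h0 : N1 2 (fun xs => ∃ a n, Nat.pair a n = xs 0 ∧ ∃ c, Nat.beta c n = xs 1 ∧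
      (∃ v, Nat.beta c 0 = v ∧ v ∈ f a) ∧ ∀ i, i < n → ∃ v w p q, Nat.beta c i = v ∧ Nat.beta c (i+1) = w ∧
        Nat.pair i v = p ∧ Nat.pair a p = q ∧ w ∈ g q) := inferInstance
    refine h0.congr (fun xs => ?_)
    have key : ∀ a n y, y ∈ (Nat.rec (f a) (fun y IH => do let i ← IH; g (Nat.pair a (Nat.pair y i))) n : Part ℕ) ↔
        ∃ h : ℕ → ℕ, h n = y ∧ h 0 ∈ f a ∧ ∀ i, i < n → h (i+1) ∈ g (Nat.pair a (Nat.pair i (h i))) := by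
      intro a n
      induction n with
      | zero =>
        intro y
        constructor
        · intro h; exact ⟨fun _ => y, rfl, h, fun i hi => absurd hi (Nat.not_lt_zero _)⟩
        · rintro ⟨h, rfl, h0, -⟩; exact h0
      | succ n ih =>
        intro y
        refine Part.mem_bind_iff.trans ?_
        constructor
        · rintro ⟨z, hz, hy⟩
          obtain ⟨h, h1, h2, h3⟩ := (ih z).1 hz
          refine ⟨fun i => if i ≤ n then h i else y, by simp, by simpa using h2, fun i hi => ?_⟩
          have hi' : i ≤ n := Nat.le_of_lt_succ hi
          rcases hi'.lt_or_eq with h' | rfl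
          · simp [hi', Nat.succ_le_of_lt h']; exact h3 i h'
          · simp [h1, hy]
        · rintro ⟨h, h1, h2, h3⟩
          refine ⟨h n, (ih _).2 ⟨h, rfl, h2, fun i hi => h3 i (Nat.lt_succ_of_lt hi)⟩, ?_⟩
          rw [← h1]; exact h3 n (Nat.lt_succ_self n)
    simp only [Nat.unpaired]
    constructor
    · intro h
      obtain ⟨h, h1, h2, h3⟩ := (key _ _ _).1 h
      obtain ⟨c, hc⟩ := beta_exists h (xs 0).unpair.2
      refine ⟨_, _, Nat.pair_unpair _, c, by rw [hc _ le_rfl, h1], ⟨_, rfl, by rwa [hc _ (Nat.zero_le _)]⟩, ?_⟩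
      intro i hi
      refine ⟨_, _, _, _, rfl, rfl, rfl, rfl, ?_⟩
      rw [hc _ hi, hc _ hi.le]; exact h3 i hi
    · rintro ⟨a, n, e, c, h1, ⟨v, hv, h2⟩, h3⟩
      rw [← e, Nat.unpair_pair]
      refine (key _ _ _).2 ⟨Nat.beta c, h1, by rwa [hv], fun i hi => ?_⟩
      obtain ⟨v, w, p, q, rfl, rfl, rfl, rfl, h⟩ := h3 i hi
      exact h
  | @rfind f _ hf =>
    haveI if' : ∀ {m} (t u : (Fin m → ℕ) → ℕ) [NT m t] [NT m u], N1 m (fun xs => u xs ∈ f (t xs)) :=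
      fun t u _ _ => n1_app2 (P := fun a b => b ∈ f a) hf t u
    have h0 : N1 2 (fun xs => (∃ p, Nat.pair (xs 0) (xs 1) = p ∧ 0 ∈ f p) ∧
      ∀ i, i < xs 1 → ∃ p v, Nat.pair (xs 0) i = p ∧ v + 1 ∈ f p) := inferInstance
    refine h0.congr (fun xs => ?_)
    refine Nat.mem_rfind.trans ?_
    simp only [Part.map_eq_map, Part.mem_map_iff, eq_comm (a := true), eq_comm (a := false), decide_eq_true_eq, decide_eq_false_iff_not, exists_eq_right, exists_eq_left']
    refine and_congr Iff.rfl (forall_congr' fun i => ?_)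
    constructor
    · intro h hi
      obtain ⟨a, h1, h2⟩ := h hi
      obtain ⟨v, rfl⟩ := Nat.exists_eq_succ_of_ne_zero h2
      exact ⟨_, v, rfl, h1⟩
    · intro h hi
      obtain ⟨_, v, rfl, hv⟩ := h hi
      exact ⟨_, hv, Nat.succ_ne_zero v⟩

theorem n1_of_re {p : ℕ → Prop} (h : REPred p) : N1 1 (fun xs => p (xs 0)) := by
  have h' : Nat.Partrec _ := h
  have h2 := partrec_n1 h'
  refine N1.congr (n1_ex (m := 1) (fun xs y => y ∈ (Part.bind (Encodable.decode (α := ℕ) (xs 0)) fun a =>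
        Part.map Encodable.encode ((fun a => Part.assert (p a) fun x => Part.some ()) a))) (hP := h2)) (fun xs => ?_)
  simp

end Recursive

section Unsat

theorem n1_pow0 : N1 2 (fun xs => 2 ^ (xs 0) = xs 1) := by
  have h0 : N1 2 (fun xs => ∃ c, Nat.beta c 0 = 1 ∧ Nat.beta c (xs 0) = xs 1 ∧
    ∀ i, i < xs 0 → ∃ v, Nat.beta c i = v ∧ Nat.beta c (i+1) = 2 * v) := inferInstance
  refine h0.congr (fun xs => ?_)
  constructor
  · intro h
    obtain ⟨c, hc⟩ := beta_exists (fun i => 2 ^ i) (xs 0)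
    refine ⟨c, hc 0 (Nat.zero_le _), (hc _ le_rfl).trans h, fun i hi => ⟨_, rfl, ?_⟩⟩
    rw [hc _ hi, hc _ hi.le, pow_succ, mul_comm]
  · rintro ⟨c, h1, h2, h3⟩
    have : ∀ i, i ≤ xs 0 → Nat.beta c i = 2 ^ i := by
      intro i
      induction i with
      | zero => intro _; simpa using h1
      | succ i ih =>
        intro hi
        obtain ⟨v, hv, hw⟩ := h3 i hi
        rw [hw, ← hv, ih (Nat.le_of_succ_le hi), pow_succ, mul_comm]
    rw [← h2, this _ le_rfl]

instance n1_pow {m : ℕ} (t u : (Fin m → ℕ) → ℕ) [NT m t] [NT m u] :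
    N1 m (fun xs => 2 ^ (t xs) = u xs) := n1_app2 (P := fun a b => 2 ^ a = b) n1_pow0 t u

theorem n1_bitT0 : N1 2 (fun xs => (xs 0).testBit (xs 1) = true) := by
  have h0 : N1 2 (fun xs => ∃ e q r, 2 ^ (xs 1) = e ∧ xs 0 = e * (2 * q + 1) + r ∧ r < e) := inferInstance
  refine h0.congr (fun xs => ?_)
  rw [Nat.testBit_eq_decide_div_mod_eq, decide_eq_true_eq]
  have hp : 0 < 2 ^ (xs 1) := by positivity
  constructor
  · intro h
    refine ⟨_, xs 0 / 2 ^ (xs 1) / 2, xs 0 % 2 ^ (xs 1), rfl, ?_, Nat.mod_lt _ hp⟩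
    have h1 := Nat.div_add_mod (xs 0 / 2 ^ (xs 1)) 2
    rw [h] at h1
    rw [h1, Nat.div_add_mod]
  · rintro ⟨e, q, r, rfl, h, hr⟩
    rw [h, Nat.mul_add_div hp, Nat.div_eq_of_lt hr]
    omega

theorem n1_bitF0 : N1 2 (fun xs => (xs 0).testBit (xs 1) = false) := by
  have h0 : N1 2 (fun xs => ∃ e q r, 2 ^ (xs 1) = e ∧ xs 0 = e * (2 * q) + r ∧ r < e) := inferInstance
  refine h0.congr (fun xs => ?_)
  rw [Nat.testBit_eq_decide_div_mod_eq, decide_eq_false_iff_not]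
  have hp : 0 < 2 ^ (xs 1) := by positivity
  constructor
  · intro h
    refine ⟨_, xs 0 / 2 ^ (xs 1) / 2, xs 0 % 2 ^ (xs 1), rfl, ?_, Nat.mod_lt _ hp⟩
    have h1 := Nat.div_add_mod (xs 0 / 2 ^ (xs 1)) 2
    rw [show xs 0 / 2 ^ (xs 1) % 2 = 0 by omega, add_zero] at h1
    rw [h1, Nat.div_add_mod]
  · rintro ⟨e, q, r, rfl, h, hr⟩
    rw [h, Nat.mul_add_div hp, Nat.div_eq_of_lt hr]
    omega

instance n1_bitT {m : ℕ} (t u : (Fin m → ℕ) → ℕ) [NT m t] [NT m u] :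
    N1 m (fun xs => (t xs).testBit (u xs) = true) :=
  n1_app2 (P := fun a b => a.testBit b = true) n1_bitT0 t u
instance n1_bitF {m : ℕ} (t u : (Fin m → ℕ) → ℕ) [NT m t] [NT m u] :
    N1 m (fun xs => (t xs).testBit (u xs) = false) :=
  n1_app2 (P := fun a b => a.testBit b = false) n1_bitF0 t u

/-- A set of clauses: two premises and two conclusions. -/
abbrev Clauses := ℕ → ℕ → ℕ → ℕ → Prop

/-- The valuation `v` satisfies all clauses; `0` codes falsity and `1` codes truth. -/
def GoodVal (C : Clauses) (v : ℕ → Bool) : Prop :=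
  v 0 = false ∧ v 1 = true ∧ ∀ a b c d, C a b c d → v a = true → v b = true → v c = true ∨ v d = true

theorem goodVal_compact (C : Clauses) :
    (∃ v, GoodVal C v) ↔ ∀ N, ∃ v, GoodVal (fun a b c d => a < N ∧ b < N ∧ c < N ∧ d < N ∧ C a b c d) v := by
  constructor
  · rintro ⟨v, h1, h2, h3⟩ N
    exact ⟨v, h1, h2, fun a b c d h => h3 a b c d h.2.2.2.2⟩
  · intro h
    let S : ℕ → Set (ℕ → Bool) := fun N => {v | GoodVal (fun a b c d => a < N ∧ b < N ∧ c < N ∧ d < N ∧ C a b c d) v}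
    have hcl : ∀ N, IsClosed (S N) := by
      intro N
      have cl : ∀ i : ℕ, ∀ x : Bool, IsClosed {v : ℕ → Bool | v i = x} := fun i x =>
        isClosed_eq (continuous_apply i) continuous_const
      have op : ∀ i : ℕ, ∀ x : Bool, IsOpen {v : ℕ → Bool | v i = x} := fun i x =>
        IsOpen.preimage (f := fun v : ℕ → Bool => v i) (continuous_apply i) (isOpen_discrete {x})
      refine (cl 0 false).inter ((cl 1 true).inter ?_)
      have : (fun v : ℕ → Bool => ∀ a b c d, (a < N ∧ b < N ∧ c < N ∧ d < N ∧ C a b c d) → v a = true → v b = true → v c = true ∨ v d = true) =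
        (⋂ (a) (b) (c) (d) (_ : a < N ∧ b < N ∧ c < N ∧ d < N ∧ C a b c d), ({v : ℕ → Bool | v a = true}ᶜ ∪ ({v | v b = true}ᶜ ∪ ({v | v c = true} ∪ {v | v d = true})) : Set (ℕ → Bool))) := by
        ext v
        change _ ↔ v ∈ (⋂ (a) (b) (c) (d) (_ : a < N ∧ b < N ∧ c < N ∧ d < N ∧ C a b c d), ({v : ℕ → Bool | v a = true}ᶜ ∪ ({v | v b = true}ᶜ ∪ ({v | v c = true} ∪ {v | v d = true})) : Set (ℕ → Bool)))
        simp only [Set.mem_iInter, Set.mem_union, Set.mem_compl_iff, Set.mem_setOf_eq, imp_iff_not_or]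
      change IsClosed (fun v : ℕ → Bool => ∀ a b c d, (a < N ∧ b < N ∧ c < N ∧ d < N ∧ C a b c d) → v a = true → v b = true → v c = true ∨ v d = true)
      rw [this]
      exact isClosed_iInter fun a => isClosed_iInter fun b => isClosed_iInter fun c => isClosed_iInter fun d =>
        isClosed_iInter fun _ => ((op a true).isClosed_compl).union (((op b true).isClosed_compl).union ((cl c true).union (cl d true)))
    obtain ⟨v, hv⟩ := IsCompact.nonempty_iInter_of_directed_nonempty_isCompact_isClosed S
      (by
        refine (antitone_nat_of_succ_le (fun N => ?_)).directed_ge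
        rintro v ⟨h1, h2, h3⟩
        refine ⟨h1, h2, fun a b c d h => h3 a b c d ⟨?_, ?_, ?_, ?_, h.2.2.2.2⟩⟩
        · exact Nat.lt_succ_of_lt h.1
        · exact Nat.lt_succ_of_lt h.2.1
        · exact Nat.lt_succ_of_lt h.2.2.1
        · exact Nat.lt_succ_of_lt h.2.2.2.1)
      h (fun N => (hcl N).isCompact) hcl
    rw [Set.mem_iInter] at hv
    refine ⟨v, (hv 0).1, (hv 0).2.1, fun a b c d hC => ?_⟩
    refine (hv (a + b + c + d + 1)).2.2 a b c d ⟨?_, ?_, ?_, ?_, hC⟩ <;> omega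

theorem n1_unsat (C : ℕ → ℕ → Clauses)
    (hC : N1 6 (fun xs => C (xs 0) (xs 1) (xs 2) (xs 3) (xs 4) (xs 5))) :
    N1 2 (fun xs => ¬ ∃ v, GoodVal (C (xs 0) (xs 1)) v) := by
  haveI : ∀ {m} (x y a b c d : (Fin m → ℕ) → ℕ) [NT m x] [NT m y] [NT m a] [NT m b] [NT m c] [NT m d],
      N1 m (fun xs => C (x xs) (y xs) (a xs) (b xs) (c xs) (d xs)) := by
    intro m x y a b c d _ _ _ _ _ _
    exact n1_subst hC ![x, y, a, b, c, d] (hts := fun i => by fin_cases i <;> assumption)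
  have h0 : N1 2 (fun xs => ∃ N e, 2 ≤ N ∧ 2 ^ N = e ∧ ∀ w, w < e → (w.testBit 0 = true ∨ w.testBit 1 = false ∨
      ∃ a b c d, (a < N ∧ b < N ∧ c < N ∧ d < N ∧ C (xs 0) (xs 1) a b c d) ∧
        w.testBit a = true ∧ w.testBit b = true ∧ w.testBit c = false ∧ w.testBit d = false)) := inferInstance
  refine h0.congr (fun xs => ?_)
  rw [goodVal_compact]
  push Not
  constructor
  · rintro ⟨N, hN⟩
    refine ⟨N + 2, _, Nat.le_add_left _ _, rfl, fun w _ => ?_⟩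
    by_contra hcon
    push Not at hcon
    obtain ⟨h1, h2, h3⟩ := hcon
    refine hN w.testBit ⟨by simpa using h1, by simpa using h2, fun a b c d h ha hb => ?_⟩
    have := h3 a b c d ⟨by omega, by omega, by omega, by omega, h.2.2.2.2⟩ ha hb
    by_contra h4
    push Not at h4
    simp at h4
    exact this h4.1 h4.2
  · rintro ⟨N, e, h2, rfl, h⟩
    refine ⟨N, fun v hv => ?_⟩
    have hb : ∀ i, i < N → (Nat.ofBits (fun i : Fin N => v i)).testBit i = v i := fun i hi => by
      rw [Nat.testBit_ofBits_lt _ _ hi]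
    rcases h _ (Nat.ofBits_lt_two_pow (fun i : Fin N => v i)) with h | h | ⟨a, b, c, d, h, h3, h4, h5, h6⟩
    · rw [hb 0 (by omega), hv.1] at h; simp at h
    · rw [hb 1 (by omega), hv.2.1] at h; simp at h
    · rw [hb _ h.1] at h3
      rw [hb _ h.2.1] at h4
      rw [hb _ h.2.2.1] at h5
      rw [hb _ h.2.2.2.1] at h6
      have := hv.2.2 a b c d h h3 h4
      simp [h5, h6] at this

end Unsat

section Codes

/-- Tagged codes. -/
def mk (tag a b : ℕ) : ℕ := pr tag (pr a b) + 2

theorem mk_inj {t a b t' a' b' : ℕ} : mk t a b = mk t' a' b' ↔ t = t' ∧ a = a' ∧ b = b' := by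
  unfold mk
  rw [Nat.add_right_cancel_iff, pr_inj, pr_inj]

instance nt_mk {m : ℕ} (c : ℕ) (t u : (Fin m → ℕ) → ℕ) [NT m t] [NT m u] :
    NT m (fun xs => mk c (t xs) (u xs)) := by
  unfold mk; infer_instance

/-- First inverse of `pr`. -/
def d1 (n : ℕ) : ℕ := n - Nat.sqrt n * Nat.sqrt n
/-- Second inverse of `pr`. -/
def d2 (n : ℕ) : ℕ := Nat.sqrt n - d1 n

theorem sqrt_pr (a b : ℕ) : Nat.sqrt (pr a b) = a + b := by
  unfold pr
  exact Nat.sqrt_add_eq _ (by omega)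
@[simp] theorem d1_pr (a b : ℕ) : d1 (pr a b) = a := by
  unfold d1; rw [sqrt_pr]; unfold pr; omega
@[simp] theorem d2_pr (a b : ℕ) : d2 (pr a b) = b := by
  unfold d2; rw [sqrt_pr, d1_pr]; omega
theorem d1_le (n : ℕ) : d1 n ≤ n := Nat.sub_le _ _
theorem d2_le (n : ℕ) : d2 n ≤ n := (Nat.sub_le _ _).trans (Nat.sqrt_le_self n)

/-- The tag of a code. -/
def dt (c : ℕ) : ℕ := d1 (c - 2)
/-- First component of a code. -/
def da (c : ℕ) : ℕ := d1 (d2 (c - 2))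
/-- Second component of a code. -/
def db (c : ℕ) : ℕ := d2 (d2 (c - 2))
@[simp] theorem dt_mk (t a b : ℕ) : dt (mk t a b) = t := by unfold dt mk; simp
@[simp] theorem da_mk (t a b : ℕ) : da (mk t a b) = a := by unfold da mk; simp
@[simp] theorem db_mk (t a b : ℕ) : db (mk t a b) = b := by unfold db mk; simp
@[simp] theorem mk_ne_zero (t a b : ℕ) : mk t a b ≠ 0 := by unfold mk; omega
@[simp] theorem mk_ne_one (t a b : ℕ) : mk t a b ≠ 1 := by unfold mk; omega
theorem da_lt {c : ℕ} (h : c ≠ 0) : da c < c := by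
  have := (d1_le (d2 (c - 2))).trans (d2_le _)
  unfold da; omega
theorem db_lt {c : ℕ} (h : c ≠ 0) : db c < c := by
  have := (d2_le (d2 (c - 2))).trans (d2_le _)
  unfold db; omega

theorem beta_le (n i : ℕ) : Nat.beta n i ≤ n :=
  (Nat.mod_le _ _).trans (Nat.unpair_left_le n)

/-! Codes of terms. -/
def tvar (k : ℕ) : ℕ := mk 0 k 0
def tzero : ℕ := mk 1 0 0
def tsucc (t : ℕ) : ℕ := mk 2 t 0
def tadd (t u : ℕ) : ℕ := mk 3 t u
def tmul (t u : ℕ) : ℕ := mk 4 t u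
/-! Codes of formulas. -/
def fbot : ℕ := mk 0 0 0
def feq (t u : ℕ) : ℕ := mk 1 t u
def fle (t u : ℕ) : ℕ := mk 2 t u
def fimp (t u : ℕ) : ℕ := mk 3 t u
def fall (t : ℕ) : ℕ := mk 4 t 0
/-! Codes of elements of the Henkin domain. -/
def inum (k : ℕ) : ℕ := mk 0 k 0
def isucc (t : ℕ) : ℕ := mk 1 t 0
def iadd (t u : ℕ) : ℕ := mk 2 t u
def imul (t u : ℕ) : ℕ := mk 3 t u
def ival (t u : ℕ) : ℕ := mk 4 t u
def iwit (t u : ℕ) : ℕ := mk 5 t u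
/-! Codes of propositional variables. -/
def vTR (t u : ℕ) : ℕ := mk 1 t u
def vEQ (t u : ℕ) : ℕ := mk 2 t u
def vLE (t u : ℕ) : ℕ := mk 3 t u
def vPT (n l t r : ℕ) : ℕ := mk 4 (pr n l) (pr t r)
def vPF (n l t r : ℕ) : ℕ := mk 5 (pr n l) (pr t r)

section inst
variable {m : ℕ} (n l t u : (Fin m → ℕ) → ℕ) [NT m n] [NT m l] [NT m t] [NT m u]
instance nt_tvar : NT m (fun xs => tvar (t xs)) := by unfold tvar; infer_instance
instance nt_tsucc : NT m (fun xs => tsucc (t xs)) := by unfold tsucc; infer_instance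
instance nt_tadd : NT m (fun xs => tadd (t xs) (u xs)) := by unfold tadd; infer_instance
instance nt_tmul : NT m (fun xs => tmul (t xs) (u xs)) := by unfold tmul; infer_instance
instance nt_feq : NT m (fun xs => feq (t xs) (u xs)) := by unfold feq; infer_instance
instance nt_fle : NT m (fun xs => fle (t xs) (u xs)) := by unfold fle; infer_instance
instance nt_fimp : NT m (fun xs => fimp (t xs) (u xs)) := by unfold fimp; infer_instance
instance nt_fall : NT m (fun xs => fall (t xs)) := by unfold fall; infer_instance
instance nt_inum : NT m (fun xs => inum (t xs)) := by unfold inum; infer_instance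
instance nt_isucc : NT m (fun xs => isucc (t xs)) := by unfold isucc; infer_instance
instance nt_iadd : NT m (fun xs => iadd (t xs) (u xs)) := by unfold iadd; infer_instance
instance nt_imul : NT m (fun xs => imul (t xs) (u xs)) := by unfold imul; infer_instance
instance nt_ival : NT m (fun xs => ival (t xs) (u xs)) := by unfold ival; infer_instance
instance nt_iwit : NT m (fun xs => iwit (t xs) (u xs)) := by unfold iwit; infer_instance
instance nt_vTR : NT m (fun xs => vTR (t xs) (u xs)) := by unfold vTR; infer_instance
instance nt_vEQ : NT m (fun xs => vEQ (t xs) (u xs)) := by unfold vEQ; infer_instance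
instance nt_vLE : NT m (fun xs => vLE (t xs) (u xs)) := by unfold vLE; infer_instance
instance nt_vPT : NT m (fun xs => vPT (n xs) (l xs) (t xs) (u xs)) := by unfold vPT; infer_instance
instance nt_vPF : NT m (fun xs => vPF (n xs) (l xs) (t xs) (u xs)) := by unfold vPF; infer_instance
end inst

/-- Tuples `c`, `c'` agree below `n`. -/
def Agree (n c c' : ℕ) : Prop := ∀ k, k < n → ∃ w, Nat.beta c k = w ∧ Nat.beta c' k = w
theorem n1_agree0 : N1 3 (fun xs => Agree (xs 0) (xs 1) (xs 2)) := by unfold Agree; infer_instance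
instance n1_agree {m : ℕ} (t u v : (Fin m → ℕ) → ℕ) [NT m t] [NT m u] [NT m v] :
    N1 m (fun xs => Agree (t xs) (u xs) (v xs)) := n1_app3 (P := Agree) n1_agree0 t u v

/-- Clauses for equality and order. -/
def KEq : Clauses := fun a b c d =>
  (∃ i, a = 1 ∧ b = 1 ∧ c = vEQ i i ∧ d = 0) ∨
  (∃ i j, a = vEQ i j ∧ b = 1 ∧ c = vEQ j i ∧ d = 0) ∨
  (∃ i j k, a = vEQ i j ∧ b = vEQ j k ∧ c = vEQ i k ∧ d = 0) ∨
  (∃ i j, a = vEQ i j ∧ b = 1 ∧ c = vEQ (isucc i) (isucc j) ∧ d = 0) ∨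
  (∃ i j k l, a = vEQ i j ∧ b = vEQ k l ∧ c = vEQ (iadd i k) (iadd j l) ∧ d = 0) ∨
  (∃ i j k l, a = vEQ i j ∧ b = vEQ k l ∧ c = vEQ (imul i k) (imul j l) ∧ d = 0) ∨
  (∃ i j k, a = vEQ i j ∧ b = vLE i k ∧ c = vLE j k ∧ d = 0) ∨
  (∃ i j k, a = vEQ i j ∧ b = vLE k i ∧ c = vLE k j ∧ d = 0)

/-- Clauses for values of terms. -/
def KVal : Clauses := fun a b c d =>
  (∃ j, a = 1 ∧ b = 1 ∧ c = vEQ (inum (j+1)) (isucc (inum j)) ∧ d = 0) ∨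
  (∃ k n e w, k < n ∧ Nat.beta e k = w ∧ a = 1 ∧ b = 1 ∧ c = vEQ (ival (tvar k) (pr n e)) w ∧ d = 0) ∨
  (∃ s, a = 1 ∧ b = 1 ∧ c = vEQ (ival tzero s) (inum 0) ∧ d = 0) ∨
  (∃ t s, a = 1 ∧ b = 1 ∧ c = vEQ (ival (tsucc t) s) (isucc (ival t s)) ∧ d = 0) ∨
  (∃ t u s, a = 1 ∧ b = 1 ∧ c = vEQ (ival (tadd t u) s) (iadd (ival t s) (ival u s)) ∧ d = 0) ∨
  (∃ t u s, a = 1 ∧ b = 1 ∧ c = vEQ (ival (tmul t u) s) (imul (ival t s) (ival u s)) ∧ d = 0)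

/-- Clauses for truth, part one. -/
def KTr : Clauses := fun a b c d =>
  (∃ s, a = vTR fbot s ∧ b = 1 ∧ c = 0 ∧ d = 0) ∨
  (∃ t u s, a = vTR (feq t u) s ∧ b = 1 ∧ c = vEQ (ival t s) (ival u s) ∧ d = 0) ∨
  (∃ t u s, a = vEQ (ival t s) (ival u s) ∧ b = 1 ∧ c = vTR (feq t u) s ∧ d = 0) ∨
  (∃ t u s, a = vTR (fle t u) s ∧ b = 1 ∧ c = vLE (ival t s) (ival u s) ∧ d = 0) ∨
  (∃ t u s, a = vLE (ival t s) (ival u s) ∧ b = 1 ∧ c = vTR (fle t u) s ∧ d = 0)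

/-- Clauses for truth, part two. -/
def KTr2 : Clauses := fun a b c d =>
  (∃ f g s, a = vTR (fimp f g) s ∧ b = vTR f s ∧ c = vTR g s ∧ d = 0) ∨
  (∃ f g s, a = 1 ∧ b = 1 ∧ c = vTR f s ∧ d = vTR (fimp f g) s) ∨
  (∃ f g s, a = vTR g s ∧ b = 1 ∧ c = vTR (fimp f g) s ∧ d = 0) ∨
  (∃ f n e e', Agree n e e' ∧ a = vTR (fall f) (pr n e) ∧ b = 1 ∧ c = vTR f (pr (n+1) e') ∧ d = 0) ∨
  (∃ f n e e', Agree n e e' ∧ Nat.beta e' n = iwit f (pr n e) ∧ a = vTR f (pr (n+1) e') ∧ b = 1 ∧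
    c = vTR (fall f) (pr n e) ∧ d = 0)

/-- Clauses for parsing terms. -/
def KPT : Clauses := fun a b c d =>
  (∃ n k l r, k < n ∧ Nat.pair (2*(2*k+1)) l = r ∧ a = 1 ∧ b = 1 ∧ c = vPT n (r+1) (tvar k) l ∧ d = 0) ∨
  (∃ n l r, Nat.pair 1 l = r ∧ a = 1 ∧ b = 1 ∧ c = vPT n (r+1) tzero l ∧ d = 0) ∨
  (∃ n l r l' t, Nat.pair 5 l = r ∧ a = vPT n l t l' ∧ b = 1 ∧ c = vPT n (r+1) (tsucc t) l' ∧ d = 0) ∨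
  (∃ n l r l' l'' t u, Nat.pair 13 l = r ∧ a = vPT n l t l' ∧ b = vPT n l' u l'' ∧
    c = vPT n (r+1) (tadd t u) l'' ∧ d = 0) ∨
  (∃ n l r l' l'' t u, Nat.pair 15 l = r ∧ a = vPT n l t l' ∧ b = vPT n l' u l'' ∧
    c = vPT n (r+1) (tmul t u) l'' ∧ d = 0)

/-- Clauses for parsing formulas, part one. -/
def KPF : Clauses := fun a b c d =>
  (∃ n l r, Nat.pair (2*(2*(n+2)+1)+1) l = r ∧ a = 1 ∧ b = 1 ∧ c = vPF n (r+1) fbot l ∧ d = 0) ∨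
  (∃ n l r l' l'' f g, Nat.pair 3 l = r ∧ a = vPF n l f l' ∧ b = vPF n l' g l'' ∧
    c = vPF n (r+1) (fimp f g) l'' ∧ d = 0) ∨
  (∃ n l r l' f, Nat.pair 7 l = r ∧ a = vPF (n+1) l f l' ∧ b = 1 ∧ c = vPF n (r+1) (fall f) l' ∧ d = 0)

/-- The list code of two terms followed by a list. -/
def Two (n x y l r : ℕ) : Prop := ∃ p q r', Nat.pair n x = p ∧ Nat.pair n y = q ∧
  Nat.pair (2*q) l = r' ∧ Nat.pair (2*p) (r'+1) = r

/-- Clauses for parsing formulas, part two. -/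
def KPF2 : Clauses := fun a b c d =>
  (∃ n x y l r t u, Two n x y l r ∧ a = vPT n x t 0 ∧ b = vPT n y u 0 ∧ c = vPF n (r+1) (feq t u) l ∧ d = 0) ∨
  (∃ n x y l r r1 r2 t u, Two n x y l r ∧ Nat.pair (2*(2*n+1)+1) (r+1) = r1 ∧ Nat.pair 25 (r1+1) = r2 ∧
    a = vPT n x t 0 ∧ b = vPT n y u 0 ∧ c = vPF n (r2+1) (fle t u) l ∧ d = 0)

theorem n1_two0 : N1 5 (fun xs => Two (xs 0) (xs 1) (xs 2) (xs 3) (xs 4)) := by unfold Two; infer_instance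
instance n1_two {m : ℕ} (a b c d e : (Fin m → ℕ) → ℕ) [NT m a] [NT m b] [NT m c] [NT m d] [NT m e] :
    N1 m (fun xs => Two (a xs) (b xs) (c xs) (d xs) (e xs)) :=
  n1_subst n1_two0 ![a, b, c, d, e] (hts := fun i => by fin_cases i <;> assumption)

/-- Clauses for axioms. -/
def KAx (A : ℕ → Prop) : Clauses := fun a b c d =>
  ∃ l f, A l ∧ a = vPF 0 l f 0 ∧ b = 1 ∧ c = vTR f (pr 0 0) ∧ d = 0

/-- The query clauses. -/
def KQ (F : ℕ) (x y : ℕ) : Clauses := fun a b c d =>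
  ∃ e, Nat.beta e 0 = inum x ∧ Nat.beta e 1 = inum y ∧ a = vTR F (pr 2 e) ∧ b = 1 ∧ c = 0 ∧ d = 0

/-- All clauses. -/
def KAll (A : ℕ → Prop) (F x y : ℕ) : Clauses := fun a b c d =>
  KEq a b c d ∨ KVal a b c d ∨ KTr a b c d ∨ KTr2 a b c d ∨ KPT a b c d ∨ KPF a b c d ∨ KPF2 a b c d ∨
  KAx A a b c d ∨ KQ F x y a b c d

set_option synthInstance.maxHeartbeats 2000000
set_option synthInstance.maxSize 4000
set_option maxHeartbeats 1000000

theorem n1_keq : N1 6 (fun xs => KEq (xs 2) (xs 3) (xs 4) (xs 5)) := by unfold KEq; infer_instance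
theorem n1_kval : N1 6 (fun xs => KVal (xs 2) (xs 3) (xs 4) (xs 5)) := by unfold KVal; infer_instance
theorem n1_ktr : N1 6 (fun xs => KTr (xs 2) (xs 3) (xs 4) (xs 5)) := by unfold KTr; infer_instance
theorem n1_ktr2 : N1 6 (fun xs => KTr2 (xs 2) (xs 3) (xs 4) (xs 5)) := by unfold KTr2; infer_instance
theorem n1_kpt : N1 6 (fun xs => KPT (xs 2) (xs 3) (xs 4) (xs 5)) := by unfold KPT; infer_instance
theorem n1_kpf : N1 6 (fun xs => KPF (xs 2) (xs 3) (xs 4) (xs 5)) := by unfold KPF; infer_instance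
theorem n1_kpf2 : N1 6 (fun xs => KPF2 (xs 2) (xs 3) (xs 4) (xs 5)) := by unfold KPF2; infer_instance
theorem n1_kax (A : ℕ → Prop) (hA : N1 1 (fun xs => A (xs 0))) :
    N1 6 (fun xs => KAx A (xs 2) (xs 3) (xs 4) (xs 5)) := by
  haveI : ∀ {m} (t : (Fin m → ℕ) → ℕ) [NT m t], N1 m (fun xs => A (t xs)) := fun t _ => n1_app1 hA t
  unfold KAx; infer_instance
theorem n1_kq (F : ℕ) : N1 6 (fun xs => KQ F (xs 0) (xs 1) (xs 2) (xs 3) (xs 4) (xs 5)) := by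
  unfold KQ; infer_instance

theorem n1_kall (A : ℕ → Prop) (hA : N1 1 (fun xs => A (xs 0))) (F : ℕ) :
    N1 6 (fun xs => KAll A F (xs 0) (xs 1) (xs 2) (xs 3) (xs 4) (xs 5)) := by
  haveI := n1_keq
  haveI := n1_kval
  haveI := n1_ktr
  haveI := n1_ktr2
  haveI := n1_kpt
  haveI := n1_kpf
  haveI := n1_kpf2
  haveI := n1_kax A hA
  haveI := n1_kq F
  unfold KAll
  infer_instance

end Codes

section Syn

/-- Symbols of term lists. -/
abbrev TSym (n : ℕ) := (Empty ⊕ Fin n) ⊕ (Σ i, LA.Functions i)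
/-- Symbols of formula lists. -/
abbrev FSym := (Σ k, LA.Term (Empty ⊕ Fin k)) ⊕ ((Σ n, LA.Relations n) ⊕ ℕ)

/-- Code of a term. -/
def cdt {n : ℕ} : LA.Term (Empty ⊕ Fin n) → ℕ
  | .var (Sum.inl e) => e.elim
  | .var (Sum.inr k) => tvar k
  | @Term.func _ _ 0 _ _ => tzero
  | @Term.func _ _ 1 _ ts => tsucc (cdt (ts 0))
  | @Term.func _ _ 2 f ts => cond (show Bool from f) (tmul (cdt (ts 0)) (cdt (ts 1))) (tadd (cdt (ts 0)) (cdt (ts 1)))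
  | @Term.func _ _ (_ + 3) f _ => (show Empty from f).elim

/-- Code of a formula. -/
def cd : {n : ℕ} → LA.BoundedFormula Empty n → ℕ
  | _, .falsum => fbot
  | _, .equal t u => feq (cdt t) (cdt u)
  | _, @BoundedFormula.rel _ _ _ 2 _ ts => fle (cdt (ts 0)) (cdt (ts 1))
  | _, @BoundedFormula.rel _ _ _ _ _ _ => 0
  | _, .imp f g => fimp (cd f) (cd g)
  | _, .all f => fall (cd f)

theorem enc_var {n : ℕ} (k : Fin n) (L : List (TSym n)) :
    Encodable.encode ((Sum.inl (Sum.inr k) : TSym n) :: L) = Nat.pair (2*(2*k+1)) (Encodable.encode L) + 1 := rfl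
theorem enc_zero {n : ℕ} (f) (L : List (TSym n)) :
    Encodable.encode ((Sum.inr ⟨0, f⟩ : TSym n) :: L) = Nat.pair 1 (Encodable.encode L) + 1 := rfl
theorem enc_succ {n : ℕ} (f) (L : List (TSym n)) :
    Encodable.encode ((Sum.inr ⟨1, f⟩ : TSym n) :: L) = Nat.pair 5 (Encodable.encode L) + 1 := rfl
theorem enc_add {n : ℕ} (L : List (TSym n)) :
    Encodable.encode ((Sum.inr ⟨2, (show LA.Functions 2 from false)⟩ : TSym n) :: L) = Nat.pair 13 (Encodable.encode L) + 1 := rfl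
theorem enc_mul {n : ℕ} (L : List (TSym n)) :
    Encodable.encode ((Sum.inr ⟨2, (show LA.Functions 2 from true)⟩ : TSym n) :: L) = Nat.pair 15 (Encodable.encode L) + 1 := rfl
theorem enc_term {n : ℕ} (t : LA.Term (Empty ⊕ Fin n)) (L : List FSym) :
    Encodable.encode ((Sum.inl ⟨n, t⟩ : FSym) :: L) =
      Nat.pair (2 * (Nat.pair n (Encodable.encode t.listEncode))) (Encodable.encode L) + 1 := rfl
theorem enc_le (f) (L : List FSym) :
    Encodable.encode ((Sum.inr (Sum.inl ⟨2, f⟩) : FSym) :: L) = Nat.pair 25 (Encodable.encode L) + 1 := rfl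
theorem enc_nat (k : ℕ) (L : List FSym) :
    Encodable.encode ((Sum.inr (Sum.inr k) : FSym) :: L) = Nat.pair (2*(2*k+1)+1) (Encodable.encode L) + 1 := rfl
theorem gnum_eq (φ : Snt) : gnum φ = Encodable.encode (BoundedFormula.listEncode φ : List FSym) := rfl

theorem le_zero {n : ℕ} (f : LA.Functions 0) (ts) : (Term.func f ts : LA.Term (Empty ⊕ Fin n)).listEncode = [Sum.inr ⟨0, f⟩] := rfl
theorem le_succ {n : ℕ} (f : LA.Functions 1) (ts) : (Term.func f ts : LA.Term (Empty ⊕ Fin n)).listEncode =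
    Sum.inr ⟨1, f⟩ :: (ts 0).listEncode := by
  simp [Term.listEncode, List.finRange_succ]
theorem le_bin {n : ℕ} (f : LA.Functions 2) (ts) : (Term.func f ts : LA.Term (Empty ⊕ Fin n)).listEncode =
    Sum.inr ⟨2, f⟩ :: ((ts 0).listEncode ++ (ts 1).listEncode) := by
  simp [Term.listEncode, List.finRange_succ]
theorem le_rel {n : ℕ} (f : LA.Relations 2) (ts) : (BoundedFormula.rel f ts : LA.BoundedFormula Empty n).listEncode =
    [Sum.inr (Sum.inl ⟨2, f⟩), Sum.inr (Sum.inr n), Sum.inl ⟨n, ts 0⟩, Sum.inl ⟨n, ts 1⟩] := by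
  simp [BoundedFormula.listEncode, List.finRange_succ]

theorem listEncode_inj {n m : ℕ} (φ : LA.BoundedFormula Empty n) (ψ : LA.BoundedFormula Empty m)
    (h : φ.listEncode = ψ.listEncode) : (⟨n, φ⟩ : Σ n, LA.BoundedFormula Empty n) = ⟨m, ψ⟩ :=
  BoundedFormula.encoding.encode_injective h

/-- Correct parses of terms. -/
def PTrel (n l t r : ℕ) : Prop := ∀ L' : List (TSym n), Encodable.encode L' = l →
  ∃ (τ : LA.Term (Empty ⊕ Fin n)) (L : List (TSym n)), L' = τ.listEncode ++ L ∧ t = cdt τ ∧ r = Encodable.encode L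
/-- Correct parses of formulas. -/
def PFrel (n l t r : ℕ) : Prop := ∀ L' : List FSym, Encodable.encode L' = l →
  ∃ (τ : LA.BoundedFormula Empty n) (L : List FSym), L' = τ.listEncode ++ L ∧ t = cd τ ∧ r = Encodable.encode L

theorem enc_list_zero {α : Type} [Encodable α] {L : List α} (h : 0 = Encodable.encode L) : L = [] := by
  cases L with
  | nil => rfl
  | cons a l => exact absurd h (by simp)

theorem enc_list_nil {α : Type} [Encodable α] : Encodable.encode ([] : List α) = 0 := rfl

theorem enc_cons {α : Type} [Encodable α] {L' : List α} {a l : ℕ} (h : Encodable.encode L' = Nat.pair a l + 1) :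
    ∃ x L, L' = x :: L ∧ Encodable.encode x = a ∧ Encodable.encode L = l := by
  cases L' with
  | nil => exact absurd h (by simp)
  | cons y L =>
    rw [Encodable.encode_list_cons, Nat.succ_inj, Nat.pair_eq_pair] at h
    exact ⟨y, L, rfl, h⟩

theorem enc_cons' {α : Type} [Encodable α] {L' : List α} {l : ℕ} (x : α)
    (h : Encodable.encode L' = Nat.pair (Encodable.encode x) l + 1) :
    ∃ L, L' = x :: L ∧ Encodable.encode L = l := by
  obtain ⟨y, L, rfl, h1, h2⟩ := enc_cons h
  rw [Encodable.encode_injective h1]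
  exact ⟨L, rfl, h2⟩

theorem term_le_inj {n : ℕ} {t u : LA.Term (Empty ⊕ Fin n)} (h : t.listEncode = u.listEncode) : t = u :=
  Term.encoding.encode_injective h

theorem enc_cons_term {L' : List FSym} {n x l : ℕ} (h : Encodable.encode L' = Nat.pair (2 * Nat.pair n x) l + 1) :
    ∃ (t : LA.Term (Empty ⊕ Fin n)) (L : List FSym), L' = Sum.inl ⟨n, t⟩ :: L ∧
      Encodable.encode t.listEncode = x ∧ Encodable.encode L = l := by
  obtain ⟨y, L, rfl, h1, h2⟩ := enc_cons h
  rcases y with ⟨k, t⟩ | y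
  · have h3 : 2 * Nat.pair k (Encodable.encode t.listEncode) = 2 * Nat.pair n x := h1
    rw [Nat.mul_right_inj (by norm_num), Nat.pair_eq_pair] at h3
    obtain ⟨rfl, h4⟩ := h3
    exact ⟨t, L, rfl, h4, h2⟩
  · have h3 : 2 * Encodable.encode y + 1 = 2 * Nat.pair n x := h1
    omega

end Syn

section Sound
variable {M : Type} [PAM M]

/-- Value of a term code. -/
def evT (e : ℕ → M) (c : ℕ) : M :=
  if h : c = 0 then 0 else
    have := da_lt h
    have := db_lt h
    if dt c = 0 then e (da c)
    else if dt c = 1 then 0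
    else if dt c = 2 then evT e (da c) + 1
    else if dt c = 3 then evT e (da c) + evT e (db c)
    else evT e (da c) * evT e (db c)
termination_by c

/-- Truth of a formula code. -/
def ev (c : ℕ) (n : ℕ) (e : ℕ → M) : Prop :=
  if h : c = 0 then False else
    have := da_lt h
    have := db_lt h
    if dt c = 0 then False
    else if dt c = 1 then evT e (da c) = evT e (db c)
    else if dt c = 2 then evT e (da c) ≤ evT e (db c)
    else if dt c = 3 then (ev (da c) n e → ev (db c) n e)
    else ∀ x, ev (da c) (n+1) (Function.update e n x)
termination_by c

/-- One step in the evaluation of element codes. -/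
noncomputable def valF (g : ℕ → M) (c : ℕ) : M :=
  if dt c = 0 then ((da c : ℕ) : M)
  else if dt c = 1 then g (da c) + 1
  else if dt c = 2 then g (da c) + g (db c)
  else if dt c = 3 then g (da c) * g (db c)
  else if dt c = 4 then evT (fun k => if k < d1 (db c) then g (Nat.beta (d2 (db c)) k) else 0) (da c)
  else Classical.epsilon (fun x => ¬ ev (da c) (d1 (db c) + 1) (Function.update
    (fun k => if k < d1 (db c) then g (Nat.beta (d2 (db c)) k) else 0) (d1 (db c)) x))

/-- Value of an element code. -/
noncomputable def val (M : Type) [PAM M] (c : ℕ) : M :=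
  valF (fun d => if d < c then val M d else 0) c
termination_by c

theorem beta_lt {c : ℕ} (h : c ≠ 0) (k : ℕ) : Nat.beta (d2 (db c)) k < c :=
  ((beta_le (d2 (db c)) k).trans (d2_le (db c))).trans_lt (db_lt h)

theorem val_eq {c : ℕ} (h : c ≠ 0) : val M c = valF (val M) c := by
  rw [val]
  unfold valF
  simp only [da_lt h, db_lt h, beta_lt h, if_true]

/-- Environment of an environment code. -/
noncomputable def envOf (M : Type) [PAM M] (s : ℕ) : ℕ → M :=
  fun k => if k < d1 s then val M (Nat.beta (d2 s) k) else 0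

@[simp] theorem evT_tvar (e : ℕ → M) (k) : evT e (tvar k) = e k := by rw [evT]; simp [tvar]
@[simp] theorem evT_tzero (e : ℕ → M) : evT e tzero = 0 := by rw [evT]; simp [tzero]
@[simp] theorem evT_tsucc (e : ℕ → M) (t) : evT e (tsucc t) = evT e t + 1 := by rw [evT]; simp [tsucc]
@[simp] theorem evT_tadd (e : ℕ → M) (t u) : evT e (tadd t u) = evT e t + evT e u := by rw [evT]; simp [tadd]
@[simp] theorem evT_tmul (e : ℕ → M) (t u) : evT e (tmul t u) = evT e t * evT e u := by rw [evT]; simp [tmul]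

@[simp] theorem ev_fbot (n) (e : ℕ → M) : ¬ ev fbot n e := by rw [ev]; simp [fbot]
@[simp] theorem ev_feq (n) (e : ℕ → M) (t u) : ev (feq t u) n e ↔ evT e t = evT e u := by rw [ev]; simp [feq]
@[simp] theorem ev_fle (n) (e : ℕ → M) (t u) : ev (fle t u) n e ↔ evT e t ≤ evT e u := by rw [ev]; simp [fle]
@[simp] theorem ev_fimp (n) (e : ℕ → M) (t u) : ev (fimp t u) n e ↔ (ev t n e → ev u n e) := by rw [ev]; simp [fimp]
@[simp] theorem ev_fall (n) (e : ℕ → M) (t) : ev (fall t) n e ↔ ∀ x, ev t (n+1) (Function.update e n x) := by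
  rw [ev]; simp [fall]

@[simp] theorem val_inum (k) : val M (inum k) = (k : M) := by unfold inum; rw [val_eq (mk_ne_zero _ _ _)]; simp [valF]
@[simp] theorem val_isucc (k) : val M (isucc k) = val M k + 1 := by unfold isucc; rw [val_eq (mk_ne_zero _ _ _)]; simp [valF]
@[simp] theorem val_iadd (k l) : val M (iadd k l) = val M k + val M l := by unfold iadd; rw [val_eq (mk_ne_zero _ _ _)]; simp [valF]
@[simp] theorem val_imul (k l) : val M (imul k l) = val M k * val M l := by unfold imul; rw [val_eq (mk_ne_zero _ _ _)]; simp [valF]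
@[simp] theorem val_ival (k s) : val M (ival k s) = evT (envOf M s) k := by unfold ival; rw [val_eq (mk_ne_zero _ _ _)]; simp [valF]; rfl
theorem val_iwit (f s) : val M (iwit f s) =
    Classical.epsilon (fun x => ¬ ev f (d1 s + 1) (Function.update (envOf M s) (d1 s) x)) := by
  unfold iwit; rw [val_eq (mk_ne_zero _ _ _)]; simp [valF]; rfl

theorem envOf_upd (n e e' : ℕ) (h : Agree n e e') :
    envOf M (pr (n+1) e') = Function.update (envOf M (pr n e)) n (val M (Nat.beta e' n)) := by
  funext k
  unfold envOf
  simp only [d1_pr, d2_pr]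
  rcases lt_trichotomy k n with hk | rfl | hk
  · rw [Function.update_of_ne hk.ne, if_pos (by omega), if_pos hk]
    obtain ⟨w, h1, h2⟩ := h k hk
    rw [h1, h2]
  · rw [Function.update_self, if_pos (by omega)]
  · rw [Function.update_of_ne hk.ne', if_neg (by omega), if_neg (by omega)]

theorem evT_cdt {n : ℕ} (t : LA.Term (Empty ⊕ Fin n)) (e : ℕ → M) :
    t.realize (Sum.elim default (fun k : Fin n => e k)) = evT e (cdt t) := by
  induction t with
  | var a =>
    rcases a with a | k
    · exact a.elim
    · simp [cdt]
  | @func m f ts ih =>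
    match m, f, ts, ih with
    | 0, f, ts, ih => simp only [cdt, evT_tzero]; exact rz_eq
    | 1, f, ts, ih =>
      simp only [cdt, evT_tsucc, ← ih]; exact rs_eq _
    | 2, f, ts, ih =>
      match f with
      | false => 
        change _ = evT e (tadd _ _)
        simp only [evT_tadd, ← ih]; exact ra_eq _ _
      | true =>
        change _ = evT e (tmul _ _)
        simp only [evT_tmul, ← ih]; exact rm_eq _ _

theorem ev_cd {n : ℕ} (φ : LA.BoundedFormula Empty n) : ∀ (e : ℕ → M),
    φ.Realize default (fun k : Fin n => e k) ↔ ev (cd φ) n e := by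
  induction φ with
  | falsum => intro e; simp [cd, BoundedFormula.Realize]
  | equal t u => intro e; simp [cd, BoundedFormula.Realize, evT_cdt]
  | @rel n m R ts =>
    intro e
    match m, R, ts with
    | 2, R, ts =>
      simp only [cd, ev_fle, ← evT_cdt]
      exact rl_eq _ _
  | imp f g ih1 ih2 => intro e; simp [cd, BoundedFormula.Realize, ih1, ih2]
  | @all n f ih =>
    intro e
    simp only [cd, ev_fall, BoundedFormula.Realize]
    refine forall_congr' fun x => ?_
    rw [← ih]
    have : (Fin.snoc (fun k : Fin n => e k) x : Fin (n+1) → M) = fun k : Fin (n+1) => Function.update e n x k := by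
      funext k
      refine Fin.lastCases ?_ (fun k => ?_) k
      · simp
      · simp [Function.update_of_ne (Nat.ne_of_lt k.2)]
    rw [this]
end Sound

section Sound2
variable {M : Type} [PAM M]

/-- The intended interpretation of the propositional variables. -/
def TV (M : Type) [PAM M] (c : ℕ) : Prop :=
  c = 1 ∨ (2 ≤ c ∧
    ((dt c = 1 ∧ ev (da c) (d1 (db c)) (envOf M (db c))) ∨
     (dt c = 2 ∧ val M (da c) = val M (db c)) ∨
     (dt c = 3 ∧ val M (da c) ≤ val M (db c)) ∨
     (dt c = 4 ∧ PTrel (d1 (da c)) (d2 (da c)) (d1 (db c)) (d2 (db c))) ∨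
     (dt c = 5 ∧ PFrel (d1 (da c)) (d2 (da c)) (d1 (db c)) (d2 (db c)))))

theorem two_le_mk (a b c : ℕ) : 2 ≤ mk a b c := by unfold mk; omega

@[simp] theorem TV_zero : ¬ TV M 0 := by simp [TV]
@[simp] theorem TV_one : TV M 1 := Or.inl rfl
@[simp] theorem TV_vTR (f s) : TV M (vTR f s) ↔ ev f (d1 s) (envOf M s) := by
  simp [TV, vTR, two_le_mk]
@[simp] theorem TV_vEQ (f s) : TV M (vEQ f s) ↔ val M f = val M s := by
  simp [TV, vEQ, two_le_mk]
@[simp] theorem TV_vLE (f s) : TV M (vLE f s) ↔ val M f ≤ val M s := by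
  simp [TV, vLE, two_le_mk]
@[simp] theorem TV_vPT (n l t r) : TV M (vPT n l t r) ↔ PTrel n l t r := by
  simp [TV, vPT, two_le_mk]
@[simp] theorem TV_vPF (n l t r) : TV M (vPF n l t r) ↔ PFrel n l t r := by
  simp [TV, vPF, two_le_mk]

/-- A clause holds under the intended interpretation. -/
def Ok (M : Type) [PAM M] (a b c d : ℕ) : Prop := TV M a → TV M b → TV M c ∨ TV M d

theorem ok_eq (a b c d : ℕ) (h : KEq a b c d) : Ok M a b c d := by
  unfold Ok
  rcases h with ⟨i, rfl, rfl, rfl, rfl⟩ | ⟨i, j, rfl, rfl, rfl, rfl⟩ | ⟨i, j, k, rfl, rfl, rfl, rfl⟩ |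
    ⟨i, j, rfl, rfl, rfl, rfl⟩ | ⟨i, j, k, l, rfl, rfl, rfl, rfl⟩ | ⟨i, j, k, l, rfl, rfl, rfl, rfl⟩ |
    ⟨i, j, k, rfl, rfl, rfl, rfl⟩ | ⟨i, j, k, rfl, rfl, rfl, rfl⟩
  all_goals simp +contextual

theorem ok_val (a b c d : ℕ) (h : KVal a b c d) : Ok M a b c d := by
  unfold Ok
  rcases h with ⟨i, rfl, rfl, rfl, rfl⟩ | ⟨k, n, e, w, hk, rfl, rfl, rfl, rfl, rfl⟩ | ⟨i, rfl, rfl, rfl, rfl⟩ |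
    ⟨i, j, rfl, rfl, rfl, rfl⟩ | ⟨i, j, k, rfl, rfl, rfl, rfl⟩ | ⟨i, j, k, rfl, rfl, rfl, rfl⟩
  · simp
  · simp [envOf, hk]
  all_goals simp

theorem ok_tr (a b c d : ℕ) (h : KTr a b c d) : Ok M a b c d := by
  unfold Ok
  rcases h with ⟨i, rfl, rfl, rfl, rfl⟩ | ⟨i, j, k, rfl, rfl, rfl, rfl⟩ | ⟨i, j, k, rfl, rfl, rfl, rfl⟩ |
    ⟨i, j, k, rfl, rfl, rfl, rfl⟩ | ⟨i, j, k, rfl, rfl, rfl, rfl⟩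
  all_goals simp

theorem ok_tr2 (a b c d : ℕ) (h : KTr2 a b c d) : Ok M a b c d := by
  unfold Ok
  rcases h with ⟨i, j, k, rfl, rfl, rfl, rfl⟩ | ⟨i, j, k, rfl, rfl, rfl, rfl⟩ | ⟨i, j, k, rfl, rfl, rfl, rfl⟩ |
    ⟨f, n, e, e', hA, rfl, rfl, rfl, rfl⟩ | ⟨f, n, e, e', hA, hw, rfl, rfl, rfl, rfl⟩
  · simp +contextual
  · simp; tauto
  · simp +contextual
  · simp only [TV_vTR, d1_pr, ev_fall, TV_zero, or_false]
    intro h _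
    rw [envOf_upd n e e' hA]
    exact h _
  · simp only [TV_vTR, d1_pr, ev_fall, TV_zero, or_false]
    intro h _ x
    rw [envOf_upd n e e' hA, hw, val_iwit] at h
    by_contra hx
    have := Classical.epsilon_spec (p := fun x => ¬ ev f (n + 1) (Function.update (envOf M (pr n e)) n x)) ⟨x, hx⟩
    simp only [d1_pr] at h
    exact this h

theorem ok_pt (a b c d : ℕ) (h : KPT a b c d) : Ok M a b c d := by
  unfold Ok
  rcases h with ⟨n, k, l, r, hk, rfl, rfl, rfl, rfl, rfl⟩ | ⟨n, l, r, rfl, rfl, rfl, rfl, rfl⟩ |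
    ⟨n, l, r, l', t, rfl, rfl, rfl, rfl, rfl⟩ | ⟨n, l, r, l', l'', t, u, rfl, rfl, rfl, rfl, rfl⟩ |
    ⟨n, l, r, l', l'', t, u, rfl, rfl, rfl, rfl, rfl⟩
  all_goals simp only [TV_vPT, TV_one, TV_zero, or_false, forall_true_left, true_implies]
  · intro L' hL
    obtain ⟨L, rfl, h⟩ := enc_cons' (Sum.inl (Sum.inr ⟨k, hk⟩) : TSym n) hL
    exact ⟨.var (Sum.inr ⟨k, hk⟩), L, rfl, rfl, h.symm⟩
  · intro L' hL
    obtain ⟨L, rfl, h⟩ := enc_cons' (Sum.inr ⟨0, (show LA.Functions 0 from Unit.unit)⟩ : TSym n) hL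
    exact ⟨.func (show LA.Functions 0 from Unit.unit) ![], L, rfl, rfl, h.symm⟩
  · intro H L' hL
    obtain ⟨L, rfl, h⟩ := enc_cons' (Sum.inr ⟨1, (show LA.Functions 1 from Unit.unit)⟩ : TSym n) hL
    obtain ⟨τ, L2, rfl, rfl, h2⟩ := H L h
    exact ⟨.func (show LA.Functions 1 from Unit.unit) ![τ], L2, by rw [le_succ]; rfl, rfl, h2⟩
  · intro H H' L' hL
    obtain ⟨L, rfl, h⟩ := enc_cons' (Sum.inr ⟨2, (show LA.Functions 2 from false)⟩ : TSym n) hL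
    obtain ⟨τ, L2, rfl, rfl, h2⟩ := H L h
    obtain ⟨τ', L3, rfl, rfl, h3⟩ := H' L2 h2.symm
    exact ⟨.func (show LA.Functions 2 from false) ![τ, τ'], L3, by
      rw [le_bin]; simp, rfl, h3⟩
  · intro H H' L' hL
    obtain ⟨L, rfl, h⟩ := enc_cons' (Sum.inr ⟨2, (show LA.Functions 2 from true)⟩ : TSym n) hL
    obtain ⟨τ, L2, rfl, rfl, h2⟩ := H L h
    obtain ⟨τ', L3, rfl, rfl, h3⟩ := H' L2 h2.symm
    exact ⟨.func (show LA.Functions 2 from true) ![τ, τ'], L3, by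
      rw [le_bin]; simp, rfl, h3⟩

theorem ok_pf (a b c d : ℕ) (h : KPF a b c d) : Ok M a b c d := by
  unfold Ok
  rcases h with ⟨n, l, r, rfl, rfl, rfl, rfl, rfl⟩ | ⟨n, l, r, l', l'', t, u, rfl, rfl, rfl, rfl, rfl⟩ |
    ⟨n, l, r, l', t, rfl, rfl, rfl, rfl, rfl⟩
  all_goals simp only [TV_vPF, TV_one, TV_zero, or_false, forall_true_left, true_implies]
  · intro L' hL
    obtain ⟨L, rfl, h⟩ := enc_cons' (Sum.inr (Sum.inr (n+2)) : FSym) hL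
    exact ⟨.falsum, L, rfl, rfl, h.symm⟩
  · intro H H' L' hL
    obtain ⟨L, rfl, h⟩ := enc_cons' (Sum.inr (Sum.inr 0) : FSym) hL
    obtain ⟨τ, L2, rfl, rfl, h2⟩ := H L h
    obtain ⟨τ', L3, rfl, rfl, h3⟩ := H' L2 h2.symm
    exact ⟨.imp τ τ', L3, by simp [BoundedFormula.listEncode], rfl, h3⟩
  · intro H L' hL
    obtain ⟨L, rfl, h⟩ := enc_cons' (Sum.inr (Sum.inr 1) : FSym) hL
    obtain ⟨τ, L2, rfl, rfl, h2⟩ := H L h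
    exact ⟨.all τ, L2, by simp [BoundedFormula.listEncode], rfl, h2⟩

theorem two_sound {n x y l r t u : ℕ} (h : Two n x y l r) (h1 : PTrel n x t 0) (h2 : PTrel n y u 0)
    (L' : List FSym) (hL : Encodable.encode L' = r + 1) :
    ∃ (τ τ' : LA.Term (Empty ⊕ Fin n)) (L : List FSym), L' = Sum.inl ⟨n, τ⟩ :: Sum.inl ⟨n, τ'⟩ :: L ∧
      t = cdt τ ∧ u = cdt τ' ∧ l = Encodable.encode L := by
  obtain ⟨p, q, r', rfl, rfl, rfl, rfl⟩ := h
  obtain ⟨τ, L, rfl, h3, h4⟩ := enc_cons_term hL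
  obtain ⟨τ', L2, rfl, h5, h6⟩ := enc_cons_term h4
  obtain ⟨σ, K, h7, rfl, h8⟩ := h1 _ h3
  obtain ⟨σ', K', h9, rfl, h10⟩ := h2 _ h5
  rw [enc_list_zero h8, List.append_nil] at h7
  rw [enc_list_zero h10, List.append_nil] at h9
  exact ⟨τ, τ', L2, rfl, by rw [term_le_inj h7], by rw [term_le_inj h9], h6.symm⟩

theorem ok_pf2 (a b c d : ℕ) (h : KPF2 a b c d) : Ok M a b c d := by
  unfold Ok
  rcases h with ⟨n, x, y, l, r, t, u, h2, rfl, rfl, rfl, rfl⟩ |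
    ⟨n, x, y, l, r, r1, r2, t, u, h2, rfl, rfl, rfl, rfl, rfl, rfl⟩
  all_goals simp only [TV_vPF, TV_vPT, TV_one, TV_zero, or_false, forall_true_left, true_implies]
  · intro H H' L' hL
    obtain ⟨τ, τ', L, rfl, h3, h4, h5⟩ := two_sound h2 H H' L' hL
    exact ⟨.equal τ τ', L, rfl, by rw [h3, h4]; rfl, h5⟩
  · intro H H' L' hL
    obtain ⟨L1, rfl, h⟩ := enc_cons' (Sum.inr (Sum.inl ⟨2, (show LA.Relations 2 from Unit.unit)⟩) : FSym) hL
    obtain ⟨L2, rfl, h'⟩ := enc_cons' (Sum.inr (Sum.inr n) : FSym) h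
    obtain ⟨τ, τ', L, rfl, h3, h4, h5⟩ := two_sound h2 H H' L2 h'
    exact ⟨.rel (show LA.Relations 2 from Unit.unit) ![τ, τ'], L, by rw [le_rel]; rfl, by rw [h3, h4]; rfl, h5⟩

theorem ok_ax (T : Thy) (hM : M ⊨ T) (a b c d : ℕ) (h : KAx (fun l => ∃ φ ∈ T, gnum φ = l) a b c d) :
    Ok M a b c d := by
  unfold Ok
  obtain ⟨l, f, ⟨φ, hφ, rfl⟩, rfl, rfl, rfl, rfl⟩ := h
  simp only [TV_vPF, TV_vTR, TV_one, TV_zero, or_false, d1_pr]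
  intro H _
  obtain ⟨τ, L, h1, rfl, h2⟩ := H (BoundedFormula.listEncode φ) rfl
  rw [enc_list_zero h2, List.append_nil] at h1
  have h3 := listEncode_inj _ _ h1
  simp only [Sigma.mk.injEq, heq_eq_eq, true_and] at h3
  subst h3
  rw [← ev_cd]
  have := hM.realize_of_mem φ hφ
  have e : (fun k : Fin 0 => envOf M (pr 0 0) k) = default := Subsingleton.elim _ _
  rw [e]
  exact this

theorem ok_q (φ : LA.BoundedFormula Empty 2) (x y : ℕ)
    (hM : ¬ φ.Realize default (fun i : Fin 2 => ((![x, y] i : ℕ) : M))) (a b c d : ℕ)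
    (h : KQ (cd φ) x y a b c d) : Ok M a b c d := by
  unfold Ok
  obtain ⟨e, h1, h2, rfl, rfl, rfl, rfl⟩ := h
  simp only [TV_vTR, TV_one, TV_zero, or_false, d1_pr]
  intro H _
  rw [← ev_cd] at H
  apply hM
  convert H using 2 with i
  match i with
  | 0 => simp [envOf, h1]
  | 1 => simp [envOf, h2]

theorem good_of_model (T : Thy) (hM : M ⊨ T) (φ : LA.BoundedFormula Empty 2) (x y : ℕ)
    (hφ : ¬ φ.Realize default (fun i : Fin 2 => ((![x, y] i : ℕ) : M))) :
    ∃ v, GoodVal (KAll (fun l => ∃ φ ∈ T, gnum φ = l) (cd φ) x y) v := by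
  classical
  refine ⟨fun c => decide (TV M c), by simp, by simp, fun a b c d h => ?_⟩
  simp only [decide_eq_true_eq]
  change Ok M a b c d
  rcases h with h | h | h | h | h | h | h | h | h
  · exact ok_eq _ _ _ _ h
  · exact ok_val _ _ _ _ h
  · exact ok_tr _ _ _ _ h
  · exact ok_tr2 _ _ _ _ h
  · exact ok_pt _ _ _ _ h
  · exact ok_pf _ _ _ _ h
  · exact ok_pf2 _ _ _ _ h
  · exact ok_ax T hM _ _ _ _ h
  · exact ok_q φ x y hφ _ _ _ _ h
end Sound2

section Compl

theorem gv_cl {A : ℕ → Prop} {F x y : ℕ} {v : ℕ → Bool}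
    (hv : GoodVal (KAll A F x y) v) {a b c : ℕ} (h : KAll A F x y a b c 0) (ha : v a = true) (hb : v b = true) : v c = true := by
  rcases hv.2.2 _ _ _ _ h ha hb with h | h
  · exact h
  · rw [hv.1] at h; cases h

theorem gv_eq {A : ℕ → Prop} {F x y : ℕ} {v : ℕ → Bool}
    (hv : GoodVal (KAll A F x y) v) {a b c : ℕ} (h : KEq a b c 0) (ha : v a = true) (hb : v b = true) : v c = true :=
  gv_cl hv (Or.inl h) ha hb
theorem gv_val {A : ℕ → Prop} {F x y : ℕ} {v : ℕ → Bool}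
    (hv : GoodVal (KAll A F x y) v) {c : ℕ} (h : KVal 1 1 c 0) : v c = true :=
  gv_cl hv (Or.inr (Or.inl h)) hv.2.1 hv.2.1
theorem gv_tr {A : ℕ → Prop} {F x y : ℕ} {v : ℕ → Bool}
    (hv : GoodVal (KAll A F x y) v) {a c : ℕ} (h : KTr a 1 c 0) (ha : v a = true) : v c = true :=
  gv_cl hv (Or.inr (Or.inr (Or.inl h))) ha hv.2.1
theorem gv_tr2 {A : ℕ → Prop} {F x y : ℕ} {v : ℕ → Bool}
    (hv : GoodVal (KAll A F x y) v) {a b c : ℕ} (h : KTr2 a b c 0) (ha : v a = true) (hb : v b = true) : v c = true :=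
  gv_cl hv (Or.inr (Or.inr (Or.inr (Or.inl h)))) ha hb
theorem gv_pt {A : ℕ → Prop} {F x y : ℕ} {v : ℕ → Bool}
    (hv : GoodVal (KAll A F x y) v) {a b c : ℕ} (h : KPT a b c 0) (ha : v a = true) (hb : v b = true) : v c = true :=
  gv_cl hv (Or.inr (Or.inr (Or.inr (Or.inr (Or.inl h))))) ha hb
theorem gv_pf {A : ℕ → Prop} {F x y : ℕ} {v : ℕ → Bool}
    (hv : GoodVal (KAll A F x y) v) {a b c : ℕ} (h : KPF a b c 0) (ha : v a = true) (hb : v b = true) : v c = true :=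
  gv_cl hv (Or.inr (Or.inr (Or.inr (Or.inr (Or.inr (Or.inl h)))))) ha hb
theorem gv_pf2 {A : ℕ → Prop} {F x y : ℕ} {v : ℕ → Bool}
    (hv : GoodVal (KAll A F x y) v) {a b c : ℕ} (h : KPF2 a b c 0) (ha : v a = true) (hb : v b = true) : v c = true :=
  gv_cl hv (Or.inr (Or.inr (Or.inr (Or.inr (Or.inr (Or.inr (Or.inl h))))))) ha hb
theorem gv_ax {A : ℕ → Prop} {F x y : ℕ} {v : ℕ → Bool}
    (hv : GoodVal (KAll A F x y) v) {a c : ℕ} (h : KAx A a 1 c 0) (ha : v a = true) : v c = true :=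
  gv_cl hv (Or.inr (Or.inr (Or.inr (Or.inr (Or.inr (Or.inr (Or.inr (Or.inl h)))))))) ha hv.2.1
theorem gv_q {A : ℕ → Prop} {F x y : ℕ} {v : ℕ → Bool}
    (hv : GoodVal (KAll A F x y) v) {a : ℕ} (h : KQ F x y a 1 0 0) : v a ≠ true := by
  intro ha
  have := gv_cl hv (Or.inr (Or.inr (Or.inr (Or.inr (Or.inr (Or.inr (Or.inr (Or.inr h)))))))) ha hv.2.1
  rw [hv.1] at this; cases this

/-- Equality on the Henkin domain. -/
def hset {A : ℕ → Prop} {F x y : ℕ} {v : ℕ → Bool}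
    (hv : GoodVal (KAll A F x y) v) : Setoid ℕ where
  r i j := v (vEQ i j) = true
  iseqv := {
    refl := fun i => gv_eq hv (Or.inl ⟨i, rfl, rfl, rfl, rfl⟩) hv.2.1 hv.2.1
    symm := fun {i j} h => gv_eq hv (Or.inr (Or.inl ⟨i, j, rfl, rfl, rfl, rfl⟩)) h hv.2.1
    trans := fun {i j k} h h' => gv_eq hv (Or.inr (Or.inr (Or.inl ⟨i, j, k, rfl, rfl, rfl, rfl⟩))) h h' }

/-- The Henkin model. -/
abbrev HM {A : ℕ → Prop} {F x y : ℕ} {v : ℕ → Bool}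
    (hv : GoodVal (KAll A F x y) v) : Type := Quotient (hset hv)

/-- Class of an element code. -/
def hq {A : ℕ → Prop} {F x y : ℕ} {v : ℕ → Bool}
    (hv : GoodVal (KAll A F x y) v) (i : ℕ) : HM hv := Quotient.mk (hset hv) i

theorem hq_eq {A : ℕ → Prop} {F x y : ℕ} {v : ℕ → Bool}
    (hv : GoodVal (KAll A F x y) v) {i j : ℕ} : hq hv i = hq hv j ↔ v (vEQ i j) = true := Quotient.eq (r := hset hv)

/-- Successor. -/
def hs {A : ℕ → Prop} {F x y : ℕ} {v : ℕ → Bool}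
    (hv : GoodVal (KAll A F x y) v) : HM hv → HM hv := Quotient.map isucc (fun i j h =>
  gv_eq hv (Or.inr (Or.inr (Or.inr (Or.inl ⟨i, j, rfl, rfl, rfl, rfl⟩)))) h hv.2.1)
/-- Addition. -/
def ha {A : ℕ → Prop} {F x y : ℕ} {v : ℕ → Bool}
    (hv : GoodVal (KAll A F x y) v) : HM hv → HM hv → HM hv := Quotient.map₂ iadd (fun i j h k l h' =>
  gv_eq hv (Or.inr (Or.inr (Or.inr (Or.inr (Or.inl ⟨i, j, k, l, rfl, rfl, rfl, rfl⟩))))) h h')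
/-- Multiplication. -/
def hm {A : ℕ → Prop} {F x y : ℕ} {v : ℕ → Bool}
    (hv : GoodVal (KAll A F x y) v) : HM hv → HM hv → HM hv := Quotient.map₂ imul (fun i j h k l h' =>
  gv_eq hv (Or.inr (Or.inr (Or.inr (Or.inr (Or.inr (Or.inl ⟨i, j, k, l, rfl, rfl, rfl, rfl⟩)))))) h h')
/-- Order. -/
def hl {A : ℕ → Prop} {F x y : ℕ} {v : ℕ → Bool}
    (hv : GoodVal (KAll A F x y) v) : HM hv → HM hv → Prop := Quotient.lift₂ (fun i j => v (vLE i j) = true) (by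
  have key : ∀ i k j l, v (vEQ i j) = true → v (vEQ k l) = true → v (vLE i k) = true → v (vLE j l) = true := by
    intro i k j l h h' hl
    have h1 := gv_eq hv (Or.inr (Or.inr (Or.inr (Or.inr (Or.inr (Or.inr (Or.inl ⟨i, j, k, rfl, rfl, rfl, rfl⟩))))))) h hl
    exact gv_eq hv (Or.inr (Or.inr (Or.inr (Or.inr (Or.inr (Or.inr (Or.inr ⟨k, l, j, rfl, rfl, rfl, rfl⟩))))))) h' h1
  intro i k j l h h'
  exact propext ⟨key _ _ _ _ h h', key _ _ _ _ ((hset hv).symm h) ((hset hv).symm h')⟩)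

/-- The structure of the Henkin model. -/
def hstr {A : ℕ → Prop} {F x y : ℕ} {v : ℕ → Bool}
    (hv : GoodVal (KAll A F x y) v) : LA.Structure (HM hv) where
  funMap := fun {n} f w => match n, f, w with
    | 0, _, _ => hq hv (inum 0)
    | 1, _, w => hs hv (w 0)
    | 2, f, w => match (show Bool from f) with
      | false => ha hv (w 0) (w 1)
      | true => hm hv (w 0) (w 1)
    | (_+3), f, _ => (show Empty from f).elim
  RelMap := fun {n} r w => match n, r, w with
    | 0, r, _ => (show Empty from r).elim
    | 1, r, _ => (show Empty from r).elim
    | 2, _, w => hl hv (w 0) (w 1)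
    | (_+3), r, _ => (show Empty from r).elim

theorem h_term {A : ℕ → Prop} {F x y : ℕ} {v : ℕ → Bool}
    (hv : GoodVal (KAll A F x y) v) {n : ℕ} (t : LA.Term (Empty ⊕ Fin n)) (e : ℕ) :
    letI := hstr hv
    t.realize (Sum.elim default (fun k : Fin n => hq hv (Nat.beta e k))) = hq hv (ival (cdt t) (pr n e)) := by
  letI := hstr hv
  induction t with
  | var a =>
    rcases a with a | k
    · exact a.elim
    · exact Eq.symm ((hq_eq hv).2 (gv_val hv (Or.inr (Or.inl ⟨k, n, e, _, k.2, rfl, rfl, rfl, rfl, rfl⟩))))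
  | @func m f ts ih =>
    match m, f, ts, ih with
    | 0, f, ts, ih =>
      exact Eq.symm ((hq_eq hv).2 (gv_val hv (Or.inr (Or.inr (Or.inl ⟨_, rfl, rfl, rfl, rfl⟩)))))
    | 1, f, ts, ih =>
      refine Eq.trans ?_ (Eq.symm ((hq_eq hv).2
        (gv_val hv (Or.inr (Or.inr (Or.inr (Or.inl ⟨_, _, rfl, rfl, rfl, rfl⟩)))))))
      change hs hv ((ts 0).realize _) = _
      rw [ih]; rfl
    | 2, f, ts, ih =>
      match f with
      | false =>
        refine Eq.trans ?_ (Eq.symm ((hq_eq hv).2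
          (gv_val hv (Or.inr (Or.inr (Or.inr (Or.inr (Or.inl ⟨_, _, _, rfl, rfl, rfl, rfl⟩))))))))
        change ha hv ((ts 0).realize _) ((ts 1).realize _) = _
        rw [ih, ih]; rfl
      | true =>
        refine Eq.trans ?_ (Eq.symm ((hq_eq hv).2
          (gv_val hv (Or.inr (Or.inr (Or.inr (Or.inr (Or.inr ⟨_, _, _, rfl, rfl, rfl, rfl⟩))))))))
        change hm hv ((ts 0).realize _) ((ts 1).realize _) = _
        rw [ih, ih]; rfl

theorem agree_ext {A : ℕ → Prop} {F x y : ℕ} {v : ℕ → Bool}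
    (hv : GoodVal (KAll A F x y) v) (n e z : ℕ) : ∃ e', Agree n e e' ∧ Nat.beta e' n = z := by
  obtain ⟨c, hc⟩ := beta_exists (fun k => if k < n then Nat.beta e k else z) n
  refine ⟨c, fun k hk => ⟨_, rfl, ?_⟩, ?_⟩
  · rw [hc k hk.le, if_pos hk]
  · rw [hc n le_rfl, if_neg (lt_irrefl _)]

theorem h_fml {A : ℕ → Prop} {F x y : ℕ} {v : ℕ → Bool}
    (hv : GoodVal (KAll A F x y) v) {n : ℕ} (φ : LA.BoundedFormula Empty n) : ∀ e : ℕ,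
    (@BoundedFormula.Realize LA (HM hv) (hstr hv) _ _ φ default (fun k : Fin n => hq hv (Nat.beta e k))) ↔
      v (vTR (cd φ) (pr n e)) = true := by
  letI := hstr hv
  induction φ with
  | @falsum n =>
    intro e
    refine ⟨fun h => h.elim, fun h => ?_⟩
    have := gv_tr hv (Or.inl ⟨pr n e, rfl, rfl, rfl, rfl⟩) h
    rw [hv.1] at this; cases this
  | equal t u =>
    intro e
    simp only [BoundedFormula.Realize, h_term hv, hq_eq]
    exact ⟨gv_tr hv (Or.inr (Or.inr (Or.inl ⟨_, _, _, rfl, rfl, rfl, rfl⟩))),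
      gv_tr hv (Or.inr (Or.inl ⟨_, _, _, rfl, rfl, rfl, rfl⟩))⟩
  | @rel n m R ts =>
    intro e
    match m, R, ts with
    | 2, R, ts =>
      change hl hv ((ts 0).realize _) ((ts 1).realize _) ↔ _
      rw [h_term hv, h_term hv]
      exact ⟨gv_tr hv (Or.inr (Or.inr (Or.inr (Or.inr ⟨_, _, _, rfl, rfl, rfl, rfl⟩)))),
        gv_tr hv (Or.inr (Or.inr (Or.inr (Or.inl ⟨_, _, _, rfl, rfl, rfl, rfl⟩))))⟩
  | @imp n f g ih1 ih2 =>
    intro e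
    simp only [BoundedFormula.Realize, ih1, ih2, cd]
    constructor
    · intro h
      rcases hv.2.2 1 1 (vTR (cd f) (pr n e)) (vTR (fimp (cd f) (cd g)) (pr n e))
        (Or.inr (Or.inr (Or.inr (Or.inl (Or.inr (Or.inl ⟨_, _, _, rfl, rfl, rfl, rfl⟩)))))) hv.2.1 hv.2.1 with h' | h'
      · exact gv_tr2 hv (Or.inr (Or.inr (Or.inl ⟨_, _, _, rfl, rfl, rfl, rfl⟩))) (h h') hv.2.1
      · exact h'
    · intro h h'
      exact gv_tr2 hv (Or.inl ⟨_, _, _, rfl, rfl, rfl, rfl⟩) h h'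
  | @all n f ih =>
    intro e
    have key : ∀ e', Agree n e e' →
        (Fin.snoc (fun k : Fin n => hq hv (Nat.beta e k)) (hq hv (Nat.beta e' n)) : Fin (n+1) → HM hv) =
          fun k : Fin (n+1) => hq hv (Nat.beta e' k) := by
      intro e' hA
      funext k
      refine Fin.lastCases ?_ (fun k => ?_) k
      · simp
      · obtain ⟨w, h1, h2⟩ := hA k k.2
        simp [h1, h2]
    simp only [BoundedFormula.Realize, cd]
    constructor
    · intro h
      obtain ⟨e', hA, hw⟩ := agree_ext hv n e (iwit (cd f) (pr n e))
      have h1 := h (hq hv (Nat.beta e' n))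
      rw [key e' hA, ih] at h1
      exact gv_tr2 hv (Or.inr (Or.inr (Or.inr (Or.inr ⟨_, _, _, _, hA, hw, rfl, rfl, rfl, rfl⟩)))) h1 hv.2.1
    · intro h z
      induction z using Quotient.inductionOn with | _ z =>
      obtain ⟨e', hA, hw⟩ := agree_ext hv n e z
      have h1 := gv_tr2 hv (Or.inr (Or.inr (Or.inr (Or.inl ⟨_, _, _, _, hA, rfl, rfl, rfl, rfl⟩)))) h hv.2.1
      rw [← ih, ← key e' hA, hw] at h1
      exact h1

theorem h_pt {A : ℕ → Prop} {F x y : ℕ} {v : ℕ → Bool}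
    (hv : GoodVal (KAll A F x y) v) {n : ℕ} (t : LA.Term (Empty ⊕ Fin n)) : ∀ L : List (TSym n),
    v (vPT n (Encodable.encode (t.listEncode ++ L)) (cdt t) (Encodable.encode L)) = true := by
  induction t with
  | var a =>
    intro L
    rcases a with a | k
    · exact a.elim
    · exact gv_pt hv (Or.inl ⟨_, _, _, _, k.2, rfl, rfl, rfl, rfl, rfl⟩) hv.2.1 hv.2.1
  | @func m f ts ih =>
    intro L
    match m, f, ts, ih with
    | 0, f, ts, ih => exact gv_pt hv (Or.inr (Or.inl ⟨_, _, _, rfl, rfl, rfl, rfl, rfl⟩)) hv.2.1 hv.2.1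
    | 1, f, ts, ih =>
      rw [le_succ]
      exact gv_pt hv (Or.inr (Or.inr (Or.inl ⟨_, _, _, _, _, rfl, rfl, rfl, rfl, rfl⟩))) (ih 0 L) hv.2.1
    | 2, f, ts, ih =>
      rw [le_bin, List.cons_append, List.append_assoc]
      match f with
      | false => exact gv_pt hv (Or.inr (Or.inr (Or.inr (Or.inl
          ⟨_, _, _, _, _, _, _, rfl, rfl, rfl, rfl, rfl⟩)))) (ih 0 _) (ih 1 L)
      | true => exact gv_pt hv (Or.inr (Or.inr (Or.inr (Or.inr
          ⟨_, _, _, _, _, _, _, rfl, rfl, rfl, rfl, rfl⟩)))) (ih 0 _) (ih 1 L)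

theorem h_pt0 {A : ℕ → Prop} {F x y : ℕ} {v : ℕ → Bool}
    (hv : GoodVal (KAll A F x y) v) {n : ℕ} (t : LA.Term (Empty ⊕ Fin n)) :
    v (vPT n (Encodable.encode t.listEncode) (cdt t) 0) = true := by
  have := h_pt hv t []
  rwa [List.append_nil] at this

theorem h_pf {A : ℕ → Prop} {F x y : ℕ} {v : ℕ → Bool}
    (hv : GoodVal (KAll A F x y) v) {n : ℕ} (t : LA.BoundedFormula Empty n) : ∀ L : List FSym,
    v (vPF n (Encodable.encode (t.listEncode ++ L)) (cd t) (Encodable.encode L)) = true := by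
  induction t with
  | falsum => intro L; exact gv_pf hv (Or.inl ⟨_, _, _, rfl, rfl, rfl, rfl, rfl⟩) hv.2.1 hv.2.1
  | equal t u =>
    intro L
    exact gv_pf2 hv (Or.inl ⟨_, _, _, _, _, _, _, ⟨_, _, _, rfl, rfl, rfl, rfl⟩, rfl, rfl, rfl, rfl⟩)
      (h_pt0 hv t) (h_pt0 hv u)
  | @rel n m R ts =>
    intro L
    match m, R, ts with
    | 2, R, ts =>
      rw [le_rel]
      exact gv_pf2 hv (Or.inr ⟨_, _, _, _, _, _, _, _, _, ⟨_, _, _, rfl, rfl, rfl, rfl⟩, rfl, rfl, rfl, rfl, rfl, rfl⟩)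
        (h_pt0 hv (ts 0)) (h_pt0 hv (ts 1))
  | imp f g ih1 ih2 =>
    intro L
    simp only [BoundedFormula.listEncode, List.cons_append, List.append_assoc]
    exact gv_pf hv (Or.inr (Or.inl ⟨_, _, _, _, _, _, _, rfl, rfl, rfl, rfl, rfl⟩)) (ih1 _) (ih2 L)
  | all f ih =>
    intro L
    exact gv_pf hv (Or.inr (Or.inr ⟨_, _, _, _, _, rfl, rfl, rfl, rfl, rfl⟩)) (ih L) hv.2.1

end Compl

section Compl2

theorem h_num {A : ℕ → Prop} {F x y : ℕ} {v : ℕ → Bool} (hv : GoodVal (KAll A F x y) v)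
    (P : PAM (HM hv)) (hP : @pamStr (HM hv) P = hstr hv) (j : ℕ) : (j : HM hv) = hq hv (inum j) := by
  induction j with
  | zero =>
    rw [Nat.cast_zero]
    have : (@rz (HM hv) (@pamStr (HM hv) P)) = 0 := rz_eq
    rw [← this, hP]; rfl
  | succ j ih =>
    rw [Nat.cast_succ, ih]
    have := fun x => @rs_eq (HM hv) P x
    rw [← this, hP]
    exact Eq.symm ((hq_eq hv).2 (gv_val hv (Or.inl ⟨_, rfl, rfl, rfl, rfl⟩)))

theorem model_of_good (T : Thy) (hT : ExtPA T) (φ : LA.BoundedFormula Empty 2) (x y : ℕ) (v : ℕ → Bool)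
    (hv : GoodVal (KAll (fun l => ∃ φ ∈ T, gnum φ = l) (cd φ) x y) v) :
    ∃ (M : Type) (_ : PAM M), M ⊨ T ∧ ¬ φ.Realize default (fun i : Fin 2 => ((![x, y] i : ℕ) : M)) := by
  have hMT : @Theory.Model LA (HM hv) (hstr hv) T := by
    letI := hstr hv
    refine ⟨fun ψ hψ => ?_⟩
    have h1 := h_pf hv ψ []
    rw [List.append_nil, enc_list_nil] at h1
    have h2 := gv_ax hv ⟨gnum ψ, _, ⟨ψ, hψ, rfl⟩, rfl, rfl, rfl, rfl⟩ h1
    have h3 := (h_fml hv ψ 0).2 h2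
    have e : (fun k : Fin 0 => hq hv (Nat.beta 0 k)) = default := Subsingleton.elim _ _
    rw [e] at h3
    unfold Sentence.Realize Formula.Realize
    convert h3
  haveI : Nonempty (HM hv) := ⟨hq hv 0⟩
  have hPA : @Theory.Model LA (HM hv) (hstr hv) PAAx := by
    letI := hstr hv
    exact ⟨fun ψ hψ => (hT ψ hψ).realize_sentence (HM hv)⟩
  letI := hstr hv
  have hS := structOf_mkPAM hPA
  refine ⟨HM hv, mkPAM hPA, ?_, ?_⟩
  · rw [show @pamStr (HM hv) (mkPAM hPA) = hstr hv from hS]; exact hMT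
  · rw [show @pamStr (HM hv) (mkPAM hPA) = hstr hv from hS]
    have hn := h_num hv (mkPAM hPA) hS
    obtain ⟨e, he⟩ := beta_exists (fun k => if k = 0 then inum x else inum y) 1
    have e0 := he 0 (by norm_num)
    have e1 := he 1 (by norm_num)
    have h1 := gv_q hv ⟨e, e0, e1, rfl, rfl, rfl, rfl⟩
    rw [ne_eq, ← h_fml hv φ e] at h1
    intro h
    apply h1
    convert h using 1
    funext i
    match i with
    | 0 => exact (congrArg _ e0).trans (hn x).symm
    | 1 => exact (congrArg _ e1).trans (hn y).symm

theorem re_of_n1 (T : Thy) (hT : ExtPA T) (hA : N1 1 (fun xs => ∃ φ ∈ T, gnum φ = xs 0)) : RE T := by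
  intro k Φ hΦ
  obtain ⟨⟨φ, -, hφ⟩, -⟩ := fml_of_sc hΦ
  refine (n1_unsat _ (n1_kall (fun l => ∃ φ ∈ T, gnum φ = l) hA (cd φ))).congr (fun xs => ?_)
  have e : ∀ M [PAM M], (fun i : Fin 2 => ((![xs 0, xs 1] i : ℕ) : M)) = fun i => (xs i : M) := by
    intro M _; funext i; match i with | 0 => rfl | 1 => rfl
  constructor
  · rintro h ⟨v, hv⟩
    obtain ⟨M, P, hM, h1⟩ := model_of_good T hT φ _ _ v hv
    apply h1
    rw [e, hφ]
    exact h M hM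
  · intro h M _ hM
    by_contra h1
    apply h
    refine good_of_model (M := M) T hM φ _ _ ?_
    rw [e, hφ]
    exact h1

theorem re_of_good (T : Thy) (h : GoodThy T) : RE T :=
  re_of_n1 T h.2.2 (n1_of_re h.1.to_re)

theorem re_add (T : Thy) (h : GoodThy T) (ψ : Snt) : RE (add T ψ) := by
  refine re_of_n1 _ (extPA_add h.2.2 ψ) ?_
  haveI := n1_of_re h.1.to_re
  have h0 : N1 1 (fun xs => xs 0 = gnum ψ ∨ ∃ φ ∈ T, gnum φ = xs 0) := inferInstance
  refine h0.congr (fun xs => ?_)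
  simp only [add, Set.mem_insert_iff]
  constructor
  · rintro ⟨φ, rfl | h, h2⟩
    · exact Or.inl h2.symm
    · exact Or.inr ⟨φ, h, h2⟩
  · rintro (h | ⟨φ, h, h2⟩)
    · exact ⟨ψ, Or.inl rfl, h.symm⟩
    · exact ⟨φ, Or.inr h, h2⟩

end Compl2

section Final

theorem sc_pi_snt {k : ℕ} {φ : Snt} (h : φ ∈ PiS k) : SC k 0 (fun M _ _ => ¬ M ⊨ φ) := by
  refine (sc_of_pi h).congr (fun M _ xs => ?_)
  rw [Subsingleton.elim xs default]
  rfl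

theorem pi_conj {k : ℕ} {U : Thy} (hU : ExtPA U) (S : Finset Snt) (hS : ∀ φ ∈ S, φ ∈ ThIn (PiS k) U) :
    ∃ θ ∈ PiS k, Prv U θ ∧ ∀ (M : Type) [PAM M], M ⊨ θ → ∀ φ ∈ S, M ⊨ φ := by
  classical
  induction S using Finset.induction_on with
  | empty =>
    obtain ⟨θ, h1, h2⟩ := pi_of_sc (k := k) (fun _ _ _ => False) inferInstance
    exact ⟨θ, h1, (prv_iff hU θ).2 (fun M _ _ => (h2 M).2 id), by simp⟩
  | insert a S ha ih =>
    obtain ⟨θ, h1, h2, h3⟩ := ih (fun φ hφ => hS φ (Finset.mem_insert_of_mem hφ))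
    obtain ⟨h4, h5⟩ := hS a (Finset.mem_insert_self _ _)
    haveI := sc_pi_snt h1
    haveI := sc_pi_snt h4
    obtain ⟨χ, h6, h7⟩ := pi_of_sc (k := k) (fun M _ _ => ¬ M ⊨ θ ∨ ¬ M ⊨ a) inferInstance
    refine ⟨χ, h6, (prv_iff hU χ).2 (fun M _ hM => (h7 M).2 ?_), fun M _ hM φ hφ => ?_⟩
    · have := (prv_iff hU θ).1 h2 M hM
      have := (prv_iff hU a).1 h5 M hM
      tauto
    · have h8 := (h7 M).1 hM
      rw [not_or, not_not, not_not] at h8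
      rcases Finset.mem_insert.1 hφ with rfl | h
      · exact h8.2
      · exact h3 M h8.1 φ h

theorem incon_pi {k : ℕ} {T U : Thy} (hU : ExtPA U) (h : ¬ Con (T ∪ ThIn (PiS k) U)) :
    ∃ θ ∈ PiS k, Prv U θ ∧ ∀ (M : Type) [PAM M], M ⊨ T → ¬ M ⊨ θ := by
  classical
  unfold Con at h
  rw [not_not] at h
  obtain ⟨T0, h0, h1⟩ := Theory.models_iff_finset_models.1 h
  obtain ⟨θ, a1, a2, a3⟩ := pi_conj (k := k) hU (T0.filter (· ∈ ThIn (PiS k) U)) (fun φ hφ => (Finset.mem_filter.1 hφ).2)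
  refine ⟨θ, a1, a2, fun M _ hM hθ => ?_⟩
  haveI : M ⊨ (T0 : Thy) := by
    refine ⟨fun φ hφ => ?_⟩
    rcases h0 hφ with h | h
    · exact hM.realize_of_mem φ h
    · exact a3 M hθ φ (Finset.mem_filter.2 ⟨hφ, h⟩)
  haveI : Nonempty M := ⟨(0 : M)⟩
  have : M ⊨ (⊥ : Snt) := Theory.ModelsBoundedFormula.realize_sentence h1 M
  exact this

theorem prv_Th {T : Thy} {φ : Snt} (hT : ExtPA T) : Prv (Th T) φ ↔ Prv T φ := by
  have h1 : ∀ ψ ∈ T, Prv T ψ := fun ψ hψ => Theory.models_sentence_of_mem hψ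
  have h2 : ExtPA (Th T) := extPA_mono (T' := Th T) (fun ψ hψ => h1 ψ hψ) hT
  rw [prv_iff hT, prv_iff h2]
  refine forall_congr' fun M => forall_congr' fun _ => ?_
  have : M ⊨ Th T ↔ M ⊨ T := by
    constructor
    · intro h; exact h.mono (fun ψ hψ => h1 ψ hψ)
    · intro h; exact ⟨fun ψ hψ => (prv_iff hT ψ).1 hψ M h⟩
  rw [this]

theorem two_three {T U : Thy} (hT : ExtPA T) {n : ℕ}
    (h : ∃ φ ∈ PiS n, ConsIn (SigmaS n) T φ ∧ ConsIn (SigmaS n) U φ ∧ φ ∉ Th U) :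
    ∃ φ : Snt, DeltaCons n T φ ∧ ∃ π ∈ PiS n, Prv (add T φ) π ∧ ¬ Prv U π := by
  obtain ⟨φ, h1, h2, -, h4⟩ := h
  refine ⟨φ, fun δ hδ hp => ?_, φ, h1, ?_, h4⟩
  · obtain ⟨⟨σ, hσ, he⟩, -⟩ := hδ
    rw [prv_Th hT, prv_iff hT] at he
    have he' : ∀ (M : Type) [PAM M], M ⊨ T → (M ⊨ δ ↔ M ⊨ σ) := fun M _ hM => by
      have := he M hM
      rwa [Sentence.Realize, Formula.realize_iff] at this
    have := h2 σ hσ ((prv_iff (extPA_add hT φ) σ).2 (fun M _ hM =>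
      (he' M (models_add.1 hM).1).1 ((prv_iff (extPA_add hT φ) δ).1 hp M hM)))
    exact (prv_iff hT δ).2 (fun M _ hM => (he' M hM).2 ((prv_iff hT σ).1 this M hM))
  · exact Theory.models_sentence_of_mem (Set.mem_insert _ _)

theorem one_two {T U : Thy} (hT : GoodThy T) (hU : GoodThy U) {k : ℕ}
    (h : ¬ ThIn (PiS (k+1)) T ⊆ Th U ∨ Con (T ∪ ThIn (PiS (k+1)) U)) :
    ∃ φ ∈ PiS (k+1), ConsIn (SigmaS (k+1)) T φ ∧ ConsIn (SigmaS (k+1)) U φ ∧ φ ∉ Th U := by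
  rcases h with h | h
  · rw [Set.not_subset] at h
    obtain ⟨π, ⟨h1, h2⟩, h3⟩ := h
    have hU' := extPA_add hU.2.2 (∼π)
    have rU' := re_add U hU (∼π)
    have hnot : ∀ (M : Type) [PAM M], M ⊨ (∼π : Snt) ↔ ¬ M ⊨ π := fun M _ => Sentence.realize_not M
    have hc : Con (add U (∼π) ∪ ThIn (PiS (k+1)) (add U (∼π))) := by
      rw [con_iff (extPA_mono Set.subset_union_left hU')]
      have h3' : ¬ Prv U π := h3
      rw [prv_iff hU.2.2] at h3'
      push Not at h3'
      obtain ⟨M, P, hM, hp⟩ := h3'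
      have hM' : M ⊨ add U (∼π) := models_add.2 ⟨hM, (hnot M).2 hp⟩
      refine ⟨M, P, ⟨fun ψ hψ => ?_⟩⟩
      rcases hψ with hψ | hψ
      · exact hM'.realize_of_mem ψ hψ
      · exact (prv_iff hU' ψ).1 hψ.2 M hM'
    obtain ⟨χ, c1, c2, -, c4⟩ := main_lemma _ _ hU' hU' rU' rU' k hc
    haveI := sc_pi_snt h1
    haveI := sc_pi_snt c1
    obtain ⟨φ, f1, f2⟩ := pi_of_sc (k := k+1) (fun M _ _ => ¬ M ⊨ π ∧ ¬ M ⊨ χ) inferInstance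
    have f3 : ∀ (M : Type) [PAM M], M ⊨ φ ↔ (M ⊨ π ∨ M ⊨ χ) := fun M _ => by rw [f2]; tauto
    refine ⟨φ, f1, fun γ hγ hp => ?_, fun γ hγ hp => ?_, fun hp => ?_⟩
    · rw [prv_iff (extPA_add hT.2.2 φ)] at hp
      rw [prv_iff hT.2.2]
      intro M _ hM
      exact hp M (models_add.2 ⟨hM, (f3 M).2 (Or.inl ((prv_iff hT.2.2 π).1 h2 M hM))⟩)
    · rw [prv_iff (extPA_add hU.2.2 φ)] at hp
      have := c2 γ hγ ((prv_iff (extPA_add hU' χ) γ).2 (fun M _ hM => by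
        obtain ⟨m1, m2⟩ := models_add.1 hM
        exact hp M (models_add.2 ⟨(models_add.1 m1).1, (f3 M).2 (Or.inr m2)⟩)))
      rw [prv_iff hU'] at this
      rw [prv_iff hU.2.2]
      intro M _ hM
      by_cases hπ : M ⊨ π
      · exact hp M (models_add.2 ⟨hM, (f3 M).2 (Or.inl hπ)⟩)
      · exact this M (models_add.2 ⟨hM, (hnot M).2 hπ⟩)
    · apply c4
      have hp' : Prv U φ := hp
      rw [prv_iff hU.2.2] at hp'
      rw [prv_iff hU']
      intro M _ hM
      obtain ⟨m1, m2⟩ := models_add.1 hM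
      rcases (f3 M).1 (hp' M m1) with h | h
      · exact absurd h ((hnot M).1 m2)
      · exact h
  · obtain ⟨θ, h1, h2, h3, h4⟩ := main_lemma T U hT.2.2 hU.2.2 (re_of_good T hT) (re_of_good U hU) k h
    exact ⟨θ, h1, h2, h3, h4⟩

theorem three_one {T U : Thy} (hT : ExtPA T) (hU : ExtPA U) {k : ℕ}
    (h : ∃ φ : Snt, DeltaCons (k+1) T φ ∧ ∃ π ∈ PiS (k+1), Prv (add T φ) π ∧ ¬ Prv U π) :
    ¬ ThIn (PiS (k+1)) T ⊆ Th U ∨ Con (T ∪ ThIn (PiS (k+1)) U) := by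
  obtain ⟨φ, h1, π, h2, h3, h4⟩ := h
  by_contra hc
  rw [not_or, not_not] at hc
  obtain ⟨c1, c2⟩ := hc
  obtain ⟨θ, t1, t2, t3⟩ := incon_pi hU c2
  obtain ⟨Q1, q1, q2⟩ := sc_succ.1 (sc_pi_snt h2)
  obtain ⟨Q2, r1, r2⟩ := sc_succ.1 (sc_pi_snt t1)
  have s1 : SC k 1 (fun M _ xs => Q1 M default (xs 0)) := by
    exact q1.congr (fun M _ xs => by rw [show default = (fun i => xs (Fin.castSucc i)) from Subsingleton.elim _ _]; rfl)
  have s2 : SC k 1 (fun M _ xs => Q2 M default (xs 0)) := by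
    exact r1.congr (fun M _ xs => by rw [show default = (fun i => xs (Fin.castSucc i)) from Subsingleton.elim _ _]; rfl)
  have d1 : ∀ (M : Type) [PAM M], M ⊨ π ↔ ∀ y, Q1 M default y := fun M _ => by
    have := q2 M default; rw [← not_iff_not, this]; push Not; rfl
  have d2 : ∀ (M : Type) [PAM M], M ⊨ θ ↔ ∀ y, Q2 M default y := fun M _ => by
    have := r2 M default; rw [← not_iff_not, this]; push Not; rfl
  haveI i1 : ∀ {m} (t : UFun m) [Tm m t], SC (k+1) m (fun M _ xs => Q1 M default (t M xs)) :=
    fun t ht => sc_mono1 _ (sc_subst _ s1 (fun _ => t) (fun _ => ht))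
  haveI i2 : ∀ {m} (t : UFun m) [Tm m t], SC (k+1) m (fun M _ xs => Q2 M default (t M xs)) :=
    fun t ht => sc_mono1 _ (sc_subst _ s2 (fun _ => t) (fun _ => ht))
  haveI i3 : ∀ {m} (t : UFun m) [Tm m t], SC (k+1) m (fun M _ xs => ¬ Q1 M default (t M xs)) :=
    fun t ht => sc_not _ (sc_subst _ s1 (fun _ => t) (fun _ => ht))
  haveI i4 : ∀ {m} (t : UFun m) [Tm m t], SC (k+1) m (fun M _ xs => ¬ Q2 M default (t M xs)) :=
    fun t ht => sc_not _ (sc_subst _ s2 (fun _ => t) (fun _ => ht))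
  obtain ⟨δ, e1, e2⟩ := pi_of_sc (k := k+1)
    (fun M _ _ => ∃ x, ¬ Q1 M default x ∧ ∀ y, y ≤ x → Q2 M default y) inferInstance
  obtain ⟨σ, g1, g2⟩ := (fml_of_sc (k := k+1) (m := 0)
    (R := fun M _ _ => ∃ x, ¬ Q2 M default x ∧ ∀ y, y ≤ x → (Q1 M default y ∨ y = x)) inferInstance).1
  have g3 : ∀ (M : Type) [PAM M], M ⊨ (σ : Snt) ↔ _ := fun M _ => g2 M default
  have key : ∀ (M : Type) [PAM M], M ⊨ T → (M ⊨ δ ↔ M ⊨ (σ : Snt)) := by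
    intro M _ hM
    have hθ := t3 M hM
    rw [d2] at hθ
    push Not at hθ
    rw [e2, g3]
    haveI : Dfn M (fun x => ¬ Q2 M default x) :=
      fm_of_sc (M := M) (l := 1) _ (sc_not _ s2) (fun i xs => xs i) (fun i => inferInstance)
    constructor
    · intro hd
      obtain ⟨x, hx, hm⟩ := pam_least (fun x => ¬ Q2 M default x) hθ
      refine ⟨x, hx, fun y hy => ?_⟩
      by_contra hcon
      rw [not_or] at hcon
      refine hd ⟨y, hcon.1, fun z hz => ?_⟩
      exact not_not.1 (hm z (hz.trans_lt (lt_of_le_of_ne hy hcon.2)))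
    · rintro ⟨x, hx, hy⟩ ⟨z, hz, hw⟩
      rcases le_total x z with hxz | hxz
      · exact hx (hw x hxz)
      · rcases hy z hxz with h | rfl
        · exact hz h
        · exact hx (hw _ le_rfl)
  have hδ : Prv T δ := by
    refine h1 δ ⟨⟨σ, g1, ?_⟩, ⟨δ, e1, ?_⟩⟩ ?_
    · rw [prv_Th hT, prv_iff hT]
      intro M _ hM
      rw [Sentence.Realize, Formula.realize_iff]
      exact key M hM
    · rw [prv_Th hT, prv_iff hT]
      intro M _ hM
      rw [Sentence.Realize, Formula.realize_iff]
    · rw [prv_iff (extPA_add hT φ)] at h3 ⊢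
      intro M _ hM
      rw [e2]
      rintro ⟨x, hx, -⟩
      exact hx ((d1 M).1 (h3 M hM) x)
  have hδU : Prv U δ := c1 ⟨e1, hδ⟩
  apply h4
  rw [prv_iff hU] at hδU t2 ⊢
  intro M _ hM
  have a := hδU M hM
  have b := (d2 M).1 (t2 M hM)
  rw [e2] at a
  rw [d1]
  intro y
  by_contra hy
  exact a ⟨y, hy, fun z _ => b z⟩
end Final

/-- Theorem 4.5 (refinement of Bennet's characterization for `Σ_n`-conservativity). -/
theorem stmt_3 (T U : Thy) (hT : GoodThy T) (hU : GoodThy U) (n : ℕ) (hn : 1 ≤ n) :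
    List.TFAE
      [¬ ThIn (PiS n) T ⊆ Th U ∨ Con (T ∪ ThIn (PiS n) U),
       ∃ φ ∈ PiS n, ConsIn (SigmaS n) T φ ∧ ConsIn (SigmaS n) U φ ∧ φ ∉ Th U,
       ∃ φ : Snt, DeltaCons n T φ ∧ ∃ π ∈ PiS n, Prv (add T φ) π ∧ ¬ Prv U π] := by
  obtain ⟨k, rfl⟩ : ∃ k, n = k + 1 := ⟨n - 1, by omega⟩
  tfae_have 1 → 2 := one_two hT hU
  tfae_have 2 → 3 := two_three hT.2.2
  tfae_have 3 → 1 := three_one hT.2.2 hU.2.2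
  tfae_finish

end Guaspari
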